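/- arXiv:1506.02766 — 6 statements merged into one kernel-verified Lean document; each statement's English description precedes it below -/
import Mathlib

section
/- Let R be a ring, let Γ be a countable directed set, let {V_γ}_{γ∈Γ} be a directed system of R-modules in which all transition maps V_γ → V_{γ′} (for γ ≤ γ′) are injective, and let W be an R-module. If Ext^i_R(V_γ, W) = 0 for all i ≥ 0 and all γ ∈ Γ, then Ext^i_R(colim_γ V_γ, W) = 0 for all i ≥ 0. -/
open CategoryTheory CategoryTheory.Limits

section ExtCoproduct

universe w v u

variable {C : Type u} [Category.{v} C] [Abelian C] [HasExt.{w} C]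

/-- Dimension shifting: if `S` is short exact with `S.X₂` injective, then `Ext X S.X₃ (n + 1)`
vanishes as soon as `Ext X S.X₁ (n + 2)` does. -/
lemma CategoryTheory.Abelian.Ext.subsingleton_of_shortExact_of_injective
    {S : ShortComplex C} (hS : S.ShortExact) [Injective S.X₂] {X : C} {n : ℕ}
    (h : Subsingleton (Abelian.Ext.{w} X S.X₁ (n + 2))) :
    Subsingleton (Abelian.Ext.{w} X S.X₃ (n + 1)) := by
  refine subsingleton_of_forall_eq 0 fun x ↦ ?_
  obtain ⟨y, rfl⟩ := Abelian.Ext.covariant_sequence_exact₃ X hS x rfl (Subsingleton.elim _ _)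
  rw [Abelian.Ext.eq_zero_of_injective y, Abelian.Ext.zero_comp]

/-- If `Ext (X j) Y n` vanishes for all `j`, so does `Ext c.pt Y n` for a coproduct `c.pt`
of the family `X`. -/
lemma CategoryTheory.Abelian.Ext.subsingleton_of_isColimit_cofan [EnoughInjectives C]
    {J : Type*} {X : J → C} {c : Cofan X} (hc : IsColimit c) (Y : C) (n : ℕ)
    (h : ∀ j, Subsingleton (Abelian.Ext.{w} (X j) Y n)) :
    Subsingleton (Abelian.Ext.{w} c.pt Y n) := by
  induction n generalizing Y with
  | zero =>
    refine Abelian.Ext.homEquiv₀.subsingleton_congr.2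
      ⟨fun f g ↦ Cofan.IsColimit.hom_ext hc _ _ fun j ↦ ?_⟩
    have := Abelian.Ext.homEquiv₀.subsingleton_congr.1 (h j)
    exact Subsingleton.elim _ _
  | succ n ih =>
    let S := ShortComplex.mk (Injective.ι Y) (cokernel.π (Injective.ι Y)) (by simp)
    have hS : S.ShortExact :=
      { exact := ShortComplex.exact_cokernel _
        mono_f := inferInstanceAs (Mono (Injective.ι Y))
        epi_g := inferInstanceAs (Epi (cokernel.π _)) }
    have : Injective S.X₂ := inferInstanceAs (Injective (Injective.under Y))
    refine subsingleton_of_forall_eq 0 fun e ↦ ?_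
    obtain ⟨x, rfl⟩ := Abelian.Ext.covariant_sequence_exact₁ c.pt hS e
      (Abelian.Ext.eq_zero_of_injective _) rfl
    cases n with
    | zero =>
      obtain ⟨φ, rfl⟩ := Abelian.Ext.homEquiv₀.symm.surjective x
      have hφ (j : J) : ∃ ψ : X j ⟶ S.X₂, ψ ≫ S.g = c.inj j ≫ φ := by
        obtain ⟨y, hy⟩ := Abelian.Ext.covariant_sequence_exact₃ (X j) hS
          (Abelian.Ext.mk₀ (c.inj j ≫ φ)) rfl (@Subsingleton.elim _ (h j) _ _)
        obtain ⟨ψ, rfl⟩ := Abelian.Ext.homEquiv₀.symm.surjective y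
        refine ⟨ψ, (Abelian.Ext.mk₀_bijective _ _).1 ?_⟩
        rw [← hy, ← Abelian.Ext.mk₀_comp_mk₀]
        rfl
      choose ψ hψ using hφ
      obtain rfl : φ = Cofan.IsColimit.desc hc ψ ≫ S.g :=
        Cofan.IsColimit.hom_ext hc _ _ fun j ↦ by simp [← hψ]
      change (Abelian.Ext.mk₀ _).comp _ _ = 0
      rw [← Abelian.Ext.mk₀_comp_mk₀, Abelian.Ext.comp_assoc _ _ _ _ (zero_add 1) (by simp),
        hS.comp_extClass, Abelian.Ext.comp_zero]
    | succ n =>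
      have := ih S.X₃ fun j ↦ Abelian.Ext.subsingleton_of_shortExact_of_injective hS (h j)
      rw [Subsingleton.elim x 0, Abelian.Ext.zero_comp]

end ExtCoproduct

section Telescope

universe v u

variable {C : Type u} [Category.{v} C] [Preadditive C] (G : ℕ ⥤ C) [HasCoproduct G.obj]

namespace CategoryTheory.Limits

/-- The endomorphism `1 - shift` of the coproduct of the terms of a sequential diagram. -/
noncomputable def telescopeMap : ∐ G.obj ⟶ ∐ G.obj :=
  Sigma.desc fun n ↦ Sigma.ι G.obj n - G.map (homOfLE n.le_succ) ≫ Sigma.ι G.obj (n + 1)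

@[simp]
lemma ι_telescopeMap (n : ℕ) : Sigma.ι G.obj n ≫ telescopeMap G =
    Sigma.ι G.obj n - G.map (homOfLE n.le_succ) ≫ Sigma.ι G.obj (n + 1) := by
  simp [telescopeMap]

@[simp]
lemma ι_telescopeMap_assoc (n : ℕ) {A : C} (k : ∐ G.obj ⟶ A) :
    Sigma.ι G.obj n ≫ telescopeMap G ≫ k =
      (Sigma.ι G.obj n - G.map (homOfLE n.le_succ) ≫ Sigma.ι G.obj (n + 1)) ≫ k := by
  rw [← Category.assoc, ι_telescopeMap]

variable {G}

/-- The short complex `∐ G.obj ⟶ ∐ G.obj ⟶ c.pt` attached to a cocone `c` over `G : ℕ ⥤ C`. -/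
noncomputable abbrev telescope (c : Cocone G) : ShortComplex C :=
  ShortComplex.mk (telescopeMap G) (Sigma.desc c.ι.app) (Sigma.hom_ext _ _ fun n ↦ by simp)

/-- The colimit of a sequential diagram is the cokernel of `1 - shift`. -/
noncomputable def telescopeIsCokernel {c : Cocone G} (hc : IsColimit c) :
    IsColimit (CokernelCofork.ofπ (telescope c).g (telescope c).zero) :=
  have key {A : C} (k : ∐ G.obj ⟶ A) (hk : telescopeMap G ≫ k = 0) (n : ℕ) :
      G.map (homOfLE n.le_succ) ≫ Sigma.ι G.obj (n + 1) ≫ k = Sigma.ι G.obj n ≫ k := by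
    have := Sigma.ι G.obj n ≫= hk
    rw [ι_telescopeMap_assoc, Preadditive.sub_comp, comp_zero, sub_eq_zero, Category.assoc] at this
    exact this.symm
  CokernelCofork.IsColimit.ofπ _ _
    (fun k hk ↦ hc.desc ⟨_, NatTrans.ofSequence (fun n ↦ Sigma.ι G.obj n ≫ k)
      (fun n ↦ by simpa using key k hk n)⟩)
    (fun k hk ↦ Sigma.hom_ext _ _ fun n ↦ by simp [hc.fac])
    (fun k hk m hm ↦ hc.hom_ext fun n ↦ by simp [hc.fac, ← hm])

variable (G) in
/-- `1 - shift` is a monomorphism as soon as the projections of the coproduct are jointly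
monomorphic. -/
lemma mono_telescopeMap
    (h : ∀ {A : C} (f : A ⟶ ∐ G.obj), (∀ n, f ≫ Sigma.π G.obj n = 0) → f = 0) :
    Mono (telescopeMap G) := by
  have h₀ : telescopeMap G ≫ Sigma.π G.obj 0 = Sigma.π G.obj 0 :=
    Sigma.hom_ext _ _ fun n ↦ by
      simp [Sigma.ι_π_of_ne G.obj (show n + 1 ≠ 0 by lia)]
  have h₁ (m : ℕ) : telescopeMap G ≫ Sigma.π G.obj (m + 1) =
      Sigma.π G.obj (m + 1) - Sigma.π G.obj m ≫ G.map (homOfLE m.le_succ) :=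
    Sigma.hom_ext _ _ fun n ↦ by
      obtain rfl | hn := eq_or_ne n m
      · simp
      · simp [Sigma.ι_π_of_ne G.obj (show n + 1 ≠ m + 1 by lia),
          Sigma.ι_π_of_ne_assoc G.obj hn]
  refine Preadditive.mono_of_cancel_zero _ fun f hf ↦ h f fun n ↦ ?_
  induction n with
  | zero => rw [← h₀, ← Category.assoc, hf, zero_comp]
  | succ n ih =>
    have := f ≫= h₁ n
    rw [← Category.assoc, hf, zero_comp, Preadditive.comp_sub, ← Category.assoc f, ih, zero_comp,
      sub_zero] at this
    exact this.symm

end CategoryTheory.Limits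

end Telescope

section ModuleCat

universe v u

variable {R : Type u} [Ring R]

/-- The projections of a coproduct of modules are jointly monomorphic. -/
lemma ModuleCat.eq_zero_of_comp_sigmaπ {J : Type} [DecidableEq J] {Z : J → ModuleCat.{v} R}
    {A : ModuleCat.{v} R} (f : A ⟶ ∐ Z) (h : ∀ j, f ≫ Sigma.π Z j = 0) : f = 0 := by
  have hπ (j : J) : Sigma.π Z j = (ModuleCat.coprodIsoDirectSum.{u, 0, v} Z).hom ≫
      ModuleCat.ofHom (DirectSum.component R J (fun i ↦ Z i) j) := by
    refine Sigma.hom_ext _ _ fun i ↦ ?_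
    rw [← Category.assoc, ModuleCat.ι_coprodIsoDirectSum_hom.{u, 0, v}, Sigma.ι_π]
    ext x
    obtain rfl | hij := eq_or_ne i j
    · simp
    · simp [DirectSum.component.of, hij]
  rw [← cancel_mono (ModuleCat.coprodIsoDirectSum.{u, 0, v} Z).hom, zero_comp]
  ext x j
  have := ConcreteCategory.congr_hom (h j) x
  rw [hπ] at this
  simpa using! this

/-- The telescope short exact sequence of a sequential colimit of modules. -/
lemma ModuleCat.shortExact_telescope {G : ℕ ⥤ ModuleCat.{v} R} {c : Cocone G} (hc : IsColimit c) :
    (telescope c).ShortExact where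
  exact := ShortComplex.exact_of_g_is_cokernel _ (telescopeIsCokernel hc)
  mono_f := mono_telescopeMap G fun f hf ↦ ModuleCat.eq_zero_of_comp_sigmaπ f hf
  epi_g := Cofork.IsColimit.epi (telescopeIsCokernel hc)

/-- If `Ext (G.obj n) W i` vanishes for all `n` and `i`, then `Ext c.pt W i` vanishes for all `i`,
where `c.pt` is the colimit of the sequential diagram `G` of modules. -/
lemma ModuleCat.subsingleton_ext_of_isColimit_nat [Small.{v} R] [HasExt (ModuleCat.{v} R)]
    {G : ℕ ⥤ ModuleCat.{v} R} {c : Cocone G} (hc : IsColimit c) (W : ModuleCat.{v} R)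
    (h : ∀ i n, Subsingleton (Abelian.Ext (G.obj n) W i)) (i : ℕ) :
    Subsingleton (Abelian.Ext c.pt W i) := by
  have hcoprod (i : ℕ) : Subsingleton (Abelian.Ext (∐ G.obj) W i) :=
    Abelian.Ext.subsingleton_of_isColimit_cofan (coproductIsCoproduct G.obj) W i (h i)
  have hS := ModuleCat.shortExact_telescope hc
  cases i with
  | zero =>
    have := hS.epi_g
    exact (Abelian.Ext.precomp_mk₀_injective_of_epi W (telescope c).g).subsingleton
  | succ i =>
    refine subsingleton_of_forall_eq 0 fun e ↦ ?_
    obtain ⟨x, rfl⟩ := Abelian.Ext.contravariant_sequence_exact₃ hS W e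
      (@Subsingleton.elim _ (hcoprod _) _ _) (add_comm 1 i)
    rw [@Subsingleton.elim _ (hcoprod i) x 0, Abelian.Ext.comp_zero]

end ModuleCat

/-- Let `R` be a ring, `Γ` a countable directed set, `{V_γ}` a directed
system of `R`-modules with injective transition maps, and `W` an `R`-module.  If
`Ext^i_R(V_γ, W) = 0` for all `i ≥ 0` and all `γ`, then `Ext^i_R(colim V_γ, W) = 0` for all
`i ≥ 0`. -/
theorem ext_vanishing_of_countable_injective_directed_system
    (R : Type) [Ring R]
    (Γ : Type) [PartialOrder Γ] [Countable Γ] [IsDirected Γ (· ≤ ·)]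
    (F : Γ ⥤ ModuleCat R)
    (hinj : ∀ {γ γ' : Γ} (h : γ ⟶ γ'), Function.Injective (F.map h))
    (W : ModuleCat R) :
    letI := HasDerivedCategory.standard (ModuleCat R)
    haveI : HasExt (ModuleCat R) := hasExt_of_hasDerivedCategory _
    (∀ (i : ℕ) (γ : Γ), Subsingleton (Abelian.Ext (F.obj γ) W i)) →
      ∀ i : ℕ, Subsingleton (Abelian.Ext (colimit F) W i) := by
  let := HasDerivedCategory.standard (ModuleCat R)
  have : HasExt (ModuleCat R) := hasExt_of_hasDerivedCategory _
  intro h i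
  cases isEmpty_or_nonempty Γ with
  | inl _ =>
    have h₀ : IsZero (colimit F) :=
      (IsZero.iff_id_eq_zero _).2 (colimit.hom_ext fun γ ↦ isEmptyElim γ)
    refine subsingleton_of_forall_eq 0 fun e ↦ ?_
    rw [← e.mk₀_id_comp, h₀.eq_zero_of_src (𝟙 _), Abelian.Ext.mk₀_zero, Abelian.Ext.zero_comp]
  | inr _ =>
    exact ModuleCat.subsingleton_ext_of_isColimit_nat
      ((Functor.Final.isColimitWhiskerEquiv (IsFiltered.sequentialFunctor Γ) _).symm
        (colimit.isColimit F)) W (fun i _ ↦ h i _) i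
end

section
/- Let Λ be a finitely generated free abelian group and let V₁ and V₂ be two representations of Λ on complex vector spaces (equivalently, modules over the group algebra ℂ[Λ]). Assume there exist two distinct characters χ₁ ≠ χ₂ : Λ → ℂ^× such that both V₁⊗χ₁⁻¹ and V₂⊗χ₂⁻¹ are locally unipotent as representations of Λ. Then Ext^i_{ℂ[Λ]}(V₁, V₂) = 0 for all i ≥ 0. -/
open CategoryTheory

/-- The representation of `Λ` on the `ℂ[Λ]`-module `V`, twisted by `χ⁻¹`, is locally
unipotent: every vector is killed by some product `(g₀−1)(g₁−1)⋯(g_k−1)` of twisted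
translation operators `g·v = χ(g)⁻¹ (g·v)`. -/
def IsLocallyUnipotentTwist (Λ : Type*) [CommGroup Λ] (V : Type*) [AddCommGroup V]
    [Module (MonoidAlgebra ℂ Λ) V] (χ : Λ →* ℂˣ) : Prop :=
  ∀ v : V, ∃ k : ℕ, ∀ l : List Λ, l.length = k + 1 →
    l.foldr (fun g w =>
      algebraMap ℂ (MonoidAlgebra ℂ Λ) (((χ g)⁻¹ : ℂˣ) : ℂ) • (MonoidAlgebra.of ℂ Λ g • w) - w)
      v = 0

universe w u

section

variable {R : Type u} [CommRing R] (a : R)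

/-- If every vector of `X` is killed by a power of `a`, then all Ext groups from `X` into a module
over the localization of `R` away from `a` vanish. -/
lemma ext_subsingleton_of_torsion_of_away [HasExt.{w} (ModuleCat.{u} R)]
    (X : ModuleCat.{u} R) (hX : ∀ x : X, ∃ n : ℕ, a ^ n • x = 0) (i : ℕ)
    (M : ModuleCat.{u} (Localization (Submonoid.powers a))) :
    Subsingleton (Abelian.Ext X
      ((ModuleCat.restrictScalars
        (algebraMap R (Localization (Submonoid.powers a)))).obj M) i) := by
  let φ := algebraMap R (Localization (Submonoid.powers a))
  induction i generalizing M with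
  | zero =>
    have : Subsingleton (X ⟶ (ModuleCat.restrictScalars φ).obj M) := by
      refine subsingleton_of_forall_eq 0 fun f => ?_
      ext x
      obtain ⟨n, hn⟩ := hX x
      have h : φ (a ^ n) • (show M from f x) = 0 := by
        change a ^ n • f x = 0
        rw [← map_smul, hn, map_zero]
      have hu : IsUnit (φ (a ^ n)) :=
        IsLocalization.map_units (Localization (Submonoid.powers a))
          (⟨a ^ n, n, rfl⟩ : Submonoid.powers a)
      exact hu.smul_eq_zero.mp h
    exact Abelian.Ext.homEquiv₀.subsingleton
  | succ i ih =>
    have hφ : φ.Flat :=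
      RingHom.flat_algebraMap_iff.mpr (IsLocalization.flat _ (Submonoid.powers a))
    have := ModuleCat.preservesFiniteLimits_extendScalars_of_flat hφ
    have : Injective ((ModuleCat.restrictScalars φ).obj (Injective.under M)) :=
      Injective.injective_of_adjoint (ModuleCat.extendRestrictScalarsAdj φ) _
    let S : ShortComplex (ModuleCat (Localization (Submonoid.powers a))) :=
      ShortComplex.mk (Injective.ι M) (Limits.cokernel.π (Injective.ι M)) (by simp)
    have hS : S.ShortExact :=
      { exact := ShortComplex.exact_cokernel _
        mono_f := inferInstanceAs (Mono (Injective.ι M))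
        epi_g := inferInstanceAs (Epi (Limits.cokernel.π (Injective.ι M))) }
    have hS' := hS.map_of_exact (ModuleCat.restrictScalars φ)
    refine subsingleton_of_forall_eq 0 fun e => ?_
    obtain ⟨y, rfl⟩ := Abelian.Ext.covariant_sequence_exact₁ X hS' e
      (Abelian.Ext.eq_zero_of_injective
        (I := (ModuleCat.restrictScalars φ).obj (Injective.under M)) _) rfl
    have : Subsingleton (Abelian.Ext X (S.map (ModuleCat.restrictScalars φ)).X₃ i) := ih S.X₃
    rw [show y = 0 from Subsingleton.elim _ _]
    exact Abelian.Ext.zero_comp ..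

lemma CategoryTheory.Abelian.Ext.subsingleton_of_iso {C : Type*} [Category* C] [Abelian C]
    [HasExt.{w} C] (X : C) {Y Z : C} (e : Y ≅ Z) (i : ℕ) [Subsingleton (Abelian.Ext X Z i)] :
    Subsingleton (Abelian.Ext X Y i) := by
  refine subsingleton_of_forall_eq 0 fun x => ?_
  rw [← x.comp_mk₀_id, ← e.hom_inv_id, ← mk₀_comp_mk₀, ← comp_assoc_of_second_deg_zero,
    show x.comp (mk₀ e.hom) (add_zero i) = 0 from Subsingleton.elim _ _, zero_comp]

/-- If `a` is locally nilpotent on `V` and bijective on `W`, then all Ext groups from `V` to `W`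
vanish. -/
lemma ext_subsingleton_of_torsion_of_bijective [HasExt.{w} (ModuleCat.{u} R)]
    (V W : Type u) [AddCommGroup V] [AddCommGroup W] [Module R V] [Module R W]
    (hV : ∀ v : V, ∃ n : ℕ, a ^ n • v = 0) (hW : Function.Bijective fun v : W => a • v) (i : ℕ) :
    Subsingleton (Abelian.Ext (ModuleCat.of R V) (ModuleCat.of R W) i) := by
  let S := Submonoid.powers a
  have hu : IsUnit (algebraMap R (Module.End R W) a) := (Module.End.isUnit_iff _).mpr hW
  have : IsLocalizedModule S (LinearMap.id : W →ₗ[R] W) :=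
    { map_units := by
        rintro ⟨_, n, rfl⟩
        simpa using hu.pow n
      surj := fun y => ⟨(y, 1), one_smul _ _⟩
      exists_of_eq := fun h => ⟨1, congrArg _ h⟩ }
  let e : W ≃ₗ[R] LocalizedModule S W := (IsLocalizedModule.iso S LinearMap.id).symm
  let M := (ModuleCat.restrictScalars (algebraMap R (Localization S))).obj
    (ModuleCat.of _ (LocalizedModule S W))
  let e' : W ≃ₗ[R] M :=
    { e with
      map_smul' := fun r x =>
        (map_smul e r x).trans (algebraMap_smul (Localization S) r (e x)).symm }
  have := ext_subsingleton_of_torsion_of_away a (ModuleCat.of R V) hV i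
    (ModuleCat.of _ (LocalizedModule S W))
  exact Abelian.Ext.subsingleton_of_iso _ (e'.toModuleIso (X₁ := ModuleCat.of R W)) i

lemma bijective_smul_of_isCoprime {W : Type*} [AddCommGroup W] [Module R W] {a b : R}
    (hab : IsCoprime a b) (hW : ∀ v : W, ∃ n : ℕ, b ^ n • v = 0) :
    Function.Bijective fun v : W => a • v := by
  constructor
  · refine (injective_iff_map_eq_zero (DistribSMul.toAddMonoidHom W a)).mpr fun v hv => ?_
    obtain ⟨n, hn⟩ := hW v
    obtain ⟨p, q, h⟩ := hab.pow_right (n := n)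
    rw [← one_smul R v, ← h, add_smul, mul_smul, mul_smul, hn]
    simp_all
  · intro v
    obtain ⟨n, hn⟩ := hW v
    obtain ⟨p, q, h⟩ := hab.pow_right (n := n)
    refine ⟨p • v, ?_⟩
    conv_rhs => rw [← one_smul R v, ← h, add_smul, mul_smul q, hn]
    simp [smul_smul, mul_comm]

end

/-- The element of `ℂ[Λ]` acting as `g - 1` on the twist by `χ⁻¹`. -/
noncomputable def twistedSubOne {Λ : Type*} [CommGroup Λ] (χ : Λ →* ℂˣ) (g : Λ) :
    MonoidAlgebra ℂ Λ :=
  algebraMap ℂ (MonoidAlgebra ℂ Λ) (((χ g)⁻¹ : ℂˣ) : ℂ) * MonoidAlgebra.of ℂ Λ g - 1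

lemma IsLocallyUnipotentTwist.exists_pow_smul_eq_zero {Λ : Type*} [CommGroup Λ] {V : Type*}
    [AddCommGroup V] [Module (MonoidAlgebra ℂ Λ) V] {χ : Λ →* ℂˣ}
    (h : IsLocallyUnipotentTwist Λ V χ) (g : Λ) (v : V) :
    ∃ n : ℕ, twistedSubOne χ g ^ n • v = 0 := by
  obtain ⟨k, hk⟩ := h v
  refine ⟨k + 1, ?_⟩
  rw [← hk (List.replicate (k + 1) g) List.length_replicate]
  generalize k + 1 = n
  induction n with
  | zero => simp
  | succ n ih =>
    rw [pow_succ', mul_smul, ih, List.replicate_succ, List.foldr_cons, twistedSubOne, sub_smul,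
      mul_smul, one_smul]

lemma isCoprime_twistedSubOne {Λ : Type*} [CommGroup Λ] {χ₁ χ₂ : Λ →* ℂˣ} {g : Λ}
    (hg : χ₁ g ≠ χ₂ g) : IsCoprime (twistedSubOne χ₁ g) (twistedSubOne χ₂ g) := by
  have hd : (χ₂ g : ℂ) - χ₁ g ≠ 0 := sub_ne_zero.mpr fun h => hg (Units.ext h.symm)
  let A := algebraMap ℂ (MonoidAlgebra ℂ Λ)
  have hA (c : ℂˣ) : A c * A ((c⁻¹ : ℂˣ) : ℂ) = 1 := by
    rw [← map_mul, Units.mul_inv, map_one]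
  have hd' : A ((χ₂ g : ℂ) - χ₁ g)⁻¹ * (A (χ₂ g) - A (χ₁ g)) = 1 := by
    rw [← map_sub, ← map_mul, inv_mul_cancel₀ hd, map_one]
  refine ⟨A ((χ₂ g : ℂ) - χ₁ g)⁻¹ * A (χ₁ g), -(A ((χ₂ g : ℂ) - χ₁ g)⁻¹ * A (χ₂ g)), ?_⟩
  unfold twistedSubOne
  linear_combination hd' +
    A ((χ₂ g : ℂ) - χ₁ g)⁻¹ * MonoidAlgebra.of ℂ Λ g * (hA (χ₁ g) - hA (χ₂ g))

/-- Let `Λ` be a finitely generated free abelian group and `V₁`, `V₂` two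
representations of `Λ` on complex vector spaces (equivalently, `ℂ[Λ]`-modules).  If there
are two distinct characters `χ₁ ≠ χ₂ : Λ → ℂ^×` such that `V₁ ⊗ χ₁⁻¹` and `V₂ ⊗ χ₂⁻¹` are
locally unipotent, then `Ext^i_{ℂ[Λ]}(V₁, V₂) = 0` for all `i ≥ 0`. -/
theorem ext_vanishing_distinct_characters
    (Λ : Type) [CommGroup Λ]
    (hfree : ∃ n : ℕ, Nonempty (Λ ≃* Multiplicative (Fin n → ℤ)))
    (V₁ V₂ : Type) [AddCommGroup V₁] [AddCommGroup V₂]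
    [Module (MonoidAlgebra ℂ Λ) V₁] [Module (MonoidAlgebra ℂ Λ) V₂]
    (χ₁ χ₂ : Λ →* ℂˣ) (hne : χ₁ ≠ χ₂)
    (h₁ : IsLocallyUnipotentTwist Λ V₁ χ₁) (h₂ : IsLocallyUnipotentTwist Λ V₂ χ₂) :
    letI := HasDerivedCategory.standard (ModuleCat (MonoidAlgebra ℂ Λ))
    haveI : HasExt (ModuleCat (MonoidAlgebra ℂ Λ)) := hasExt_of_hasDerivedCategory _
    ∀ i : ℕ,
      Subsingleton (Abelian.Ext (ModuleCat.of (MonoidAlgebra ℂ Λ) V₁)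
        (ModuleCat.of (MonoidAlgebra ℂ Λ) V₂) i) := by
  intro i
  obtain ⟨g, hg⟩ := DFunLike.ne_iff.mp hne
  let : HasDerivedCategory (ModuleCat (MonoidAlgebra ℂ Λ)) := HasDerivedCategory.standard _
  have : HasExt (ModuleCat (MonoidAlgebra ℂ Λ)) := hasExt_of_hasDerivedCategory _
  exact ext_subsingleton_of_torsion_of_bijective (twistedSubOne χ₁ g) V₁ V₂
    (h₁.exists_pow_smul_eq_zero g)
    (bijective_smul_of_isCoprime (isCoprime_twistedSubOne hg) (h₂.exists_pow_smul_eq_zero g)) i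
end

section
/- Let n ∈ ℕ and let C(ℤⁿ) be the space of all complex-valued functions on ℤⁿ, with ℤⁿ acting by translations: (y·f)(x) := f(x+y). A function f ∈ C(ℤⁿ) is ℤⁿ-finite (i.e. the span of its translates {y·f : y ∈ ℤⁿ} is finite-dimensional) if and only if f belongs to 𝒜(ℤⁿ). -/
/-- A character of `ℤⁿ`, i.e. a multiplicative map `ℤⁿ → ℂ^×` (nonvanishing is automatic
from `χ 0 = 1` and `χ (x + (-x)) = χ x * χ (-x)`). -/
def IsCharacterZn {n : ℕ} (χ : (Fin n → ℤ) → ℂ) : Prop :=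
  χ 0 = 1 ∧ ∀ x y, χ (x + y) = χ x * χ y

/-- The space `𝒜_k(ℤⁿ)` of linear combinations of functions `x ↦ χ(x) P(x)` where `χ` is a
character of `ℤⁿ` and `P` is a polynomial of degree `≤ k`. -/
noncomputable def polyCharSpace (n k : ℕ) : Submodule ℂ ((Fin n → ℤ) → ℂ) :=
  Submodule.span ℂ {f | ∃ (χ : (Fin n → ℤ) → ℂ) (P : MvPolynomial (Fin n) ℂ),
    IsCharacterZn χ ∧ P.totalDegree ≤ k ∧
    f = fun x => χ x * MvPolynomial.eval (fun i => (x i : ℂ)) P}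

section TranslationFinite

variable {G : Type*} [AddCommGroup G]

/-- The translation operator `f ↦ (x ↦ f (x + y))`. -/
def translation (y : G) : Module.End ℂ (G → ℂ) :=
  LinearMap.funLeft ℂ ℂ (· + y)

@[simp]
theorem translation_apply (y : G) (f : G → ℂ) (x : G) : translation y f x = f (x + y) := rfl

theorem translation_translation (y z : G) (f : G → ℂ) :
    translation y (translation z f) = translation (y + z) f := by
  ext x
  simp [add_assoc]

theorem translation_commute (y z : G) : Commute (translation y) (translation z) := by
  ext f : 1
  simp only [Module.End.mul_apply, translation_translation, add_comm]

theorem translation_injective (y : G) : Function.Injective (translation y) := by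
  intro f g h
  ext x
  simpa using congrFun h (x - y)

/-- A function lying in a finitely generated translation-invariant space of functions. -/
def TranslationFinite (f : G → ℂ) : Prop :=
  ∃ W : Submodule ℂ (G → ℂ), W.FG ∧ f ∈ W ∧ ∀ y, ∀ g ∈ W, translation y g ∈ W

namespace TranslationFinite

theorem of_eq_smul_add_const {f : G → ℂ} (c d : G → ℂ) (h : ∀ x y, f (x + y) = c y * f x + d y) :
    TranslationFinite f := by
  refine ⟨Submodule.span ℂ {f, 1}, Submodule.fg_span (by simp),
    Submodule.subset_span (by simp), fun y g hg => ?_⟩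
  obtain ⟨a, b, rfl⟩ := Submodule.mem_span_pair.1 hg
  refine Submodule.mem_span_pair.2 ⟨a * c y, a * d y + b, ?_⟩
  ext x
  simp only [Pi.add_apply, Pi.smul_apply, Pi.one_apply, smul_eq_mul, translation_apply, h]
  ring

theorem const (c : ℂ) : TranslationFinite fun _ : G => c :=
  of_eq_smul_add_const 1 0 fun _ _ => by simp

theorem add {f g : G → ℂ} (hf : TranslationFinite f) (hg : TranslationFinite g) :
    TranslationFinite (f + g) := by
  obtain ⟨V, hV, hfV, hVt⟩ := hf
  obtain ⟨W, hW, hgW, hWt⟩ := hg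
  refine ⟨V ⊔ W, hV.sup hW, Submodule.add_mem_sup hfV hgW, fun y u hu => ?_⟩
  obtain ⟨v, hv, w, hw, rfl⟩ := Submodule.mem_sup.1 hu
  rw [map_add]
  exact Submodule.add_mem_sup (hVt y v hv) (hWt y w hw)

theorem mul {f g : G → ℂ} (hf : TranslationFinite f) (hg : TranslationFinite g) :
    TranslationFinite (f * g) := by
  obtain ⟨V, hV, hfV, hVt⟩ := hf
  obtain ⟨W, hW, hgW, hWt⟩ := hg
  refine ⟨V * W, hV.mul hW, Submodule.mul_mem_mul hfV hgW, fun y u hu => ?_⟩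
  induction hu using Submodule.mul_induction_on' with
  | mem_mul_mem v hv w hw => exact Submodule.mul_mem_mul (hVt y v hv) (hWt y w hw)
  | add a _ b _ ha hb =>
    rw [map_add]
    exact add_mem ha hb

theorem finiteDimensional_span {f : G → ℂ} (hf : TranslationFinite f) :
    FiniteDimensional ℂ (Submodule.span ℂ (Set.range fun y : G => fun x => f (x + y))) := by
  obtain ⟨W, hW, hfW, hWt⟩ := hf
  have : FiniteDimensional ℂ W := Module.Finite.iff_fg.2 hW
  refine Submodule.finiteDimensional_of_le (Submodule.span_le.2 ?_ : _ ≤ W)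
  rintro _ ⟨y, rfl⟩
  exact hWt y f hfW

end TranslationFinite

theorem translation_mem_span_translates (f : G → ℂ) (y : G) {g : G → ℂ}
    (hg : g ∈ Submodule.span ℂ (Set.range fun y : G => fun x => f (x + y))) :
    translation y g ∈ Submodule.span ℂ (Set.range fun y : G => fun x => f (x + y)) := by
  induction hg using Submodule.span_induction with
  | mem g hg =>
    obtain ⟨z, rfl⟩ := hg
    exact Submodule.subset_span ⟨y + z, by ext x; simp [add_assoc]⟩
  | zero => simp
  | add a b _ _ ha hb => rw [map_add]; exact add_mem ha hb
  | smul c a _ ha => rw [map_smul]; exact Submodule.smul_mem _ _ ha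

end TranslationFinite

/-- Newton's binomial expansion with integer exponents for the powers of `c • (1 + D)` applied to
a vector killed by a power of `D`. -/
theorem orbit_eq_zpow_smul_sum_choose {V : Type*} [AddCommGroup V] [Module ℂ V]
    {D : Module.End ℂ V} (hD : Function.Injective ⇑(1 + D)) {c : ℂ} (hc : c ≠ 0)
    {u : ℤ → V} (hu : ∀ m, u (m + 1) = c • (1 + D) (u m))
    {N : ℕ} (hN : (D ^ N) (u 0) = 0) (m : ℤ) :
    u m = c ^ m • ∑ k ∈ Finset.range N, Ring.choose (m : ℂ) k • (D ^ k) (u 0) := by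
  set S : ℤ → V := fun m => ∑ k ∈ Finset.range N, Ring.choose (m : ℂ) k • (D ^ k) (u 0) with hS
  have hSsucc (m : ℤ) : S (m + 1) = (1 + D) (S m) := by
    have hshift : D (S m) =
        ∑ k ∈ Finset.range N, Ring.choose (m : ℂ) k • (D ^ (k + 1)) (u 0) := by
      simp [hS, map_sum, pow_succ']
    rcases N with _ | N
    · simp [hS]
    rw [LinearMap.add_apply, Module.End.one_apply, hshift, Finset.sum_range_succ, hN, smul_zero,
      add_zero]
    simp only [hS]
    rw [Finset.sum_range_succ', Finset.sum_range_succ' _ N]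
    simp only [Int.cast_add, Int.cast_one, Ring.choose_succ_succ, add_smul,
      Finset.sum_add_distrib, Ring.choose_zero_right]
    abel
  have hS0 : S 0 = u 0 := by
    rcases N with _ | N
    · simpa [hS] using hN.symm
    · simp [hS, Finset.sum_range_succ']
  change u m = c ^ m • S m
  induction m using Int.induction_on with
  | zero => simp [hS0]
  | succ i ih => rw [hu, ih, hSsucc, map_smul, smul_smul, zpow_add_one₀ hc, mul_comm]
  | pred i ih =>
    apply hD
    apply smul_right_injective V hc
    have h1 := hu (-i - 1)
    have h2 := hSsucc (-i - 1)
    rw [sub_add_cancel] at h1 h2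
    simp only
    rw [← h1, ih, h2, map_smul, smul_smul, ← zpow_one_add₀ hc, add_sub_cancel]

theorem exists_mvPolynomial_eval_eq_choose {σ : Type*} (i : σ) (k : ℕ) :
    ∃ Q : MvPolynomial σ ℂ, ∀ x : σ → ℂ, MvPolynomial.eval x Q = Ring.choose (x i) k := by
  refine ⟨MvPolynomial.C (k.factorial : ℂ)⁻¹ *
    Polynomial.aeval (MvPolynomial.X i) (descPochhammer ℤ k), fun x => ?_⟩
  rw [Ring.choose_eq_smul, map_mul, MvPolynomial.eval_C, smul_eq_mul,
    ← Polynomial.aeval_eq_smeval, Polynomial.aeval_def, Polynomial.aeval_def,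
    Polynomial.hom_eval₂, MvPolynomial.eval_X]
  congr 2
  exact RingHom.ext_int _ _

section Zn

variable {n : ℕ}

theorem translation_generalizedEigenvector_single {μ : ℂ} (hμ : μ ≠ 0) (i : Fin n)
    {g : (Fin n → ℤ) → ℂ} {N : ℕ}
    (hg : ((translation (Pi.single i 1 : Fin n → ℤ) - μ • 1) ^ N) g = 0) (m : ℤ) :
    translation (Pi.single i m) g = μ ^ m • ∑ k ∈ Finset.range N,
      Ring.choose (m : ℂ) k • ((μ⁻¹ • (translation (Pi.single i 1 : Fin n → ℤ) - μ • 1)) ^ k) g := by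
  have hD : (1 : Module.End ℂ ((Fin n → ℤ) → ℂ)) +
      μ⁻¹ • (translation (Pi.single i 1 : Fin n → ℤ) - μ • 1) =
      μ⁻¹ • translation (Pi.single i 1 : Fin n → ℤ) := by
    rw [smul_sub, smul_smul, inv_mul_cancel₀ hμ, one_smul, add_sub_cancel]
  have h0 : translation (Pi.single i (0 : ℤ)) g = g := by
    ext x
    simp
  have key := orbit_eq_zpow_smul_sum_choose
    (D := μ⁻¹ • (translation (Pi.single i 1 : Fin n → ℤ) - μ • 1)) (N := N)
    (u := fun m : ℤ => translation (Pi.single i m) g) ?_ hμ ?_ ?_ m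
  · simpa only [h0] using key
  · rw [hD]
    intro a b hab
    exact translation_injective _ (smul_right_injective _ (inv_ne_zero hμ) hab)
  · intro m
    rw [hD, LinearMap.smul_apply, smul_smul, mul_inv_cancel₀ hμ, one_smul,
      translation_translation, ← Pi.single_add, add_comm]
  · simp only [h0, smul_pow, LinearMap.smul_apply, hg, smul_zero]

theorem exists_mvPolynomial_of_generalizedEigenvector {μ : Fin n → ℂ} (hμ : ∀ i, μ i ≠ 0)
    (s : Finset (Fin n)) {g : (Fin n → ℤ) → ℂ}
    (hg : ∀ i, ∃ N : ℕ, ((translation (Pi.single i 1 : Fin n → ℤ) - μ i • 1) ^ N) g = 0) :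
    ∃ P : MvPolynomial (Fin n) ℂ, ∀ x : Fin n → ℤ,
      g (∑ i ∈ s, Pi.single i (x i)) =
        (∏ i ∈ s, μ i ^ x i) * MvPolynomial.eval (fun i => (x i : ℂ)) P := by
  induction s using Finset.induction_on generalizing g with
  | empty => exact ⟨MvPolynomial.C (g 0), by simp⟩
  | insert i s hi ih =>
    obtain ⟨N, hN⟩ := hg i
    set D := (μ i)⁻¹ • (translation (Pi.single i 1 : Fin n → ℤ) - μ i • 1) with hD
    have hcomm (j : Fin n) : Commute D (translation (Pi.single j 1 : Fin n → ℤ) - μ j • 1) :=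
      (((translation_commute _ _).sub_left ((Commute.one_left _).smul_left _)).sub_right
        ((Commute.one_right _).smul_right _)).smul_left _
    have hDg (k : ℕ) (j : Fin n) :
        ∃ M : ℕ, ((translation (Pi.single j 1 : Fin n → ℤ) - μ j • 1) ^ M) ((D ^ k) g) = 0 := by
      obtain ⟨M, hM⟩ := hg j
      refine ⟨M, ?_⟩
      rw [← Module.End.mul_apply, ← ((hcomm j).pow_pow k M).eq, Module.End.mul_apply, hM, map_zero]
    choose P hP using fun k => ih (hDg k)
    choose Q hQ using exists_mvPolynomial_eval_eq_choose i
    refine ⟨∑ k ∈ Finset.range N, Q k * P k, fun x => ?_⟩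
    have key := congrFun (translation_generalizedEigenvector_single (hμ i) i hN (x i))
      (∑ j ∈ s, Pi.single j (x j))
    rw [translation_apply] at key
    rw [Finset.sum_insert hi, add_comm, key, Finset.prod_insert hi, map_sum]
    simp only [Pi.smul_apply, Finset.sum_apply, smul_eq_mul, map_mul, hQ, ← hD, hP]
    simp only [Finset.mul_sum]
    exact Finset.sum_congr rfl fun k _ => by ring

theorem polyCharSpace_mono {k l : ℕ} (h : k ≤ l) : polyCharSpace n k ≤ polyCharSpace n l := by
  refine Submodule.span_mono ?_
  rintro f ⟨χ, P, hχ, hP, rfl⟩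
  exact ⟨χ, P, hχ, hP.trans h, rfl⟩

theorem isCharacterZn_prod_zpow {μ : Fin n → ℂ} (hμ : ∀ i, μ i ≠ 0) :
    IsCharacterZn fun x : Fin n → ℤ => ∏ i, μ i ^ x i :=
  ⟨by simp, fun x y => by simp [zpow_add₀ (hμ _), Finset.prod_mul_distrib]⟩

theorem exists_mem_polyCharSpace_of_generalizedEigenvector {μ : Fin n → ℂ} {g : (Fin n → ℤ) → ℂ}
    (hg : ∀ i, ∃ N : ℕ, ((translation (Pi.single i 1 : Fin n → ℤ) - μ i • 1) ^ N) g = 0) :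
    ∃ k, g ∈ polyCharSpace n k := by
  by_cases hμ : ∀ i, μ i ≠ 0
  · obtain ⟨P, hP⟩ := exists_mvPolynomial_of_generalizedEigenvector hμ Finset.univ hg
    refine ⟨P.totalDegree, Submodule.subset_span
      ⟨_, P, isCharacterZn_prod_zpow hμ, le_rfl, funext fun x => ?_⟩⟩
    rw [← hP, Finset.univ_sum_single]
  · push Not at hμ
    obtain ⟨i, hi⟩ := hμ
    obtain ⟨N, hN⟩ := hg i
    rw [hi, zero_smul, sub_zero, Module.End.pow_apply] at hN
    have : g = 0 := (translation_injective _).iterate N (hN.trans (by simp))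
    exact ⟨0, this ▸ zero_mem _⟩

theorem exists_mem_polyCharSpace_of_mem_invariant {W : Submodule ℂ ((Fin n → ℤ) → ℂ)}
    [FiniteDimensional ℂ W] (hW : ∀ y, ∀ g ∈ W, translation y g ∈ W)
    {f : (Fin n → ℤ) → ℂ} (hf : f ∈ W) : ∃ k, f ∈ polyCharSpace n k := by
  let T (i : Fin n) : Module.End ℂ W := (translation (Pi.single i 1 : Fin n → ℤ)).restrict (hW _)
  have htop : ⨆ μ : Fin n → ℂ, ⨅ i, (T i).maxGenEigenspace (μ i) = ⊤ :=
    Module.End.iSup_iInf_maxGenEigenspace_eq_top_of_iSup_maxGenEigenspace_eq_top_of_commute T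
      (fun _ _ _ => LinearMap.restrict_commute (translation_commute _ _) _ _)
      fun i => Module.End.iSup_maxGenEigenspace_eq_top (T i)
  have hmem : (⟨f, hf⟩ : W) ∈ ⨆ μ : Fin n → ℂ, ⨅ i, (T i).maxGenEigenspace (μ i) :=
    htop ▸ Submodule.mem_top
  refine Submodule.iSup_induction _ (motive := fun w : W => ∃ k, (w : (Fin n → ℤ) → ℂ) ∈
    polyCharSpace n k) hmem (fun μ w hw => ?_) ⟨0, zero_mem _⟩ ?_
  · refine exists_mem_polyCharSpace_of_generalizedEigenvector (μ := μ) fun i => ?_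
    obtain ⟨N, hN⟩ := (Module.End.mem_maxGenEigenspace _ _ _).1 ((Submodule.mem_iInf _).1 hw i)
    have hsub : ∀ g ∈ W, (translation (Pi.single i 1 : Fin n → ℤ) - μ i • 1) g ∈ W := fun g hg =>
      sub_mem (hW _ g hg) (W.smul_mem _ hg)
    have hT : T i - μ i • 1 =
        (translation (Pi.single i 1 : Fin n → ℤ) - μ i • 1 : Module.End ℂ _).restrict hsub := rfl
    rw [hT, Module.End.pow_restrict] at hN
    exact ⟨N, congrArg Subtype.val hN⟩
  · rintro v w ⟨k, hk⟩ ⟨l, hl⟩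
    exact ⟨max k l, add_mem (polyCharSpace_mono (le_max_left k l) hk)
      (polyCharSpace_mono (le_max_right k l) hl)⟩

theorem translationFinite_eval (P : MvPolynomial (Fin n) ℂ) :
    TranslationFinite fun x : Fin n → ℤ => MvPolynomial.eval (fun i => (x i : ℂ)) P := by
  induction P using MvPolynomial.induction_on with
  | C a => simpa using TranslationFinite.const a
  | add p q hp hq => simpa using! hp.add hq
  | mul_X p i hp =>
    have hX : TranslationFinite fun x : Fin n → ℤ => (x i : ℂ) :=
      .of_eq_smul_add_const 1 (fun y => (y i : ℂ)) fun _ _ => by simp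
    simpa using! hp.mul hX

theorem translationFinite_of_mem_polyCharSpace {k : ℕ} {f : (Fin n → ℤ) → ℂ}
    (hf : f ∈ polyCharSpace n k) : TranslationFinite f := by
  induction hf using Submodule.span_induction with
  | mem f hf =>
    obtain ⟨χ, P, hχ, -, rfl⟩ := hf
    have : TranslationFinite χ :=
      .of_eq_smul_add_const χ 0 fun x y => by simp [hχ.2, mul_comm]
    exact this.mul (translationFinite_eval P)
  | zero => exact .const 0
  | add f g _ _ hf hg => exact hf.add hg
  | smul c f _ hf => exact (TranslationFinite.const c).mul hf

end Zn

/-- A complex-valued function on `ℤⁿ` is `ℤⁿ`-finite for the translation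
action `(y·f)(x) = f (x + y)` (i.e. the span of its translates is finite-dimensional) if and
only if it belongs to `𝒜(ℤⁿ) = ⋃ₖ 𝒜ₖ(ℤⁿ)`. -/
theorem zn_finite_iff_poly_char (n : ℕ) (f : (Fin n → ℤ) → ℂ) :
    FiniteDimensional ℂ
      (Submodule.span ℂ (Set.range fun y : Fin n → ℤ => fun x => f (x + y))) ↔
    ∃ k : ℕ, f ∈ polyCharSpace n k := by
  refine ⟨fun _ => ?_, fun ⟨_, hf⟩ =>
    (translationFinite_of_mem_polyCharSpace hf).finiteDimensional_span⟩
  exact exists_mem_polyCharSpace_of_mem_invariant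
    (fun y _ => translation_mem_span_translates f y) (Submodule.subset_span ⟨0, by simp⟩)
end

section
/- Let Λ be a free abelian group of finite rank, let Λ₀ be a subgroup of Λ, and let k ∈ ℕ. Let f : Λ → ℂ be a function that is invariant under translations by Λ₀ and satisfies (g₀−1)(g₁−1)⋯(g_k−1)·f = 0 for all g₀,…,g_k ∈ Λ, where Λ acts on functions by translations (g·f)(x) := f(x−g). Then there exist r ∈ ℕ, group homomorphisms λ₁,…,λ_r : Λ/Λ₀ → ℂ (with ℂ viewed as an additive group), and a polynomial P in r variables of degree ≤ k such that f(x) = P(λ₁(x̄), λ₂(x̄), …, λ_r(x̄)) for all x ∈ Λ, where x̄ denotes the image of x in Λ/Λ₀. -/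
/-- All `n`-fold iterated differences of `f` vanish. -/
def FwdDiffVanish {A : Type*} [AddCommGroup A] : ℕ → (A → ℂ) → Prop
  | 0, f => f = 0
  | n + 1, f => ∀ g, FwdDiffVanish n (fwdDiff g f)

/-- Every function on `A` whose `(k + 1)`-fold differences vanish is a polynomial of degree at
most `k` in additive homomorphisms `A → ℂ`. -/
def FwdDiffVanishIsPolynomial (A : Type*) [AddCommGroup A] : Prop :=
  ∀ (k : ℕ) (f : A → ℂ), FwdDiffVanish (k + 1) f →
    ∃ P : MvPolynomial (A →+ ℂ) ℂ, P.totalDegree ≤ k ∧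
      ∀ x, f x = MvPolynomial.eval (fun l => l x) P

section

variable {A B : Type*} [AddCommGroup A] [AddCommGroup B]

lemma FwdDiffVanish.of_foldr {n : ℕ} {f : A → ℂ}
    (h : ∀ l : List A, l.length = n →
      l.foldr (fun g h => (fun x => h (x - g)) - h) f = 0) : FwdDiffVanish n f := by
  induction n generalizing f with
  | zero => exact h [] rfl
  | succ n ih =>
    intro g
    refine ih fun l hl => ?_
    have hlg := h (l ++ [-g]) (by simp [hl])
    rw [List.foldr_append] at hlg
    convert hlg using 2
    funext x
    simp [fwdDiff]

lemma FwdDiffVanish.comp_addMonoidHom {n : ℕ} {f : B → ℂ} (h : FwdDiffVanish n f) (φ : A →+ B) :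
    FwdDiffVanish n (f ∘ φ) := by
  induction n generalizing f with
  | zero =>
    obtain rfl : f = 0 := h
    rfl
  | succ n ih =>
    intro g
    convert ih (h (φ g)) using 1
    funext x
    simp [fwdDiff]

lemma FwdDiffVanish.of_comp_surjective {n : ℕ} {f : B → ℂ} {φ : A →+ B}
    (hφ : Function.Surjective φ) (h : FwdDiffVanish n (f ∘ φ)) : FwdDiffVanish n f := by
  induction n generalizing f with
  | zero => exact hφ.injective_comp_right h
  | succ n ih =>
    intro g
    obtain ⟨g, rfl⟩ := hφ g
    refine ih ?_
    convert h g using 1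
    funext x
    simp [fwdDiff]

lemma FwdDiffVanish.iterate {n j : ℕ} {f : A → ℂ} (h : FwdDiffVanish (n + j) f) (g : A) :
    FwdDiffVanish n ((fwdDiff g)^[j] f) := by
  induction j generalizing f with
  | zero => exact h
  | succ j ih => exact ih (h g)

lemma FwdDiffVanish.iterate_eq_zero {n : ℕ} {f : A → ℂ} (h : FwdDiffVanish n f) (g : A) :
    (fwdDiff g)^[n] f = 0 :=
  FwdDiffVanish.iterate (n := 0) (by rwa [Nat.zero_add]) g

/-- Newton's forward difference formula with integer steps. -/
lemma apply_add_zsmul_eq_sum_choose {N : ℕ} {f : A → ℂ} {g : A} (h : (fwdDiff g)^[N] f = 0)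
    (a : A) (n : ℤ) :
    f (a + n • g) = ∑ j ∈ Finset.range N, Ring.choose (n : ℂ) j * (fwdDiff g)^[j] f a := by
  induction N generalizing f n with
  | zero =>
    obtain rfl : f = 0 := h
    simp
  | succ N ih =>
    have hdiff : ∀ n : ℤ, f (a + (n + 1) • g) - f (a + n • g) =
        ∑ j ∈ Finset.range N, Ring.choose (n : ℂ) j * (fwdDiff g)^[j + 1] f a := by
      intro n
      rw [add_smul, one_smul, ← add_assoc]
      exact ih h n
    have hsum : ∀ n : ℤ,
        (∑ j ∈ Finset.range (N + 1), Ring.choose ((n + 1 : ℤ) : ℂ) j * (fwdDiff g)^[j] f a) -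
          ∑ j ∈ Finset.range (N + 1), Ring.choose (n : ℂ) j * (fwdDiff g)^[j] f a =
        ∑ j ∈ Finset.range N, Ring.choose (n : ℂ) j * (fwdDiff g)^[j + 1] f a := by
      intro n
      rw [← Finset.sum_sub_distrib, Finset.sum_range_succ']
      simp only [Int.cast_add, Int.cast_one, Ring.choose_succ_succ, Ring.choose_zero_right,
        sub_self, add_zero]
      exact Finset.sum_congr rfl fun j _ => by ring
    induction n using Int.induction_on with
    | zero => simp [Finset.sum_range_succ']
    | succ n ihn => linear_combination hdiff n - hsum n + ihn
    | pred n ihn =>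
      have hd := hdiff (-n - 1)
      have hs := hsum (-n - 1)
      rw [sub_add_cancel] at hd hs
      linear_combination ihn - hd + hs

lemma fwdDiff_eq_zero_of_iterate_eq_zero {f : A → ℂ} {t : A} {m n : ℕ} (hm : m ≠ 0)
    (ht : m • t = 0) (h : (fwdDiff t)^[n] f = 0) : fwdDiff t f = 0 := by
  induction n with
  | zero =>
    obtain rfl : f = 0 := h
    funext x
    simp [fwdDiff]
  | succ n ih =>
    cases n with
    | zero => exact h
    | succ n =>
      refine ih (funext fun x => ?_)
      have hx := apply_add_zsmul_eq_sum_choose (N := 2) (f := (fwdDiff t)^[n] f) (g := t)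
        (by rw [← Function.iterate_add_apply, Nat.add_comm]; exact h) x m
      rw [natCast_zsmul, ht] at hx
      simp only [Finset.sum_range_succ, Finset.sum_range_zero, Ring.choose_zero_right,
        Ring.choose_one_right, Function.iterate_zero, Function.iterate_one, id] at hx
      rw [← Function.iterate_succ_apply' (fwdDiff t)] at hx
      simpa [hm] using hx

lemma MvPolynomial.totalDegree_aeval_X_le {σ : Type*} (i : σ) (p : Polynomial ℤ) :
    (Polynomial.aeval (MvPolynomial.X i : MvPolynomial σ ℂ) p).totalDegree ≤ p.natDegree := by
  rw [Polynomial.aeval_eq_sum_range]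
  refine (MvPolynomial.totalDegree_finsetSum _ _).trans (Finset.sup_le fun j hj => ?_)
  refine (MvPolynomial.totalDegree_smul_le _ _).trans ?_
  rw [MvPolynomial.totalDegree_X_pow]
  exact Nat.lt_succ_iff.mp (Finset.mem_range.mp hj)

/-- The binomial coefficient `choose (X i) j` as a polynomial of degree at most `j`. -/
lemma MvPolynomial.exists_eval_eq_choose {σ : Type*} (i : σ) (j : ℕ) :
    ∃ Q : MvPolynomial σ ℂ, Q.totalDegree ≤ j ∧
      ∀ v, MvPolynomial.eval v Q = Ring.choose (v i) j := by
  refine ⟨(j.factorial : ℂ)⁻¹ • Polynomial.aeval (MvPolynomial.X i) (descPochhammer ℤ j),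
    ?_, fun v => ?_⟩
  · refine (MvPolynomial.totalDegree_smul_le _ _).trans
      ((MvPolynomial.totalDegree_aeval_X_le _ _).trans ?_)
    rw [descPochhammer_natDegree]
  · rw [MvPolynomial.smul_eval, Ring.choose_eq_smul, smul_eq_mul, Polynomial.aeval_def,
      Polynomial.hom_eval₂, MvPolynomial.eval_X, ← Polynomial.aeval_eq_smeval,
      Polynomial.aeval_def]
    rw [Subsingleton.elim ((MvPolynomial.eval v).comp _) (algebraMap ℤ ℂ)]

lemma MvPolynomial.totalDegree_le_totalDegree_rename {σ τ : Type*} {e : σ → τ}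
    (he : Function.Injective e) (p : MvPolynomial σ ℂ) :
    p.totalDegree ≤ (MvPolynomial.rename e p).totalDegree := by
  cases isEmpty_or_nonempty σ
  · rw [MvPolynomial.eq_C_of_isEmpty p, MvPolynomial.totalDegree_C]
    exact Nat.zero_le _
  · conv_lhs => rw [← MvPolynomial.rename_id_apply p, ← Function.invFun_comp he,
      ← MvPolynomial.rename_rename]
    exact MvPolynomial.totalDegree_rename_le _ _

lemma FwdDiffVanishIsPolynomial.exists_comp (hB : FwdDiffVanishIsPolynomial B) {k : ℕ}
    {f : B → ℂ} (hf : FwdDiffVanish (k + 1) f) (φ : A →+ B) :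
    ∃ P : MvPolynomial (A →+ ℂ) ℂ, P.totalDegree ≤ k ∧
      ∀ x, f (φ x) = MvPolynomial.eval (fun l => l x) P := by
  obtain ⟨P, hP, hfP⟩ := hB k f hf
  refine ⟨MvPolynomial.rename (fun l => l.comp φ) P,
    (MvPolynomial.totalDegree_rename_le _ _).trans hP, fun x => ?_⟩
  rw [hfP, MvPolynomial.eval_rename]
  rfl

lemma FwdDiffVanishIsPolynomial.of_surjective_of_torsion_ker (hB : FwdDiffVanishIsPolynomial B)
    (φ : A →+ B) (hφ : Function.Surjective φ)
    (hker : ∀ t, φ t = 0 → ∃ m : ℕ, m ≠ 0 ∧ m • t = 0) : FwdDiffVanishIsPolynomial A := by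
  intro k f hf
  have hfactor : Function.FactorsThrough f φ := by
    intro x y hxy
    obtain ⟨m, hm, ht⟩ := hker (x - y) (by rw [map_sub, hxy, sub_self])
    have hdiff := congrFun (fwdDiff_eq_zero_of_iterate_eq_zero hm ht
      (hf.iterate_eq_zero (x - y))) y
    simpa [fwdDiff, sub_eq_zero] using hdiff
  obtain ⟨F, rfl⟩ : ∃ F : B → ℂ, f = F ∘ φ := (Function.factorsThrough_iff f).mp hfactor
  exact hB.exists_comp (hf.of_comp_surjective hφ) φ

lemma FwdDiffVanishIsPolynomial.of_addEquiv (hB : FwdDiffVanishIsPolynomial B) (e : A ≃+ B) :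
    FwdDiffVanishIsPolynomial A :=
  hB.of_surjective_of_torsion_ker e.toAddMonoidHom e.surjective
    fun t ht => ⟨1, one_ne_zero, by simpa using ht⟩

lemma FwdDiffVanishIsPolynomial.int_prod (hB : FwdDiffVanishIsPolynomial B) :
    FwdDiffVanishIsPolynomial (ℤ × B) := by
  intro k f hf
  let e : ℤ × B := (1, 0)
  have hcoeff : ∀ j ∈ Finset.range (k + 1), ∃ P : MvPolynomial (ℤ × B →+ ℂ) ℂ,
      P.totalDegree ≤ k - j ∧
        ∀ x : ℤ × B, (fwdDiff e)^[j] f (0, x.2) = MvPolynomial.eval (fun l => l x) P := by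
    intro j hj
    have hjk : k + 1 = k - j + 1 + j := by have := Finset.mem_range.mp hj; lia
    rw [hjk] at hf
    exact hB.exists_comp ((hf.iterate e).comp_addMonoidHom (AddMonoidHom.inr ℤ B))
      (AddMonoidHom.snd ℤ B)
  choose! P hPdeg hP using hcoeff
  choose Q hQdeg hQ using MvPolynomial.exists_eval_eq_choose
    ((Int.castAddHom ℂ).comp (AddMonoidHom.fst ℤ B))
  refine ⟨∑ j ∈ Finset.range (k + 1), Q j * P j, ?_, fun x => ?_⟩
  · refine (MvPolynomial.totalDegree_finsetSum _ _).trans (Finset.sup_le fun j hj => ?_)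
    refine (MvPolynomial.totalDegree_mul _ _).trans ?_
    have := hPdeg j hj
    have := hQdeg j
    have := Finset.mem_range.mp hj
    lia
  · have hx : x = (0, x.2) + x.1 • e := by ext <;> simp [e]
    conv_lhs => rw [hx]
    rw [apply_add_zsmul_eq_sum_choose (hf.iterate_eq_zero e), map_sum]
    refine Finset.sum_congr rfl fun j hj => ?_
    rw [map_mul, hQ, hP j hj x]
    rfl

lemma fwdDiffVanishIsPolynomial_of_subsingleton [Subsingleton A] :
    FwdDiffVanishIsPolynomial A := fun k f _ =>
  ⟨MvPolynomial.C (f 0), by simp, fun x => by simp [Subsingleton.elim x 0]⟩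

lemma fwdDiffVanishIsPolynomial_pi_int (r : ℕ) : FwdDiffVanishIsPolynomial (Fin r → ℤ) := by
  induction r with
  | zero => exact fwdDiffVanishIsPolynomial_of_subsingleton
  | succ r ih =>
    exact ih.int_prod.of_addEquiv (Fin.consLinearEquiv ℤ fun _ => ℤ).symm.toAddEquiv

lemma fwdDiffVanishIsPolynomial_of_finite [Module.Finite ℤ A] : FwdDiffVanishIsPolynomial A := by
  let T := Submodule.torsion ℤ A
  let b := Module.finBasis ℤ (A ⧸ T)
  refine ((fwdDiffVanishIsPolynomial_pi_int _).of_addEquiv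
    b.equivFun.toAddEquiv).of_surjective_of_torsion_ker T.mkQ.toAddMonoidHom
    T.mkQ_surjective fun t ht => ?_
  obtain ⟨a, ha⟩ := (Submodule.mem_torsion_iff t).mp ((Submodule.Quotient.mk_eq_zero T).mp ht)
  refine ⟨(a : ℤ).natAbs, Int.natAbs_ne_zero.mpr (nonZeroDivisors.coe_ne_zero a), ?_⟩
  rw [← natCast_zsmul]
  rcases Int.natAbs_eq (a : ℤ) with h | h
  · rw [← h]
    exact ha
  · rw [← neg_inj, ← neg_smul, ← h, neg_zero]
    exact ha

end

/-- Let `Λ` be a free abelian group of finite rank, `Λ₀ ≤ Λ` a subgroup and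
`k ∈ ℕ`. Let `f : Λ → ℂ` be invariant under translations by `Λ₀` and satisfy
`(g₀−1)(g₁−1)⋯(g_k−1)·f = 0` for all `g₀,…,g_k ∈ Λ`, where `(g·f)(x) := f (x − g)`.
Then `f(x) = P (λ₁ x̄, …, λ_r x̄)` for some additive homomorphisms `λᵢ : Λ/Λ₀ → ℂ` and
some polynomial `P` of degree `≤ k`. -/
theorem gen_invariant_function_is_polynomial
    (Λ : Type*) [AddCommGroup Λ] [Module.Free ℤ Λ] [Module.Finite ℤ Λ]
    (Λ₀ : AddSubgroup Λ) (k : ℕ) (f : Λ → ℂ)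
    (hinv : ∀ g ∈ Λ₀, ∀ x, f (x - g) = f x)
    (hunip : ∀ l : List Λ, l.length = k + 1 →
      l.foldr (fun g h => (fun x => h (x - g)) - h) f = 0) :
    ∃ (r : ℕ) (lam : Fin r → (Λ ⧸ Λ₀ →+ ℂ)) (P : MvPolynomial (Fin r) ℂ),
      P.totalDegree ≤ k ∧
      ∀ x : Λ, f x = MvPolynomial.eval (fun i => lam i (QuotientAddGroup.mk x)) P := by
  have hfactor : Function.FactorsThrough f (QuotientAddGroup.mk' Λ₀) := by
    intro x y hxy
    have hmem := QuotientAddGroup.eq.mp hxy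
    simpa using hinv _ hmem y
  obtain ⟨F, rfl⟩ : ∃ F : Λ ⧸ Λ₀ → ℂ, f = F ∘ QuotientAddGroup.mk' Λ₀ :=
    (Function.factorsThrough_iff f).mp hfactor
  have hF : FwdDiffVanish (k + 1) F :=
    (FwdDiffVanish.of_foldr hunip).of_comp_surjective (QuotientAddGroup.mk'_surjective Λ₀)
  have : Module.Finite ℤ (Λ ⧸ Λ₀) :=
    Module.Finite.of_surjective (QuotientAddGroup.mk' Λ₀).toIntLinearMap
      (QuotientAddGroup.mk'_surjective Λ₀)
  obtain ⟨P, hdeg, hP⟩ := fwdDiffVanishIsPolynomial_of_finite k F hF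
  obtain ⟨r, lam, hlam, Q, rfl⟩ := MvPolynomial.exists_fin_rename P
  refine ⟨r, lam, Q, ?_, fun x => ?_⟩
  · exact (MvPolynomial.totalDegree_le_totalDegree_rename hlam Q).trans hdeg
  · rw [Function.comp_apply, hP, MvPolynomial.eval_rename]
    rfl
end

section
/- Let k be a non-archimedean local field of characteristic zero (i.e. a finite extension of ℚ_p for some prime p), and let 𝒮(k) be the space of compactly supported locally constant complex-valued functions on k, with k^× acting by (a·φ)(x) := φ(a⁻¹x). Then for every locally constant character χ : k^× → ℂ^×, the space of linear functionals η : 𝒮(k) → ℂ satisfying η(a·φ) = χ(a)η(φ) for all a ∈ k^× and φ ∈ 𝒮(k) is exactly one-dimensional. -/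
/-- The space `𝒮(X)` of Bruhat–Schwartz functions on an ℓ-space `X`: compactly supported
locally constant complex-valued functions. -/
noncomputable def SchwartzBZ (X : Type*) [TopologicalSpace X] : Submodule ℂ (X → ℂ) where
  carrier := {φ | IsLocallyConstant φ ∧ HasCompactSupport φ}
  add_mem' hφ hψ := ⟨hφ.1.comp₂ hψ.1 (· + ·), hφ.2.add hψ.2⟩
  zero_mem' := ⟨IsLocallyConstant.const 0, HasCompactSupport.zero⟩
  smul_mem' c φ hφ := ⟨hφ.1.comp (c • ·), hφ.2.mono (Function.support_const_smul_subset c φ)⟩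

/-- `η : 𝒮(k) → ℂ` is a `χ`-invariant distribution: `η(a·φ) = χ(a) η(φ)`, where
`(a·φ)(x) = φ(a⁻¹ x)`. -/
def IsSemiInvDistrib {K : Type*} [NontriviallyNormedField K] (χ : Kˣ →* ℂˣ)
    (η : SchwartzBZ K →ₗ[ℂ] ℂ) : Prop :=
  ∀ (a : Kˣ) (φ ψ : SchwartzBZ K),
    (∀ x : K, (ψ : K → ℂ) x = (φ : K → ℂ) (((a⁻¹ : Kˣ) : K) * x)) →
    η ψ = (χ a : ℂ) * η φ

open Topology Pointwise MeasureTheory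

namespace SchwartzBZ

section Group

variable {G : Type*} [CommGroup G] [TopologicalSpace G]

/-- A linear functional on `𝒮(G)` transforming under translations by the character `χ`. -/
def IsSemiInv (χ : G →* ℂˣ) (η : SchwartzBZ G →ₗ[ℂ] ℂ) : Prop :=
  ∀ (a : G) (φ ψ : SchwartzBZ G), (∀ x, (ψ : G → ℂ) x = (φ : G → ℂ) (a⁻¹ * x)) →
    η ψ = (χ a : ℂ) * η φ

/-- The group of periods of a function on a group. -/
def periods (φ : G → ℂ) : Subgroup G where
  carrier := {g | ∀ x, φ (x * g) = φ x}
  one_mem' := by simp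
  mul_mem' := fun {a b} ha hb x => by rw [← mul_assoc, hb, ha]
  inv_mem' := fun {a} ha x => by rw [← ha (x * a⁻¹), inv_mul_cancel_right]

/-- The indicator function of a compact open set is a Bruhat–Schwartz function. -/
theorem indicator_mem {X : Type*} [TopologicalSpace X] [R1Space X] {W : Set X}
    (hW : IsClopen W) (hc : IsCompact W) : W.indicator (fun _ => (1 : ℂ)) ∈ SchwartzBZ X := by
  refine ⟨?_, ?_⟩
  · classical
    exact (LocallyConstant.charFn ℂ hW).isLocallyConstant
  · exact HasCompactSupport.intro hc fun x hx => Set.indicator_of_notMem hx _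

theorem IsSemiInv.sub {χ : G →* ℂˣ} {η θ : SchwartzBZ G →ₗ[ℂ] ℂ} (hη : IsSemiInv χ η)
    (hθ : IsSemiInv χ θ) (c : ℂ) : IsSemiInv χ (η - c • θ) := fun a φ ψ h => by
  simp only [LinearMap.sub_apply, LinearMap.smul_apply, smul_eq_mul, hη a φ ψ h, hθ a φ ψ h]
  ring

theorem isClopen_support {X : Type*} [TopologicalSpace X] (φ : SchwartzBZ X) :
    IsClopen (Function.support (φ : X → ℂ)) :=
  (φ.2.1.isClopen_fiber 0).compl

variable [IsTopologicalGroup G]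

theorem isOpen_periods (φ : SchwartzBZ G) : IsOpen (periods (φ : G → ℂ) : Set G) := by
  obtain ⟨hlc, hcs⟩ := φ.2
  have hopen : IsOpen {p : G × G | (φ : G → ℂ) (p.1 * p.2) = (φ : G → ℂ) p.1} := by
    have h1 : IsLocallyConstant fun p : G × G => (φ : G → ℂ) (p.1 * p.2) :=
      hlc.comp_continuous continuous_mul
    have h2 : IsLocallyConstant fun p : G × G => (φ : G → ℂ) p.1 :=
      hlc.comp_continuous continuous_fst
    simpa [Set.preimage] using (h1.comp₂ h2 (· = ·)).isOpen_fiber True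
  obtain ⟨u, T, -, hT, hu, h1, hsub⟩ := generalized_tube_lemma (s := tsupport (φ : G → ℂ)) hcs
    (isCompact_singleton (x := (1 : G))) hopen (by rintro ⟨x, g⟩ ⟨-, rfl⟩; simp)
  have hT1 : T ∈ 𝓝 (1 : G) := hT.mem_nhds (h1 rfl)
  have key : ∀ x ∈ tsupport (φ : G → ℂ), ∀ g ∈ T, (φ : G → ℂ) (x * g) = (φ : G → ℂ) x :=
    fun x hx g hg => hsub (Set.mk_mem_prod (hu hx) hg)
  refine Subgroup.isOpen_of_mem_nhds _ (g := 1) ?_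
  filter_upwards [hT1, inv_mem_nhds_one G hT1] with g hg hg' x
  by_cases hx : x ∈ tsupport (φ : G → ℂ)
  · exact key x hx g hg
  by_cases hxg : x * g ∈ tsupport (φ : G → ℂ)
  · have := key _ hxg g⁻¹ hg'
    rw [mul_inv_cancel_right] at this
    exact this.symm
  · rw [image_eq_zero_of_notMem_tsupport hx, image_eq_zero_of_notMem_tsupport hxg]

theorem isCompact_periods (φ : SchwartzBZ G) {x : G} (hx : (φ : G → ℂ) x ≠ 0) :
    IsCompact (periods (φ : G → ℂ) : Set G) := by
  have hcl : IsClosed (periods (φ : G → ℂ) : Set G) :=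
    Subgroup.isClosed_of_isOpen _ (isOpen_periods φ)
  refine IsCompact.of_isClosed_subset (IsCompact.smul x⁻¹ φ.2.2) hcl fun g hg => ?_
  rw [Set.mem_smul_set_iff_inv_smul_mem, inv_inv, smul_eq_mul]
  refine subset_tsupport _ ?_
  rw [Function.mem_support, hg x]
  exact hx

/-- The value of a semi-invariant functional on a `V`-periodic function is a multiple of its value
on the indicator function of `V`, the factor being independent of the functional. -/
theorem exists_eq_mul_indicator (χ : G →* ℂˣ) (V : Subgroup G) (hV : IsOpen (V : Set G))
    (i : SchwartzBZ G) (hi : (i : G → ℂ) = (V : Set G).indicator fun _ => (1 : ℂ))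
    (φ : SchwartzBZ G) (hφ : V ≤ periods (φ : G → ℂ)) :
    ∃ n : ℂ, ∀ η : SchwartzBZ G →ₗ[ℂ] ℂ, IsSemiInv χ η → η φ = n * η i := by
  classical
  have hmem : ∀ g : G, (fun x => (i : G → ℂ) (g⁻¹ * x)) ∈ SchwartzBZ G := fun g =>
    ⟨i.2.1.comp_continuous (continuous_const_mul g⁻¹),
      i.2.2.comp_homeomorph (Homeomorph.mulLeft g⁻¹)⟩
  have hfin : ((QuotientGroup.mk : G → G ⧸ V) '' tsupport (φ : G → ℂ)).Finite := by
    have : DiscreteTopology (G ⧸ V) := QuotientGroup.discreteTopology hV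
    exact (IsCompact.image φ.2.2 QuotientGroup.continuous_mk).finite_of_discrete
  have hsum : φ = ∑ q ∈ hfin.toFinset, (φ : G → ℂ) q.out •
      (⟨fun x => (i : G → ℂ) (q.out⁻¹ * x), hmem q.out⟩ : SchwartzBZ G) := by
    ext x
    have hx : ∀ q : G ⧸ V, (i : G → ℂ) (q.out⁻¹ * x) = if q = (x : G ⧸ V) then 1 else 0 := by
      intro q
      have : q.out⁻¹ * x ∈ V ↔ q = (x : G ⧸ V) := by
        rw [← QuotientGroup.eq, QuotientGroup.out_eq']
      simp [hi, Set.indicator_apply, this]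
    have hout : (φ : G → ℂ) (x : G ⧸ V).out = (φ : G → ℂ) x := by
      have h : x⁻¹ * (x : G ⧸ V).out ∈ V := by
        rw [← QuotientGroup.eq, QuotientGroup.out_eq']
      simpa using hφ h x
    simp only [Submodule.coe_sum, Submodule.coe_smul, Finset.sum_apply, Pi.smul_apply, hx,
      smul_eq_mul, mul_ite, mul_one, mul_zero, Finset.sum_ite_eq', hout]
    split_ifs with h
    · rfl
    · by_contra h0
      exact h (hfin.mem_toFinset.2 ⟨x, subset_tsupport _ h0, rfl⟩)
  refine ⟨∑ q ∈ hfin.toFinset, (φ : G → ℂ) q.out * χ q.out, fun η hη => ?_⟩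
  conv_lhs => rw [hsum]
  rw [map_sum, Finset.sum_mul]
  refine Finset.sum_congr rfl fun q _ => ?_
  rw [map_smul, hη q.out i _ fun _ => rfl, smul_eq_mul, mul_assoc]

theorem IsSemiInv.eq_zero [T2Space G] {χ : G →* ℂˣ} {η I : SchwartzBZ G →ₗ[ℂ] ℂ}
    (hη : IsSemiInv χ η) (hI : IsSemiInv χ I) {f : SchwartzBZ G} (hIf : I f ≠ 0)
    (hηf : η f = 0) : η = 0 := by
  obtain ⟨x, hx⟩ : ∃ x, (f : G → ℂ) x ≠ 0 := by
    by_contra! h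
    exact hIf (by rw [show f = 0 from Subtype.ext (funext h), map_zero])
  ext φ
  set V := periods (φ : G → ℂ) ⊓ periods (f : G → ℂ)
  have hV : IsOpen (V : Set G) := (isOpen_periods φ).inter (isOpen_periods f)
  have hVc : IsClosed (V : Set G) := Subgroup.isClosed_of_isOpen _ hV
  have hVk : IsCompact (V : Set G) :=
    (isCompact_periods f hx).of_isClosed_subset hVc Set.inter_subset_right
  let i : SchwartzBZ G := ⟨_, indicator_mem ⟨hVc, hV⟩ hVk⟩
  obtain ⟨n, hn⟩ := exists_eq_mul_indicator χ V hV i rfl φ inf_le_left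
  obtain ⟨m, hm⟩ := exists_eq_mul_indicator χ V hV i rfl f inf_le_right
  have hm0 : m ≠ 0 := by
    rintro rfl
    exact hIf (by rw [hm I hI, zero_mul])
  have : η i = 0 := by
    have h := hm η hη
    rw [hηf] at h
    exact (mul_eq_zero.1 h.symm).resolve_left hm0
  simp [hn η hη, this]

/-- Semi-invariant functionals on `𝒮(G)` are unique up to scalars. -/
theorem IsSemiInv.exists_eq_smul [T2Space G] {χ : G →* ℂˣ} {η I : SchwartzBZ G →ₗ[ℂ] ℂ}
    (hη : IsSemiInv χ η) (hI : IsSemiInv χ I) (hI0 : I ≠ 0) : ∃ c : ℂ, η = c • I := by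
  obtain ⟨f, hf⟩ : ∃ f, I f ≠ 0 := by
    by_contra! h
    exact hI0 (LinearMap.ext h)
  refine ⟨η f / I f, sub_eq_zero.1 ((hη.sub hI _).eq_zero hI hf ?_)⟩
  simp [div_mul_cancel₀ _ hf]

/-- Integration against `χ` times a Haar measure. -/
theorem exists_isSemiInv [LocallyCompactSpace G] [T2Space G] (χ : G →* ℂˣ)
    (hχ : IsLocallyConstant fun a : G => (χ a : ℂ)) :
    ∃ I : SchwartzBZ G →ₗ[ℂ] ℂ, IsSemiInv χ I ∧
      ∀ (W : Set G) (f : SchwartzBZ G), IsOpen W → IsCompact W → W.Nonempty →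
        (∀ x, (χ x : ℂ) * (f : G → ℂ) x = W.indicator (fun _ => (1 : ℂ)) x) → I f ≠ 0 := by
  borelize G
  let μ : Measure G := Measure.haar
  have hint : ∀ φ : SchwartzBZ G, Integrable (fun x => (χ x : ℂ) * (φ : G → ℂ) x) μ := fun φ =>
    (hχ.continuous.mul φ.2.1.continuous).integrable_of_hasCompactSupport φ.2.2.mul_left
  let I : SchwartzBZ G →ₗ[ℂ] ℂ :=
    { toFun := fun φ => ∫ x, (χ x : ℂ) * (φ : G → ℂ) x ∂μ
      map_add' := fun φ ψ => by
        simp only [Submodule.coe_add, Pi.add_apply, mul_add]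
        exact integral_add (hint φ) (hint ψ)
      map_smul' := fun c φ => by
        simp only [Submodule.coe_smul, Pi.smul_apply, smul_eq_mul, RingHom.id_apply]
        rw [← integral_const_mul]
        exact integral_congr_ae (.of_forall fun x => by ring) }
  refine ⟨I, fun a φ ψ h => ?_, fun W f hW hc hne h => ?_⟩
  · change ∫ x, (χ x : ℂ) * (ψ : G → ℂ) x ∂μ = χ a * ∫ x, (χ x : ℂ) * (φ : G → ℂ) x ∂μ
    rw [← integral_mul_left_eq_self _ a, ← integral_const_mul]
    refine integral_congr_ae (.of_forall fun x => ?_)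
    simp [h, mul_assoc]
  · change ∫ x, (χ x : ℂ) * (f : G → ℂ) x ∂μ ≠ 0
    simp only [h]
    rw [integral_indicator_const _ hW.measurableSet]
    have : μ.real W ≠ 0 :=
      (ENNReal.toReal_pos (hW.measure_pos μ hne).ne' hc.measure_lt_top.ne).ne'
    simpa using this

end Group

section Field

variable {K : Type*} [NontriviallyNormedField K]

theorem dilate_mem (a : Kˣ) (φ : SchwartzBZ K) :
    (fun x => (φ : K → ℂ) ((a⁻¹ : Kˣ) * x)) ∈ SchwartzBZ K :=
  ⟨φ.2.1.comp_continuous (continuous_const_mul _),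
    φ.2.2.comp_homeomorph (Homeomorph.mulLeft₀ _ a⁻¹.ne_zero)⟩

/-- The action of `Kˣ` on `𝒮(K)`. -/
noncomputable def dilate (a : Kˣ) : SchwartzBZ K →ₗ[ℂ] SchwartzBZ K where
  toFun φ := ⟨fun x => (φ : K → ℂ) ((a⁻¹ : Kˣ) * x), dilate_mem a φ⟩
  map_add' _ _ := rfl
  map_smul' _ _ := rfl

/-- Evaluation at the origin. -/
noncomputable def evalZero (K : Type*) [NontriviallyNormedField K] : SchwartzBZ K →ₗ[ℂ] ℂ where
  toFun φ := (φ : K → ℂ) 0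
  map_add' _ _ := rfl
  map_smul' _ _ := rfl

theorem isOpenEmbedding_units_val : IsOpenEmbedding (Units.val : Kˣ → K) := by
  refine ⟨Units.isEmbedding_val₀, ?_⟩
  have : Set.range (Units.val : Kˣ → K) = {0}ᶜ := by
    ext x
    exact ⟨fun ⟨u, hu⟩ => hu ▸ u.ne_zero, fun hx => ⟨Units.mk0 x hx, rfl⟩⟩
  rw [this]
  exact isOpen_compl_singleton

/-- Restriction to `Kˣ` preserves compactness of the support for functions vanishing at `0`. -/
theorem comp_val_mem (φ : SchwartzBZ K) (h0 : (φ : K → ℂ) 0 = 0) :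
    (fun x : Kˣ => (φ : K → ℂ) x) ∈ SchwartzBZ Kˣ := by
  refine ⟨φ.2.1.comp_continuous Units.continuous_val, ?_⟩
  have hc : IsCompact (Function.support (φ : K → ℂ)) :=
    IsCompact.of_isClosed_subset φ.2.2 (isClopen_support φ).1 (subset_tsupport _)
  refine HasCompactSupport.intro
    ((isOpenEmbedding_units_val.isInducing.isCompact_preimage_iff fun x hx => ?_).2 hc) fun x hx => ?_
  · exact ⟨Units.mk0 x fun h => hx (h ▸ h0), rfl⟩
  · simpa using hx

theorem extend_val_apply (φ : Kˣ → ℂ) (x : Kˣ) :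
    Function.extend Units.val φ (0 : K → ℂ) x = φ x :=
  Units.val_injective.extend_apply _ _ _

theorem extend_val_zero (φ : Kˣ → ℂ) :
    Function.extend Units.val φ (0 : K → ℂ) 0 = 0 :=
  Function.extend_apply' _ _ _ fun ⟨u, hu⟩ => u.ne_zero hu

theorem extend_val_mem (φ : SchwartzBZ Kˣ) :
    Function.extend Units.val (φ : Kˣ → ℂ) (0 : K → ℂ) ∈ SchwartzBZ K := by
  have hS : IsCompact (Units.val '' tsupport (φ : Kˣ → ℂ) : Set K) :=
    IsCompact.image φ.2.2 Units.continuous_val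
  have hz : ∀ x ∉ (Units.val '' tsupport (φ : Kˣ → ℂ) : Set K),
      Function.extend Units.val (φ : Kˣ → ℂ) (0 : K → ℂ) x = 0 := by
    intro x hx
    rcases eq_or_ne x 0 with rfl | h0
    · exact extend_val_zero _
    · lift x to Kˣ using h0.isUnit
      rw [extend_val_apply]
      exact image_eq_zero_of_notMem_tsupport fun h => hx ⟨x, h, rfl⟩
  refine ⟨(IsLocallyConstant.iff_eventually_eq _).2 fun x => ?_, HasCompactSupport.intro hS hz⟩
  rcases eq_or_ne x 0 with rfl | h0
  · have h0S : (0 : K) ∉ (Units.val '' tsupport (φ : Kˣ → ℂ) : Set K) :=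
      fun ⟨u, _, hu⟩ => u.ne_zero hu
    filter_upwards [hS.isClosed.isOpen_compl.mem_nhds h0S] with y hy
    rw [hz y hy, extend_val_zero]
  · lift x to Kˣ using h0.isUnit
    rw [← isOpenEmbedding_units_val.map_nhds_eq, Filter.eventually_map]
    filter_upwards [(IsLocallyConstant.iff_eventually_eq _).1 φ.2.1 x] with y hy
    rw [extend_val_apply, extend_val_apply, hy]

/-- Extension by zero from `Kˣ` to `K`. -/
noncomputable def extendZero (K : Type*) [NontriviallyNormedField K] :
    SchwartzBZ Kˣ →ₗ[ℂ] SchwartzBZ K where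
  toFun φ := ⟨Function.extend Units.val (φ : Kˣ → ℂ) (0 : K → ℂ), extend_val_mem φ⟩
  map_add' φ ψ := by
    ext x
    rcases eq_or_ne x 0 with rfl | h0
    · simp
    · lift x to Kˣ using h0.isUnit
      simp [extend_val_apply]
  map_smul' c φ := by
    ext x
    rcases eq_or_ne x 0 with rfl | h0
    · simp
    · lift x to Kˣ using h0.isUnit
      simp [extend_val_apply]

theorem extendZero_eq {φ : SchwartzBZ Kˣ} {ψ : SchwartzBZ K} (h0 : (ψ : K → ℂ) 0 = 0)
    (h : ∀ x : Kˣ, (φ : Kˣ → ℂ) x = (ψ : K → ℂ) x) : extendZero K φ = ψ := by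
  ext x
  rcases eq_or_ne x 0 with rfl | hx
  · exact (extend_val_zero _).trans h0.symm
  · lift x to Kˣ using hx.isUnit
    exact (extend_val_apply _ x).trans (h x)

/-- The restriction of `φ(a⁻¹ x) - φ(x)` to `Kˣ`. -/
noncomputable def dilateSub (a : Kˣ) : SchwartzBZ K →ₗ[ℂ] SchwartzBZ Kˣ where
  toFun φ := ⟨_, comp_val_mem (dilate a φ - φ) (by simp [dilate])⟩
  map_add' φ ψ := by
    ext x
    simp
    ring
  map_smul' c φ := by
    ext x
    simp
    ring

theorem dilateSub_apply (a : Kˣ) (φ : SchwartzBZ K) (x : Kˣ) :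
    (dilateSub a φ : Kˣ → ℂ) x = (φ : K → ℂ) ((a⁻¹ : Kˣ) * x) - (φ : K → ℂ) x := rfl

theorem extendZero_dilateSub (a : Kˣ) (φ : SchwartzBZ K) :
    extendZero K (dilateSub a φ) = dilate a φ - φ :=
  extendZero_eq (by simp [dilate]) fun _ => rfl

theorem isSemiInv_comp_extendZero {χ : Kˣ →* ℂˣ} {η : SchwartzBZ K →ₗ[ℂ] ℂ}
    (hη : IsSemiInvDistrib χ η) : IsSemiInv χ (η ∘ₗ extendZero K) := fun a φ ψ h => by
  refine hη a _ _ fun x => ?_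
  change Function.extend Units.val (ψ : Kˣ → ℂ) (0 : K → ℂ) x =
    Function.extend Units.val (φ : Kˣ → ℂ) (0 : K → ℂ) ((a⁻¹ : Kˣ) * x)
  rcases eq_or_ne x 0 with rfl | h0
  · simp
  · lift x to Kˣ using h0.isUnit
    rw [← Units.val_mul, extend_val_apply, extend_val_apply, h]

theorem isSemiInvDistrib_comp_dilateSub {χ : Kˣ →* ℂˣ} {I : SchwartzBZ Kˣ →ₗ[ℂ] ℂ}
    (hI : IsSemiInv χ I) (a : Kˣ) : IsSemiInvDistrib χ (I ∘ₗ dilateSub a) := fun b φ ψ h => by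
  refine hI b _ _ fun x => ?_
  rw [dilateSub_apply, dilateSub_apply, h, h, Units.val_mul, mul_left_comm]

theorem dilateSub_extendZero (a : Kˣ) (φ : SchwartzBZ Kˣ) (x : Kˣ) :
    (dilateSub a (extendZero K φ) : Kˣ → ℂ) x = (φ : Kˣ → ℂ) (a⁻¹ * x) - (φ : Kˣ → ℂ) x := by
  rw [dilateSub_apply, ← Units.val_mul]
  exact congrArg₂ _ (extend_val_apply _ _) (extend_val_apply _ _)

theorem IsSemiInv.apply_dilateSub_extendZero {χ : Kˣ →* ℂˣ} {I : SchwartzBZ Kˣ →ₗ[ℂ] ℂ}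
    (hI : IsSemiInv χ I) (a : Kˣ) (φ : SchwartzBZ Kˣ) :
    I (dilateSub a (extendZero K φ)) = (χ a - 1) * I φ := by
  have h := hI a φ (dilateSub a (extendZero K φ) + φ) fun x => by
    simp [dilateSub_extendZero]
  rw [map_add] at h
  linear_combination h

/-- A semi-invariant distribution supported at the origin vanishes when `χ` is nontrivial. -/
theorem eq_zero_of_comp_extendZero {χ : Kˣ →* ℂˣ} {η : SchwartzBZ K →ₗ[ℂ] ℂ}
    (hη : IsSemiInvDistrib χ η) (h : η ∘ₗ extendZero K = 0) {a : Kˣ} (ha : (χ a : ℂ) ≠ 1) :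
    η = 0 := by
  ext φ
  have h1 : η (dilate a φ - φ) = 0 := by
    rw [← extendZero_dilateSub]
    exact LinearMap.congr_fun h _
  rw [map_sub, hη a φ _ fun _ => rfl] at h1
  have h2 : ((χ a : ℂ) - 1) * η φ = 0 := by linear_combination h1
  exact (mul_eq_zero.1 h2).resolve_left (sub_ne_zero.2 ha)

/-- There is a compact open neighbourhood of `0` strictly containing one of its dilates. -/
theorem exists_compact_open_smul_ssubset (K : Type*) [NontriviallyNormedField K]
    [LocallyCompactSpace K] [TotallyDisconnectedSpace K] :
    ∃ (V : Set K) (a : Kˣ), IsClopen V ∧ IsCompact V ∧ (0 : K) ∈ V ∧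
      (∀ x : K, ((a⁻¹ : Kˣ) : K) * x ∈ V → x ∈ V) ∧
      ∃ x : Kˣ, (x : K) ∈ V ∧ ((a⁻¹ : Kˣ) : K) * x ∉ V := by
  obtain ⟨C, hC, hC0⟩ := exists_compact_mem_nhds (0 : K)
  obtain ⟨V, hV, hV0, hVC⟩ := loc_compact_Haus_tot_disc_of_zero_dim.mem_nhds_iff.1 hC0
  have hVc : IsCompact V := hC.of_isClosed_subset hV.1 hVC
  obtain ⟨R, hR⟩ := hVc.isBounded.exists_norm_le
  obtain ⟨ε, hε, hball⟩ := Metric.isOpen_iff.1 hV.2 0 hV0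
  have hR0 : 0 ≤ R := by simpa using hR 0 hV0
  obtain ⟨b, hb0, hb⟩ := NormedField.exists_norm_lt K (r := min 1 (ε / (R + 1))) (by positivity)
  let a : Kˣ := Units.mk0 b (norm_pos_iff.1 hb0)
  obtain ⟨x, hxV, hmax⟩ := hVc.exists_isMaxOn ⟨0, hV0⟩ continuous_norm.continuousOn
  obtain ⟨y, hy0, hy⟩ := NormedField.exists_norm_lt K hε
  have hxpos : 0 < ‖x‖ := hy0.trans_le (hmax (hball (by simpa using hy)))
  refine ⟨V, a, hV, hVc, hV0, fun z hz => ?_, Units.mk0 x (norm_pos_iff.1 hxpos), hxV, fun h => ?_⟩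
  · have hz' : z = b * ((a⁻¹ : Kˣ) * z) := by
      change z = a * _
      rw [Units.mul_inv_cancel_left]
    apply hball
    rw [mem_ball_zero_iff, hz', norm_mul]
    calc ‖b‖ * ‖((a⁻¹ : Kˣ) : K) * z‖ ≤ ‖b‖ * (R + 1) := by
          gcongr
          linarith [hR _ hz]
      _ < ε / (R + 1) * (R + 1) := by
          gcongr
          exact hb.trans_le (min_le_right _ _)
      _ = ε := by field_simp
  · have h1 : ‖((a⁻¹ : Kˣ) : K) * x‖ ≤ ‖x‖ := hmax h
    have h2 : x = b * ((a⁻¹ : Kˣ) * x) := by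
      change x = a * _
      rw [Units.mul_inv_cancel_left]
    have h3 : ‖b‖ < 1 := hb.trans_le (min_le_left _ _)
    have h4 : ‖x‖ = ‖b‖ * ‖((a⁻¹ : Kˣ) : K) * x‖ := by rw [← norm_mul, ← h2]
    nlinarith [norm_nonneg (((a⁻¹ : Kˣ) : K) * x)]

end Field
end SchwartzBZ

open SchwartzBZ

/-- Let `k` be a non-archimedean local field of characteristic zero
(a locally compact, totally disconnected, nontrivially normed field of characteristic
zero, i.e. a finite extension of `ℚ_p`).  For every locally constant character
`χ : k^× → ℂ^×`, the space of `χ`-invariant distributions on `k` is exactly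
one-dimensional. -/
theorem semiInvariant_distributions_on_local_field_one_dimensional
    (K : Type*) [NontriviallyNormedField K] [LocallyCompactSpace K]
    [TotallyDisconnectedSpace K] [CharZero K]
    (χ : Kˣ →* ℂˣ) (hχ : IsLocallyConstant fun a : Kˣ => (χ a : ℂ)) :
    ∃ η₀ : SchwartzBZ K →ₗ[ℂ] ℂ, IsSemiInvDistrib χ η₀ ∧ η₀ ≠ 0 ∧
      ∀ η : SchwartzBZ K →ₗ[ℂ] ℂ, IsSemiInvDistrib χ η → ∃ c : ℂ, η = c • η₀ := by
  obtain ⟨I, hI, hI'⟩ := exists_isSemiInv χ hχ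
  obtain ⟨V, b, hV, hVc, hV0, hsub, y, hyV, hyb⟩ := exists_compact_open_smul_ssubset K
  let v : SchwartzBZ K := ⟨_, indicator_mem hV hVc⟩
  have hv : ∀ x, (v : K → ℂ) x = V.indicator (fun _ => 1) x := fun _ => rfl
  have hv0 : (v : K → ℂ) 0 = 1 := by simp [hv, hV0]
  let W : Set Kˣ := {x | (x : K) ∈ V ∧ ((b⁻¹ : Kˣ) : K) * x ∉ V}
  have hW : ∀ x : Kˣ, (dilateSub b v : Kˣ → ℂ) x = -W.indicator (fun _ => 1) x := by
    intro x
    by_cases h1 : (x : K) ∈ V <;> by_cases h2 : ((b⁻¹ : Kˣ) : K) * x ∈ V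
    · simp [dilateSub_apply, hv, W, h1, h2, -Units.val_inv_eq_inv_val]
    · simp [dilateSub_apply, hv, W, h1, h2, -Units.val_inv_eq_inv_val]
    · exact absurd (hsub _ h2) h1
    · simp [dilateSub_apply, hv, W, h1, h2, -Units.val_inv_eq_inv_val]
  have hWs : W = Function.support (dilateSub b v : Kˣ → ℂ) := by
    ext x
    simp [hW]
  have hWo : IsClopen W := hWs ▸ isClopen_support _
  have hWc : IsCompact W :=
    IsCompact.of_isClosed_subset (dilateSub b v).2.2 hWo.1 (hWs ▸ subset_tsupport _)
  have hWn : W.Nonempty := ⟨y, hyV, hyb⟩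
  have hWm := indicator_mem hWo hWc
  let f : SchwartzBZ Kˣ := ⟨fun x => (χ x : ℂ)⁻¹ * W.indicator (fun _ => 1) x,
    (hχ.comp (·⁻¹)).comp₂ hWm.1 (· * ·), hWm.2.mul_left⟩
  have hIf : I f ≠ 0 := hI' W f hWo.2 hWc hWn fun x => mul_inv_cancel_left₀ (χ x).ne_zero _
  have hI0 : I ≠ 0 := fun h => hIf (by rw [h, LinearMap.zero_apply])
  by_cases hχ1 : ∀ a, (χ a : ℂ) = 1
  · refine ⟨evalZero K, fun a φ ψ h => ?_, fun h => ?_, fun η hη => ⟨η v, ?_⟩⟩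
    · change (ψ : K → ℂ) 0 = χ a * (φ : K → ℂ) 0
      rw [h, mul_zero, hχ1, one_mul]
    · exact one_ne_zero (hv0.symm.trans (LinearMap.congr_fun h v))
    obtain ⟨c, hc⟩ := (isSemiInv_comp_extendZero hη).exists_eq_smul hI hI0
    have hdf : dilateSub b v = -f := by
      ext x
      simp [hW, f, hχ1]
    have hc0 : c = 0 := by
      have h := LinearMap.congr_fun hc (dilateSub b v)
      rw [LinearMap.comp_apply, extendZero_dilateSub, map_sub, hη b v _ fun _ => rfl, hχ1,
        one_mul, sub_self, LinearMap.smul_apply, hdf, map_neg, smul_neg, smul_eq_mul, eq_comm,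
        neg_eq_zero] at h
      exact (mul_eq_zero.1 h).resolve_right hIf
    rw [hc0, zero_smul] at hc
    ext φ
    have h0 : ((φ - (φ : K → ℂ) 0 • v : SchwartzBZ K) : K → ℂ) 0 = 0 := by simp [hv0]
    have h := LinearMap.congr_fun hc ⟨_, comp_val_mem _ h0⟩
    rw [LinearMap.comp_apply, extendZero_eq h0 fun _ => rfl, LinearMap.zero_apply, map_sub,
      map_smul, smul_eq_mul, sub_eq_zero] at h
    rw [h, mul_comm]
    rfl
  · push Not at hχ1
    obtain ⟨a, ha⟩ := hχ1
    have hη₀ := isSemiInvDistrib_comp_dilateSub hI a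
    have ha' : (χ a : ℂ) - 1 ≠ 0 := sub_ne_zero.2 ha
    refine ⟨I ∘ₗ dilateSub a, hη₀, fun h => ?_, fun η hη => ?_⟩
    · have h1 := hI.apply_dilateSub_extendZero a f
      rw [← LinearMap.comp_apply, h, LinearMap.zero_apply] at h1
      exact mul_ne_zero ha' hIf h1.symm
    obtain ⟨c, hc⟩ := (isSemiInv_comp_extendZero hη).exists_eq_smul hI hI0
    refine ⟨c / (χ a - 1), sub_eq_zero.1 (eq_zero_of_comp_extendZero (χ := χ) ?_ ?_ ha)⟩
    · intro g φ ψ h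
      simp only [LinearMap.sub_apply, LinearMap.smul_apply, smul_eq_mul, hη g φ ψ h,
        hη₀ g φ ψ h]
      ring
    · ext φ
      have h1 := LinearMap.congr_fun hc φ
      simp only [LinearMap.comp_apply, LinearMap.smul_apply, smul_eq_mul] at h1
      simp only [LinearMap.comp_apply, LinearMap.sub_apply, LinearMap.smul_apply, smul_eq_mul,
        LinearMap.zero_apply, h1, hI.apply_dilateSub_extendZero]
      field_simp
      ring
end

section
/- Let k be a non-archimedean local field of characteristic zero, let n ≥ 1, and let G = GL_n(k) × GL_n(k) act on the space M_n of n×n matrices over k by (g₁,g₂)·x := g₁xg₂⁻¹. Then for every character χ of k^×, the space of (χ,χ⁻¹)-invariant distributions on M_n, i.e. linear functionals η : 𝒮(M_n) → ℂ with η((g₁,g₂)·φ) = χ(det g₁)χ(det g₂)⁻¹·η(φ) for all (g₁,g₂) ∈ G and φ ∈ 𝒮(M_n), is exactly one-dimensional. -/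
open Matrix

/-- `η` is a `(χ,χ⁻¹)`-invariant distribution on `M_n(k)` for the action
`(g₁,g₂)·x = g₁ x g₂⁻¹` of `GL_n(k) × GL_n(k)`:
`η((g₁,g₂)·φ) = χ(det g₁) χ(det g₂)⁻¹ η(φ)`, where `((g₁,g₂)·φ)(x) = φ(g₁⁻¹ x g₂)`. -/
def IsMatInvDistrib {K : Type*} [NontriviallyNormedField K] {n : ℕ} (χ : Kˣ →* ℂˣ)
    (η : SchwartzBZ (Matrix (Fin n) (Fin n) K) →ₗ[ℂ] ℂ) : Prop :=
  ∀ (g₁ g₂ : GL (Fin n) K) (φ ψ : SchwartzBZ (Matrix (Fin n) (Fin n) K)),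
    (∀ x : Matrix (Fin n) (Fin n) K,
      (ψ : Matrix (Fin n) (Fin n) K → ℂ) x =
        (φ : Matrix (Fin n) (Fin n) K → ℂ) ((g₁⁻¹ : GL (Fin n) K) * x * (g₂ : Matrix (Fin n) (Fin n) K))) →
    η ψ = (χ (Matrix.GeneralLinearGroup.det g₁) : ℂ) *
      ((χ (Matrix.GeneralLinearGroup.det g₂))⁻¹ : ℂˣ) * η φ

namespace SchwartzBZ

section General

variable {X Y : Type*} [TopologicalSpace X] [TopologicalSpace Y]

/-- The indicator function of a compact open set, with junk value `0` on other sets. -/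
noncomputable def ind (U : Set X) : SchwartzBZ X := by
  classical
  exact if h : IsClopen U ∧ IsCompact U then
    ⟨U.indicator 1, by
      refine ⟨(IsLocallyConstant.iff_eventually_eq _).2 fun x => ?_, ?_⟩
      · by_cases hx : x ∈ U
        · filter_upwards [h.1.isOpen.mem_nhds hx] with y hy
          simp [hx, hy]
        · filter_upwards [h.1.compl.isOpen.mem_nhds hx] with y hy
          simp [hx, Set.indicator_of_notMem hy]
      · refine HasCompactSupport.intro' h.2 h.1.isClosed fun x hx => ?_
        simp [hx]⟩
  else 0

theorem ind_coe {U : Set X} (h : IsClopen U ∧ IsCompact U) :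
    (ind U : X → ℂ) = U.indicator 1 := by
  simp [ind, h]

theorem ind_of_mem {U : Set X} (h : IsClopen U ∧ IsCompact U) {x : X} (hx : x ∈ U) :
    (ind U : X → ℂ) x = 1 := by
  simp [ind_coe h, hx]

theorem ind_of_notMem {U : Set X} (h : IsClopen U ∧ IsCompact U) {x : X} (hx : x ∉ U) :
    (ind U : X → ℂ) x = 0 := by
  simp [ind_coe h, hx]

theorem mem_of_ind_ne_zero {U : Set X} (h : IsClopen U ∧ IsCompact U) {x : X}
    (hx : (ind U : X → ℂ) x ≠ 0) : x ∈ U := by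
  by_contra hU
  exact hx (ind_of_notMem h hU)

theorem eventually_eq (φ : SchwartzBZ X) (x : X) :
    ∀ᶠ y in nhds x, (φ : X → ℂ) y = (φ : X → ℂ) x :=
  (IsLocallyConstant.iff_eventually_eq _).1 φ.2.1 x

theorem isCompact_support (φ : SchwartzBZ X) : IsCompact (Function.support (φ : X → ℂ)) := by
  have h : IsClosed (Function.support (φ : X → ℂ)) := (φ.2.1.isClopen_fiber 0).compl.isClosed
  have := φ.2.2
  rwa [HasCompactSupport, tsupport, h.closure_eq] at this

/-- Pull-back of Schwartz functions along a homeomorphism. -/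
noncomputable def pull (e : X ≃ₜ Y) : SchwartzBZ Y →ₗ[ℂ] SchwartzBZ X where
  toFun φ := ⟨φ.1 ∘ e, φ.2.1.comp_continuous e.continuous, φ.2.2.comp_homeomorph e⟩
  map_add' _ _ := rfl
  map_smul' _ _ := rfl

@[simp]
theorem pull_apply (e : X ≃ₜ Y) (φ : SchwartzBZ Y) (x : X) :
    (pull e φ : X → ℂ) x = (φ : Y → ℂ) (e x) := rfl

theorem pull_ind (e : X ≃ₜ Y) {U : Set Y} (h : IsClopen U ∧ IsCompact U) :
    pull e (ind U) = ind (e ⁻¹' U) := by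
  have h' : IsClopen (e ⁻¹' U) ∧ IsCompact (e ⁻¹' U) :=
    ⟨h.1.preimage e.continuous, e.isCompact_preimage.2 h.2⟩
  refine Subtype.ext (funext fun x => ?_)
  rw [pull_apply, ind_coe h, ind_coe h']
  rfl

/-- Multiplication of Schwartz functions by a locally constant function. -/
noncomputable def mulLeft (w : X → ℂ) (hw : IsLocallyConstant w) :
    SchwartzBZ X →ₗ[ℂ] SchwartzBZ X where
  toFun φ := ⟨w * φ.1, hw.mul φ.2.1, φ.2.2.mul_left⟩
  map_add' φ ψ := Subtype.ext (mul_add w φ.1 ψ.1)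
  map_smul' c φ := Subtype.ext (mul_smul_comm c w φ.1)

@[simp]
theorem mulLeft_apply (w : X → ℂ) (hw : IsLocallyConstant w) (φ : SchwartzBZ X) (x : X) :
    (mulLeft w hw φ : X → ℂ) x = w x * (φ : X → ℂ) x := rfl

/-- A Schwartz function that is constant on the classes of an equivalence relation with compact
open classes is a finite combination of indicators of classes. -/
theorem exists_finset_eq_sum_ind (s : Setoid X)
    (hs : ∀ x, IsClopen {y | s y x} ∧ IsCompact {y | s y x})
    (φ : SchwartzBZ X) (hφ : ∀ x y, s y x → (φ : X → ℂ) y = (φ : X → ℂ) x) :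
    ∃ T : Finset X, (∀ t ∈ T, (φ : X → ℂ) t ≠ 0) ∧
      (∀ x, (φ : X → ℂ) x ≠ 0 → ∃ t ∈ T, s x t) ∧
      φ = ∑ t ∈ T, (φ : X → ℂ) t • ind {y | s y t} := by
  classical
  obtain ⟨T₀, -, hT₀⟩ := (isCompact_support φ).elim_nhds_subcover (fun x => {y | s y x})
    fun x _ => (hs x).1.isOpen.mem_nhds (s.refl x)
  let rep : X → X := fun x => Quotient.out (Quotient.mk s x)
  have hrep : ∀ x, s (rep x) x := fun x => Quotient.mk_out x
  have hrep' : ∀ x y, s x y → rep x = rep y := fun x y h => by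
    simp only [rep, Quotient.sound h]
  let T := (T₀.image rep).filter fun t => (φ : X → ℂ) t ≠ 0
  have hcov : ∀ x, (φ : X → ℂ) x ≠ 0 → rep x ∈ T := by
    intro x hx
    obtain ⟨t, ht, hxt⟩ := Set.mem_iUnion₂.1 (hT₀ hx)
    refine Finset.mem_filter.2 ⟨Finset.mem_image.2 ⟨t, ht, (hrep' _ _ hxt).symm⟩, ?_⟩
    rwa [hφ _ _ (hrep x)]
  refine ⟨T, fun t ht => (Finset.mem_filter.1 ht).2, fun x hx => ⟨_, hcov x hx, s.symm (hrep x)⟩, ?_⟩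
  refine Subtype.ext (funext fun x => ?_)
  have hsum : (↑(∑ t ∈ T, (φ : X → ℂ) t • ind {y | s y t}) : X → ℂ) x =
      ∑ t ∈ T, (φ : X → ℂ) t * (ind {y | s y t} : X → ℂ) x := by
    rw [Submodule.coe_sum, Finset.sum_apply]
    rfl
  rw [hsum]
  have hT : ∀ t ∈ T, s x t → t = rep x := by
    intro t ht hxt
    obtain ⟨t₁, -, rfl⟩ := Finset.mem_image.1 (Finset.mem_filter.1 ht).1
    exact (hrep' _ _ (s.trans hxt (hrep t₁))).symm
  by_cases hx : (φ : X → ℂ) x = 0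
  · rw [hx, Finset.sum_eq_zero]
    intro t ht
    rw [ind_of_notMem (hs t), mul_zero]
    intro hxt
    exact (Finset.mem_filter.1 ht).2 (by rw [← hφ t x hxt, hx])
  · rw [Finset.sum_eq_single_of_mem (rep x) (hcov x hx), ind_of_mem (hs _), mul_one,
      hφ _ _ (hrep x)]
    · exact s.symm (hrep x)
    · intro t ht hne
      rw [ind_of_notMem (hs t), mul_zero]
      exact fun hxt => hne (hT t ht hxt)

end General

/-- Integration against a Haar measure, as a translation-invariant functional. -/
theorem exists_translation_invariant (V : Type*) [AddCommGroup V] [TopologicalSpace V]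
    [IsTopologicalAddGroup V] [LocallyCompactSpace V] :
    ∃ I : SchwartzBZ V →ₗ[ℂ] ℂ,
      (∀ (v : V) (φ : SchwartzBZ V), I (pull (Homeomorph.addRight v) φ) = I φ) ∧
      ∀ U : Set V, IsClopen U → IsCompact U → U.Nonempty → I (ind U) ≠ 0 := by
  let _ : MeasurableSpace V := borel V
  have : BorelSpace V := ⟨rfl⟩
  let μ : MeasureTheory.Measure V := MeasureTheory.Measure.addHaar
  have hint : ∀ φ : SchwartzBZ V, MeasureTheory.Integrable (φ : V → ℂ) μ := fun φ =>
    φ.2.1.continuous.integrable_of_hasCompactSupport φ.2.2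
  refine ⟨⟨⟨fun φ => ∫ x, (φ : V → ℂ) x ∂μ, fun φ ψ => ?_⟩, fun c φ => ?_⟩, fun v φ => ?_,
    fun U hU hc hne => ?_⟩
  · exact MeasureTheory.integral_add (hint φ) (hint ψ)
  · exact MeasureTheory.integral_smul c _
  · exact MeasureTheory.integral_add_right_eq_self (φ : V → ℂ) v
  · change ∫ x, (ind U : V → ℂ) x ∂μ ≠ 0
    rw [ind_coe ⟨hU, hc⟩]
    change ∫ x, U.indicator (fun _ => (1 : ℂ)) x ∂μ ≠ 0
    rw [MeasureTheory.integral_indicator_const _ hU.isOpen.measurableSet]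
    refine smul_ne_zero ?_ one_ne_zero
    exact (ENNReal.toReal_pos (hU.isOpen.measure_pos μ hne).ne' hc.measure_lt_top.ne).ne'

end SchwartzBZ

section Field

variable {K : Type*} [NontriviallyNormedField K]

theorem isUltrametricDist_of_totallyDisconnectedSpace [LocallyCompactSpace K]
    [TotallyDisconnectedSpace K] : IsUltrametricDist K := by
  refine IsUltrametricDist.isUltrametricDist_of_forall_norm_natCast_le_one fun n => ?_
  obtain ⟨C, hC, h0⟩ := exists_compact_mem_nhds (0 : K)
  obtain ⟨W, hW, h0W, hWC⟩ := (loc_compact_Haus_tot_disc_of_zero_dim (H := K)).mem_nhds_iff.1 h0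
  have hWc : IsCompact W := hC.of_isClosed_subset hW.isClosed hWC
  obtain ⟨V, hV, hWV⟩ := compact_open_separated_add_right hWc hW.isOpen subset_rfl
  obtain ⟨ε, hε, hεV⟩ := Metric.mem_nhds_iff.1 hV
  obtain ⟨x, hx0, hxε⟩ := NormedField.exists_norm_lt K hε
  have hxV : x ∈ V := hεV (by simpa using hxε)
  have hmul : ∀ m : ℕ, (m : K) * x ∈ W := by
    intro m
    induction m with
    | zero => simpa using h0W
    | succ m ih =>
      rw [Nat.cast_succ, add_mul, one_mul]
      exact hWV (Set.add_mem_add ih hxV)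
  obtain ⟨B, hB⟩ := hWc.isBounded.exists_norm_le
  by_contra! hn
  obtain ⟨j, hj⟩ := pow_unbounded_of_one_lt (B / ‖x‖) hn
  have := hB _ (hmul (n ^ j))
  rw [norm_mul, Nat.cast_pow, norm_pow] at this
  rw [div_lt_iff₀ hx0] at hj
  linarith

theorem exists_uniformizer [LocallyCompactSpace K] [IsUltrametricDist K] :
    ∃ ϖ : K, ϖ ≠ 0 ∧ ‖ϖ‖ < 1 ∧ ∀ x : K, ‖x‖ < 1 → ‖x‖ ≤ ‖ϖ‖ := by
  have : ProperSpace K := ProperSpace.of_locallyCompactSpace K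
  have hc : IsCompact (Metric.ball (0 : K) 1) :=
    (isCompact_closedBall (0 : K) 1).of_isClosed_subset (IsUltrametricDist.isClosed_ball _ _)
      Metric.ball_subset_closedBall
  obtain ⟨ϖ, hϖ, hmax⟩ := hc.exists_isMaxOn ⟨0, by simp⟩ continuous_norm.continuousOn
  have hm : ∀ x : K, ‖x‖ < 1 → ‖x‖ ≤ ‖ϖ‖ := fun x hx => hmax (by simpa using hx)
  obtain ⟨x, hx0, hx1⟩ := NormedField.exists_norm_lt K one_pos
  exact ⟨ϖ, norm_pos_iff.1 (hx0.trans_le (hm x hx1)), by simpa using hϖ, hm⟩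

theorem exists_norm_eq_zpow {ϖ : K} (h0 : ϖ ≠ 0) (h1 : ‖ϖ‖ < 1)
    (hm : ∀ x : K, ‖x‖ < 1 → ‖x‖ ≤ ‖ϖ‖) {x : K} (hx : x ≠ 0) : ∃ m : ℤ, ‖x‖ = ‖ϖ‖ ^ m := by
  have hϖ : 0 < ‖ϖ‖ := norm_pos_iff.2 h0
  obtain ⟨m, hm1, hm2⟩ := exists_mem_Ico_zpow (norm_pos_iff.2 hx) ((one_lt_inv₀ hϖ).2 h1)
  rw [_root_.inv_zpow'] at hm1 hm2
  refine ⟨-m, le_antisymm ?_ hm1⟩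
  by_contra! hlt
  have hp : 0 < ‖ϖ‖ ^ (-m) := zpow_pos hϖ _
  have h2 : 1 < ‖x‖ / ‖ϖ‖ ^ (-m) := (one_lt_div hp).2 hlt
  have h3 := hm (x / ϖ ^ (-m))⁻¹ (by rw [norm_inv, norm_div, norm_zpow]; exact inv_lt_one_of_one_lt₀ h2)
  rw [norm_inv, norm_div, norm_zpow, inv_div, div_le_iff₀ (norm_pos_iff.2 hx)] at h3
  rw [neg_add, zpow_add₀ hϖ.ne', _root_.zpow_neg_one, ← div_eq_mul_inv, lt_div_iff₀ hϖ] at hm2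
  linarith

end Field

section Matrices

variable {K : Type*} [NontriviallyNormedField K] {n : ℕ}

/-- The matrices whose `j`-th column is within distance `e j` of the `j`-th column of `t`. -/
def colBox (e : Fin n → ℝ) (t : Matrix (Fin n) (Fin n) K) : Set (Matrix (Fin n) (Fin n) K) :=
  {y | ∀ i j, ‖y i j - t i j‖ ≤ e j}

/-- The matrix entries have norm at most one. -/
def IsIntegralMatrix (A : Matrix (Fin n) (Fin n) K) : Prop := ∀ i j, ‖A i j‖ ≤ 1

theorem isIntegralMatrix_one : IsIntegralMatrix (1 : Matrix (Fin n) (Fin n) K) := fun i j => by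
  rw [Matrix.one_apply]
  split_ifs <;> simp

theorem exists_colBox_subset {ϖ : K} (h1 : ‖ϖ‖ < 1) {x : Matrix (Fin n) (Fin n) K}
    {U : Set (Matrix (Fin n) (Fin n) K)} (hU : U ∈ nhds x) :
    ∃ N : ℕ, colBox (fun _ => ‖ϖ‖ ^ N) x ⊆ U := by
  obtain ⟨ε, hε, hU⟩ := Metric.mem_nhds_iff.1
    (show U ∈ nhds (X := Fin n → Fin n → K) x from hU)
  obtain ⟨N, hN⟩ := exists_pow_lt_of_lt_one hε h1
  refine ⟨N, fun y hy => hU ?_⟩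
  refine (dist_pi_lt_iff hε).2 fun i => (dist_pi_lt_iff hε).2 fun j => ?_
  rw [dist_eq_norm]
  exact (hy i j).trans_lt hN

section Ultrametric

variable [IsUltrametricDist K]

theorem norm_sub_le_of_le_ultra {a b : K} {c : ℝ} (ha : ‖a‖ ≤ c) (hb : ‖b‖ ≤ c) : ‖a - b‖ ≤ c := by
  rw [sub_eq_add_neg]
  exact (IsUltrametricDist.norm_add_le_max a (-b)).trans (max_le ha (by rwa [norm_neg]))

theorem norm_add_le_of_le_ultra {a b : K} {c : ℝ} (ha : ‖a‖ ≤ c) (hb : ‖b‖ ≤ c) : ‖a + b‖ ≤ c :=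
  (IsUltrametricDist.norm_add_le_max a b).trans (max_le ha hb)

theorem norm_sub_le_trans {a b c : K} {r : ℝ} (h₁ : ‖a - b‖ ≤ r) (h₂ : ‖b - c‖ ≤ r) :
    ‖a - c‖ ≤ r := by
  rw [← sub_add_sub_cancel a b c]
  exact norm_add_le_of_le_ultra h₁ h₂

theorem norm_eq_one_of_norm_sub_lt {a : K} (h : ‖a - 1‖ < 1) : ‖a‖ = 1 := by
  have := IsUltrametricDist.norm_add_eq_max_of_norm_ne_norm (x := a - 1) (y := (1 : K))
    (by rw [norm_one]; exact h.ne)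
  rw [sub_add_cancel, norm_one, max_eq_right h.le] at this
  exact this

/-- The partition of the matrix space into translates of a column box. -/
def colSetoid (e : Fin n → ℝ) (he : ∀ j, 0 < e j) : Setoid (Matrix (Fin n) (Fin n) K) where
  r y x := y ∈ colBox e x
  iseqv :=
    { refl := fun x i j => by simpa using (he j).le
      symm := fun h i j => by rw [norm_sub_rev]; exact h i j
      trans := fun h₁ h₂ i j => norm_sub_le_trans (h₁ i j) (h₂ i j) }

theorem isClopen_isCompact_colBox [LocallyCompactSpace K] {e : Fin n → ℝ} (he : ∀ j, 0 < e j)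
    (t : Matrix (Fin n) (Fin n) K) : IsClopen (colBox e t) ∧ IsCompact (colBox e t) := by
  have : ProperSpace K := ProperSpace.of_locallyCompactSpace K
  have h : colBox e t = Set.pi Set.univ fun i => Set.pi Set.univ fun j =>
      Metric.closedBall (t i j) (e j) := by
    ext y
    change (∀ i j, ‖y i j - t i j‖ ≤ e j) ↔
      ∀ i ∈ Set.univ, ∀ j ∈ Set.univ, y i j ∈ Metric.closedBall (t i j) (e j)
    simp [dist_eq_norm]
  have hc : IsCompact (colBox e t) := by
    rw [h]
    exact isCompact_univ_pi fun i => isCompact_univ_pi fun j => isCompact_closedBall _ _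
  refine ⟨⟨hc.isClosed, ?_⟩, hc⟩
  rw [h]
  exact isOpen_set_pi Set.finite_univ fun i _ => isOpen_set_pi Set.finite_univ fun j _ =>
    IsUltrametricDist.isOpen_closedBall _ (he j).ne'

/-- A property of balls that holds locally and is inherited by smaller balls holds uniformly
near a compact set. -/
theorem exists_uniform_colBox [LocallyCompactSpace K] {ϖ : K} (h0 : ϖ ≠ 0) (h1 : ‖ϖ‖ < 1)
    {s : Set (Matrix (Fin n) (Fin n) K)} (hs : IsCompact s)
    {p : Set (Matrix (Fin n) (Fin n) K) → Prop} (hp : ∀ U U', U ⊆ U' → p U' → p U)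
    (h : ∀ x ∈ s, ∃ U ∈ nhds x, p U) :
    ∃ N : ℕ, ∀ M ≥ N, ∀ x ∈ s, p (colBox (fun _ => ‖ϖ‖ ^ M) x) := by
  have hϖ : 0 < ‖ϖ‖ := norm_pos_iff.2 h0
  have hmono : ∀ {N M : ℕ}, N ≤ M → ∀ x : Matrix (Fin n) (Fin n) K,
      colBox (fun _ => ‖ϖ‖ ^ M) x ⊆ colBox (fun _ => ‖ϖ‖ ^ N) x := fun hNM x y hy i j =>
    (hy i j).trans (pow_le_pow_of_le_one hϖ.le h1.le hNM)
  refine hs.induction_on (p := fun s => ∃ N : ℕ, ∀ M ≥ N, ∀ x ∈ s,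
    p (colBox (fun _ => ‖ϖ‖ ^ M) x)) ⟨0, by simp⟩ ?_ ?_ ?_
  · rintro s t hst ⟨N, hN⟩
    exact ⟨N, fun M hM x hx => hN M hM x (hst hx)⟩
  · rintro s t ⟨N, hN⟩ ⟨N', hN'⟩
    refine ⟨max N N', fun M hM x hx => ?_⟩
    rcases hx with hx | hx
    · exact hN M (le_of_max_le_left hM) x hx
    · exact hN' M (le_of_max_le_right hM) x hx
  · intro x hx
    obtain ⟨U, hU, hpU⟩ := h x hx
    obtain ⟨N, hN⟩ := exists_colBox_subset h1 hU
    refine ⟨_, mem_nhdsWithin_of_mem_nhds ((isClopen_isCompact_colBox (e := fun _ => ‖ϖ‖ ^ N)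
      (fun _ => pow_pos hϖ N) x).1.isOpen.mem_nhds fun i j => ?_), N, fun M hM y hy => ?_⟩
    · simp
    · refine hp _ U (fun z hz => hN fun i j => ?_) hpU
      exact norm_sub_le_trans (hmono hM y hz i j) (hy i j)

theorem SchwartzBZ.exists_level [LocallyCompactSpace K] {ϖ : K} (h0 : ϖ ≠ 0) (h1 : ‖ϖ‖ < 1)
    (φ : SchwartzBZ (Matrix (Fin n) (Fin n) K)) :
    ∃ N : ℕ, ∀ M ≥ N, ∀ x y, y ∈ colBox (fun _ => ‖ϖ‖ ^ M) x →
      (φ : Matrix (Fin n) (Fin n) K → ℂ) y = (φ : Matrix (Fin n) (Fin n) K → ℂ) x := by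
  obtain ⟨N, hN⟩ := exists_uniform_colBox h0 h1 (isCompact_support φ)
    (p := fun U => ∀ y ∈ U, ∀ z ∈ U, (φ : Matrix (Fin n) (Fin n) K → ℂ) y =
      (φ : Matrix (Fin n) (Fin n) K → ℂ) z)
    (fun U U' h hU y hy z hz => hU y (h hy) z (h hz)) fun x _ =>
      ⟨_, eventually_eq φ x, fun y hy z hz => Eq.trans hy (Eq.symm hz)⟩
  have hself : ∀ M (x : Matrix (Fin n) (Fin n) K), x ∈ colBox (fun _ => ‖ϖ‖ ^ M) x := by
    intro M x i j
    simp
  refine ⟨N, fun M hM x y hy => ?_⟩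
  by_cases hx : (φ : Matrix (Fin n) (Fin n) K → ℂ) x = 0
  · by_cases hy' : (φ : Matrix (Fin n) (Fin n) K → ℂ) y = 0
    · rw [hx, hy']
    · refine hN M hM y hy' y (hself M y) x fun i j => ?_
      rw [norm_sub_rev]
      exact hy i j
  · exact hN M hM x hx y hy x (hself M x)

theorem norm_mul_apply_le {A B : Matrix (Fin n) (Fin n) K} {c : ℝ} {i j : Fin n}
    (hc : 0 ≤ c) (h : ∀ k, ‖A i k‖ * ‖B k j‖ ≤ c) : ‖(A * B) i j‖ ≤ c := by
  rw [Matrix.mul_apply]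
  refine IsUltrametricDist.norm_sum_le_of_forall_le_of_nonneg hc fun k _ => ?_
  rw [norm_mul]
  exact h k

theorem norm_integral_mul_apply_le {A B : Matrix (Fin n) (Fin n) K} (hA : IsIntegralMatrix A)
    {c : ℝ} {i j : Fin n} (hB : ∀ k, ‖B k j‖ ≤ c) : ‖(A * B) i j‖ ≤ c :=
  norm_mul_apply_le ((norm_nonneg _).trans (hB i)) fun k =>
    (mul_le_of_le_one_left (norm_nonneg _) (hA i k)).trans (hB k)

theorem norm_mul_integral_apply_le {A B : Matrix (Fin n) (Fin n) K} (hB : IsIntegralMatrix B)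
    {c : ℝ} {i j : Fin n} (hA : ∀ k, ‖A i k‖ ≤ c) : ‖(A * B) i j‖ ≤ c :=
  norm_mul_apply_le ((norm_nonneg _).trans (hA i)) fun k =>
    (mul_le_of_le_one_right (norm_nonneg _) (hB k j)).trans (hA k)

theorem IsIntegralMatrix.mul {A B : Matrix (Fin n) (Fin n) K} (hA : IsIntegralMatrix A)
    (hB : IsIntegralMatrix B) : IsIntegralMatrix (A * B) := fun _ j =>
  norm_integral_mul_apply_le hA fun k => hB k j

theorem norm_prod_sub_prod_le {ι : Type*} (s : Finset ι) {a b : ι → K} {ε : ℝ} (hε : 0 ≤ ε)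
    (ha : ∀ i, ‖a i‖ ≤ 1) (hb : ∀ i, ‖b i‖ ≤ 1) (hab : ∀ i, ‖a i - b i‖ ≤ ε) :
    ‖∏ i ∈ s, a i - ∏ i ∈ s, b i‖ ≤ ε := by
  classical
  induction s using Finset.induction_on with
  | empty => simpa using hε
  | insert i s hi ih =>
    rw [Finset.prod_insert hi, Finset.prod_insert hi]
    have hp : ‖∏ i ∈ s, b i‖ ≤ 1 := by
      rw [norm_prod]
      exact Finset.prod_le_one (fun _ _ => norm_nonneg _) fun i _ => hb i
    have : a i * ∏ i ∈ s, a i - b i * ∏ i ∈ s, b i =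
        a i * (∏ i ∈ s, a i - ∏ i ∈ s, b i) + (a i - b i) * ∏ i ∈ s, b i := by ring
    rw [this]
    refine norm_add_le_of_le_ultra ?_ ?_
    · rw [norm_mul]
      exact (mul_le_of_le_one_left (norm_nonneg _) (ha i)).trans ih
    · rw [norm_mul]
      exact (mul_le_of_le_one_right (norm_nonneg _) hp).trans (hab i)

theorem norm_det_sub_det_le {A B : Matrix (Fin n) (Fin n) K} {ε : ℝ} (hε : 0 ≤ ε)
    (hA : IsIntegralMatrix A) (hB : IsIntegralMatrix B) (hAB : ∀ i j, ‖A i j - B i j‖ ≤ ε) :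
    ‖A.det - B.det‖ ≤ ε := by
  rw [Matrix.det_apply', Matrix.det_apply', ← Finset.sum_sub_distrib]
  refine IsUltrametricDist.norm_sum_le_of_forall_le_of_nonneg hε fun σ _ => ?_
  rw [← mul_sub, norm_mul]
  have hsign : ‖((Equiv.Perm.sign σ : ℤ) : K)‖ = 1 := by
    rcases Int.units_eq_one_or (Equiv.Perm.sign σ) with h | h <;> simp [h]
  rw [hsign, one_mul]
  exact norm_prod_sub_prod_le _ hε (fun i => hA _ _) (fun i => hB _ _) fun i => hAB _ _

theorem IsIntegralMatrix.norm_det_le {A : Matrix (Fin n) (Fin n) K} (hA : IsIntegralMatrix A) :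
    ‖A.det‖ ≤ 1 := by
  have h := norm_det_sub_det_le zero_le_one hA isIntegralMatrix_one fun i j =>
    norm_sub_le_of_le_ultra (hA i j) (isIntegralMatrix_one i j)
  rw [← sub_add_cancel A.det 1]
  exact norm_add_le_of_le_ultra (by simpa using h) (by simp)

theorem IsIntegralMatrix.inv {A : Matrix (Fin n) (Fin n) K} (hA : IsIntegralMatrix A)
    (hdet : ‖A.det‖ = 1) : IsIntegralMatrix A⁻¹ := by
  intro i j
  rw [Matrix.inv_def, Matrix.smul_apply, Ring.inverse_eq_inv', smul_eq_mul, norm_mul, norm_inv, hdet,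
    inv_one, one_mul, Matrix.adjugate_apply]
  refine IsIntegralMatrix.norm_det_le fun k l => ?_
  rw [Matrix.updateRow_apply]
  split_ifs
  · rw [Pi.single_apply]
    split_ifs <;> simp
  · exact hA k l

end Ultrametric

/-- The homeomorphism `x ↦ g₁⁻¹ x g₂` of the matrix space. -/
noncomputable def matHomeo (g₁ g₂ : GL (Fin n) K) :
    Matrix (Fin n) (Fin n) K ≃ₜ Matrix (Fin n) (Fin n) K where
  toFun x := (g₁⁻¹ : GL (Fin n) K) * x * (g₂ : Matrix (Fin n) (Fin n) K)
  invFun x := (g₁ : Matrix (Fin n) (Fin n) K) * x * (g₂⁻¹ : GL (Fin n) K)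
  left_inv x := by simp [Matrix.mul_assoc]
  right_inv x := by simp [Matrix.mul_assoc]
  continuous_toFun := by fun_prop
  continuous_invFun := by fun_prop

theorem matHomeo_apply (g₁ g₂ : GL (Fin n) K) (x : Matrix (Fin n) (Fin n) K) :
    matHomeo g₁ g₂ x = (g₁⁻¹ : GL (Fin n) K) * x * (g₂ : Matrix (Fin n) (Fin n) K) := rfl

/-- The action of `GL_n × GL_n` on Schwartz functions on the matrix space. -/
noncomputable def matAct (g₁ g₂ : GL (Fin n) K) :
    SchwartzBZ (Matrix (Fin n) (Fin n) K) →ₗ[ℂ] SchwartzBZ (Matrix (Fin n) (Fin n) K) :=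
  SchwartzBZ.pull (matHomeo g₁ g₂)

/-- Semi-invariant vector-valued distributions on the matrix space, the action on the values
being through the determinants. -/
def IsSemiInvariant {N : Type*} [AddCommGroup N] [Module ℂ N] (ρ : Kˣ →* Module.End ℂ N)
    (η : SchwartzBZ (Matrix (Fin n) (Fin n) K) →ₗ[ℂ] N) : Prop :=
  ∀ (g₁ g₂ : GL (Fin n) K) (φ : SchwartzBZ (Matrix (Fin n) (Fin n) K)),
    η (matAct g₁ g₂ φ) = ρ (Matrix.GeneralLinearGroup.det g₁ *
      (Matrix.GeneralLinearGroup.det g₂)⁻¹) (η φ)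

end Matrices

section Counting

variable {X N : Type*} [TopologicalSpace X] [AddCommGroup N] [Module ℂ N]

/-- If a compact open set is partitioned into pieces whose values lie in `P`, except for those
which have the same value as a fixed piece, then the value of that piece lies in `P` as soon as
the value of the whole set does. -/
theorem SchwartzBZ.mem_of_partition (s : Setoid X)
    (hs : ∀ x, IsClopen {y | s y x} ∧ IsCompact {y | s y x}) {W : Set X}
    (hW : IsClopen W ∧ IsCompact W) (hinv : ∀ x y, s y x → x ∈ W → y ∈ W)
    (η : SchwartzBZ X →ₗ[ℂ] N) (P : Submodule ℂ N) {x₀ : X} (hx₀ : x₀ ∈ W)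
    (h : ∀ t ∈ W, η (ind {y | s y t}) = η (ind {y | s y x₀}) ∨ η (ind {y | s y t}) ∈ P)
    (hP : η (ind W) ∈ P) : η (ind {y | s y x₀}) ∈ P := by
  classical
  by_contra hc
  obtain ⟨T, hT0, hT, hsum⟩ := exists_finset_eq_sum_ind s hs (ind W) fun x y hxy => by
    by_cases hx : x ∈ W
    · rw [ind_of_mem hW hx, ind_of_mem hW (hinv x y hxy hx)]
    · rw [ind_of_notMem hW hx, ind_of_notMem hW fun hy => hx (hinv y x (s.symm hxy) hy)]
  have hTW : ∀ t ∈ T, t ∈ W := fun t ht => mem_of_ind_ne_zero hW (hT0 t ht)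
  obtain ⟨t₀, ht₀, hxt⟩ := hT x₀ (by rw [ind_of_mem hW hx₀]; exact one_ne_zero)
  have heq : {y | s y t₀} = {y | s y x₀} := by
    ext y
    exact ⟨fun hy => s.trans hy (s.symm hxt), fun hy => s.trans hy hxt⟩
  rw [hsum, map_sum] at hP
  let T' := T.filter fun t => η (ind {y | s y t}) = η (ind {y | s y x₀})
  have h1 : ∑ t ∈ T', η ((ind W : X → ℂ) t • ind {y | s y t}) =
      (T'.card : ℂ) • η (ind {y | s y x₀}) := by
    rw [Finset.sum_congr rfl (g := fun _ => η (ind {y | s y x₀})), Finset.sum_const,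
      Nat.cast_smul_eq_nsmul]
    intro t ht
    rw [ind_of_mem hW (hTW t (Finset.mem_filter.1 ht).1), one_smul, (Finset.mem_filter.1 ht).2]
  rw [← Finset.sum_filter_add_sum_filter_not T
    fun t => η (ind {y | s y t}) = η (ind {y | s y x₀}), h1] at hP
  have h2 := (Submodule.add_mem_iff_left P (Submodule.sum_mem P fun t ht => ?_)).1 hP
  · have hcard : (T'.card : ℂ) ≠ 0 := by
      rw [Nat.cast_ne_zero]
      exact Finset.card_ne_zero.2 ⟨t₀, Finset.mem_filter.2 ⟨ht₀, by rw [heq]⟩⟩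
    exact hc ((Submodule.smul_mem_iff P hcard).1 h2)
  · obtain ⟨htT, htne⟩ := Finset.mem_filter.1 ht
    rw [map_smul]
    exact P.smul_mem _ ((h t (hTW t htT)).resolve_left htne)

end Counting

section MatrixLemmas

variable {K : Type*} [NontriviallyNormedField K] {n : ℕ}

/-- The matrix with diagonal entries `1` in the first `r` places, and `0` elsewhere. -/
def rankMatrix (K : Type*) [NontriviallyNormedField K] (n r : ℕ) : Matrix (Fin n) (Fin n) K :=
  Matrix.diagonal fun i => if i.1 < r then 1 else 0

/-- The radii `ε` in the first `r` columns, and `1` in the others. -/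
noncomputable def stepRadius (n : ℕ) (ε : ℝ) (r : ℕ) : Fin n → ℝ := fun j => if j.1 < r then ε else 1

theorem stepRadius_pos {ε : ℝ} (hε : 0 < ε) (r : ℕ) (j : Fin n) : 0 < stepRadius n ε r j := by
  unfold stepRadius
  split_ifs
  exacts [hε, one_pos]

/-- The integral matrices whose first `r` columns are within `ε` of the first columns of the
identity matrix. -/
def stepBox (K : Type*) [NontriviallyNormedField K] (n : ℕ) (ε : ℝ) (r : ℕ) :
    Set (Matrix (Fin n) (Fin n) K) :=
  colBox (stepRadius n ε r) (rankMatrix K n r)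

theorem rankMatrix_apply_of_lt {r : ℕ} (i : Fin n) {j : Fin n} (hj : j.1 < r) :
    rankMatrix K n r i j = (1 : Matrix (Fin n) (Fin n) K) i j := by
  rw [rankMatrix, Matrix.diagonal_apply, Matrix.one_apply]
  split_ifs with h h' <;> simp_all

theorem rankMatrix_apply_of_le {r : ℕ} (i : Fin n) {j : Fin n} (hj : r ≤ j.1) :
    rankMatrix K n r i j = 0 := by
  rw [rankMatrix, Matrix.diagonal_apply]
  split_ifs with h h'
  · subst h; omega
  · rfl
  · rfl

theorem mem_stepBox {ε : ℝ} {r : ℕ} {y : Matrix (Fin n) (Fin n) K} :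
    y ∈ stepBox K n ε r ↔ (∀ i j, j.1 < r → ‖y i j - (1 : Matrix (Fin n) (Fin n) K) i j‖ ≤ ε) ∧
      ∀ i j, r ≤ j.1 → ‖y i j‖ ≤ 1 := by
  constructor
  · intro h
    refine ⟨fun i j hj => ?_, fun i j hj => ?_⟩
    · have := h i j
      rwa [stepRadius, if_pos hj, rankMatrix_apply_of_lt i hj] at this
    · have := h i j
      rwa [stepRadius, if_neg (not_lt.2 hj), rankMatrix_apply_of_le i hj, sub_zero] at this
  · rintro ⟨h₁, h₂⟩ i j
    rcases lt_or_ge j.1 r with hj | hj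
    · rw [stepRadius, if_pos hj, rankMatrix_apply_of_lt i hj]
      exact h₁ i j hj
    · rw [stepRadius, if_neg (not_lt.2 hj), rankMatrix_apply_of_le i hj, sub_zero]
      exact h₂ i j hj

theorem rankMatrix_mem_stepBox {ε : ℝ} (hε : 0 < ε) (r : ℕ) :
    rankMatrix K n r ∈ stepBox K n ε r := fun i j => by
  simpa using (stepRadius_pos hε r j).le

theorem exists_matrix_of_column (r i : Fin n) (hri : r ≤ i) (v : Fin n → K) :
    ∃ G : Matrix (Fin n) (Fin n) K, (∀ a k, k < r → G a k = (1 : Matrix (Fin n) (Fin n) K) a k) ∧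
      (∀ a, G a r = v a) ∧ ‖G.det‖ = ‖v i‖ ∧
      ((∀ a, ‖v a‖ ≤ 1) → IsIntegralMatrix G) := by
  refine ⟨((1 : Matrix (Fin n) (Fin n) K).submatrix id (Equiv.swap r i)).updateCol r v, ?_, ?_, ?_, ?_⟩
  · intro a k hk
    rw [Matrix.updateCol_ne hk.ne, Matrix.submatrix_apply, id,
      Equiv.swap_apply_of_ne_of_ne hk.ne (hk.trans_le hri).ne]
  · intro a
    rw [Matrix.updateCol_self]
  · have h := Matrix.det_permute (Equiv.swap r i)
      (((1 : Matrix (Fin n) (Fin n) K).submatrix id (Equiv.swap r i)).updateCol r v)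
    have h2 : ((((1 : Matrix (Fin n) (Fin n) K).submatrix id (Equiv.swap r i)).updateCol r v).submatrix
        (Equiv.swap r i) id) = (1 : Matrix (Fin n) (Fin n) K).updateCol r (v ∘ Equiv.swap r i) := by
      ext a b
      rw [Matrix.submatrix_apply, Matrix.updateCol_apply, Matrix.updateCol_apply]
      simp only [id]
      split_ifs
      · rfl
      · simp [Matrix.one_apply]
    rw [h2, ← Matrix.cramer_apply, Matrix.cramer_one] at h
    have hsign : ‖((Equiv.Perm.sign (Equiv.swap r i) : ℤ) : K)‖ = 1 := by
      rcases Int.units_eq_one_or (Equiv.Perm.sign (Equiv.swap r i)) with h | h <;> simp [h]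
    have h3 := congrArg norm h
    rw [norm_mul, hsign, one_mul] at h3
    rw [← h3]
    simp
  · intro hv a b
    rw [Matrix.updateCol_apply]
    split_ifs
    · exact hv a
    · exact isIntegralMatrix_one _ _

theorem inv_mul_apply_of_column_eq {A y : Matrix (Fin n) (Fin n) K} (hA : A.det ≠ 0) {j : Fin n}
    (h : ∀ i, y i j = A i j) (i : Fin n) : (A⁻¹ * y) i j = (1 : Matrix (Fin n) (Fin n) K) i j := by
  rw [← Matrix.nonsing_inv_mul A hA.isUnit, Matrix.mul_apply, Matrix.mul_apply]
  simp_rw [h]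

/-- The first `r` columns are those of the identity matrix. -/
def IsColReduced (r : ℕ) (z : Matrix (Fin n) (Fin n) K) : Prop :=
  ∀ i j, j.1 < r → z i j = (1 : Matrix (Fin n) (Fin n) K) i j

theorem IsColReduced.exists_pivot {r : ℕ} {z : Matrix (Fin n) (Fin n) K} (hz : IsColReduced r z)
    {i j : Fin n} (hi : r ≤ i.1) (hj : r ≤ j.1) (hij : z i j ≠ 0) :
    ∃ A B : Matrix (Fin n) (Fin n) K, A.det ≠ 0 ∧ B.det ≠ 0 ∧ IsColReduced (r + 1) (A * z * B) := by
  let r' : Fin n := ⟨r, hi.trans_lt i.2⟩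
  obtain ⟨G, hG1, hG2, hG3, -⟩ := exists_matrix_of_column r' i hi fun a => z a j
  have hG : G.det ≠ 0 := by
    rw [← norm_ne_zero_iff, hG3, norm_ne_zero_iff]
    exact hij
  refine ⟨G⁻¹, (1 : Matrix (Fin n) (Fin n) K).submatrix id (Equiv.swap r' j), ?_, ?_, ?_⟩
  · rw [Matrix.det_nonsing_inv, Ring.inverse_eq_inv']
    exact inv_ne_zero hG
  · rw [Matrix.det_permute', Matrix.det_one, mul_one]
    rcases Int.units_eq_one_or (Equiv.Perm.sign (Equiv.swap r' j)) with h | h <;> simp [h]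
  · intro a k hk
    rw [Matrix.mul_assoc]
    refine inv_mul_apply_of_column_eq hG (fun b => ?_) a
    have hswap : (z * (1 : Matrix (Fin n) (Fin n) K).submatrix id (Equiv.swap r' j)) b k =
        z b (Equiv.swap r' j k) := by
      simp [Matrix.mul_apply, Matrix.one_apply]
    rw [hswap]
    rcases (Nat.lt_succ_iff.1 hk).lt_or_eq with hk | hk
    · have h1 : k ≠ r' := fun h => by rw [h] at hk; exact lt_irrefl r hk
      have h2 : k ≠ j := fun h => by rw [h] at hk; omega
      rw [Equiv.swap_apply_of_ne_of_ne h1 h2, hz b k hk, hG1 b k hk]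
    · obtain rfl : k = r' := Fin.ext hk
      rw [Equiv.swap_apply_left, hG2]

theorem IsColReduced.exists_eq_rankMatrix_mul {r : ℕ} {z : Matrix (Fin n) (Fin n) K}
    (hz : IsColReduced r z)
    (h0 : ∀ i j : Fin n, r ≤ i.1 → r ≤ j.1 → z i j = 0) :
    ∃ B : Matrix (Fin n) (Fin n) K, (IsIntegralMatrix z → IsIntegralMatrix B) ∧ B.det = 1 ∧
      z = rankMatrix K n r * B := by
  let B : Matrix (Fin n) (Fin n) K := Matrix.of fun i j =>
    if i.1 < r then z i j else (1 : Matrix (Fin n) (Fin n) K) i j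
  have hB : ∀ i j, B i j = if i.1 < r then z i j else (1 : Matrix (Fin n) (Fin n) K) i j :=
    fun _ _ => rfl
  refine ⟨B, fun hzi i j => ?_, ?_, ?_⟩
  · rw [hB]
    split_ifs
    exacts [hzi i j, isIntegralMatrix_one i j]
  · rw [Matrix.det_of_isUpperTriangular]
    · refine Finset.prod_eq_one fun i _ => ?_
      rw [hB]
      split_ifs with hi
      · rw [hz i i hi, Matrix.one_apply_eq]
      · rw [Matrix.one_apply_eq]
    · intro i j hij
      have hij : j < i := hij
      rw [hB]
      split_ifs with hi
      · rw [hz i j (lt_trans hij hi), Matrix.one_apply_ne hij.ne']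
      · rw [Matrix.one_apply_ne hij.ne']
  · ext i j
    rw [rankMatrix, Matrix.diagonal_mul, hB]
    split_ifs with hi
    · rw [one_mul]
    · rw [zero_mul]
      rcases lt_or_ge j.1 r with hj | hj
      · rw [hz i j hj, Matrix.one_apply_ne]
        rintro rfl
        exact hi hj
      · exact h0 i j (not_lt.1 hi) hj

variable [IsUltrametricDist K]

theorem isIntegralMatrix_of_mem_stepBox {ε : ℝ} (hε : ε ≤ 1) {r : ℕ}
    {y : Matrix (Fin n) (Fin n) K} (hy : y ∈ stepBox K n ε r) : IsIntegralMatrix y := by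
  obtain ⟨h₁, h₂⟩ := mem_stepBox.1 hy
  intro i j
  rcases lt_or_ge j.1 r with hj | hj
  · rw [← sub_add_cancel (y i j) ((1 : Matrix (Fin n) (Fin n) K) i j)]
    exact norm_add_le_of_le_ultra ((h₁ i j hj).trans hε) (isIntegralMatrix_one i j)
  · exact h₂ i j hj

/-- A matrix close to the identity in the first `r` columns can be reduced by a matrix close to
the identity. -/
theorem exists_eq_mul_isColReduced {ε : ℝ} (hε0 : 0 ≤ ε) (hε : ε < 1) {r : ℕ}
    {y : Matrix (Fin n) (Fin n) K} (hy : y ∈ stepBox K n ε r) :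
    ∃ A z : Matrix (Fin n) (Fin n) K, IsIntegralMatrix A ∧ ‖A.det - 1‖ ≤ ε ∧ y = A * z ∧
      IsColReduced r z ∧ IsIntegralMatrix z := by
  have hyi := isIntegralMatrix_of_mem_stepBox hε.le hy
  let A : Matrix (Fin n) (Fin n) K := Matrix.of fun i j =>
    if j.1 < r then y i j else (1 : Matrix (Fin n) (Fin n) K) i j
  have hA : ∀ i j, A i j = if j.1 < r then y i j else (1 : Matrix (Fin n) (Fin n) K) i j :=
    fun _ _ => rfl
  have hAi : IsIntegralMatrix A := fun i j => by
    rw [hA]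
    split_ifs
    exacts [hyi i j, isIntegralMatrix_one i j]
  have hdet : ‖A.det - 1‖ ≤ ε := by
    rw [← Matrix.det_one (n := Fin n) (R := K)]
    refine norm_det_sub_det_le hε0 hAi isIntegralMatrix_one fun i j => ?_
    rw [hA]
    split_ifs with hj
    · exact (mem_stepBox.1 hy).1 i j hj
    · simpa using hε0
  have hdet1 : ‖A.det‖ = 1 := norm_eq_one_of_norm_sub_lt (hdet.trans_lt hε)
  have hdet0 : A.det ≠ 0 := norm_ne_zero_iff.1 (by rw [hdet1]; exact one_ne_zero)
  refine ⟨A, A⁻¹ * y, hAi, hdet, ?_, fun i j hj => ?_, (hAi.inv hdet1).mul hyi⟩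
  · rw [← Matrix.mul_assoc, Matrix.mul_nonsing_inv A hdet0.isUnit, Matrix.one_mul]
  · exact inv_mul_apply_of_column_eq hdet0 (fun i => by rw [hA, if_pos hj]) i

theorem colBox_eq_of_mem {e : Fin n → ℝ} {x y : Matrix (Fin n) (Fin n) K} (h : y ∈ colBox e x) :
    colBox e y = colBox e x := by
  ext z
  refine ⟨fun hz i j => norm_sub_le_trans (hz i j) (h i j), fun hz i j =>
    norm_sub_le_trans (hz i j) ?_⟩
  rw [norm_sub_rev]
  exact h i j

theorem mem_stepBox_of_mem_colBox {ε : ℝ} {r : ℕ} {e : Fin n → ℝ}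
    (he : ∀ j, e j ≤ stepRadius n ε r j) {x y : Matrix (Fin n) (Fin n) K} (hy : y ∈ colBox e x)
    (hx : x ∈ stepBox K n ε r) : y ∈ stepBox K n ε r := fun i j =>
  norm_sub_le_trans ((hy i j).trans (he j)) (hx i j)

theorem mem_colBox_iff_mul_left {A : Matrix (Fin n) (Fin n) K} (hA : IsIntegralMatrix A)
    (hdet : ‖A.det‖ = 1) {e : Fin n → ℝ} {s x : Matrix (Fin n) (Fin n) K} :
    x ∈ colBox e s ↔ A * x ∈ colBox e (A * s) := by
  have hdet0 : A.det ≠ 0 := norm_ne_zero_iff.1 (by rw [hdet]; exact one_ne_zero)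
  constructor
  · intro h i j
    rw [← Matrix.sub_apply, ← Matrix.mul_sub]
    exact norm_integral_mul_apply_le hA fun k => h k j
  · intro h i j
    have : x i j - s i j = (A⁻¹ * (A * x - A * s)) i j := by
      rw [← Matrix.mul_sub, ← Matrix.mul_assoc, Matrix.nonsing_inv_mul A hdet0.isUnit,
        Matrix.one_mul, Matrix.sub_apply]
    rw [this]
    exact norm_integral_mul_apply_le (hA.inv hdet) fun k => h k j

theorem mem_colBox_iff_mul_right {B : Matrix (Fin n) (Fin n) K} (hB : IsIntegralMatrix B)
    (hdet : ‖B.det‖ = 1) {c : ℝ} {s x : Matrix (Fin n) (Fin n) K} :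
    x ∈ colBox (fun _ => c) s ↔ x * B ∈ colBox (fun _ => c) (s * B) := by
  have hdet0 : B.det ≠ 0 := norm_ne_zero_iff.1 (by rw [hdet]; exact one_ne_zero)
  constructor
  · intro h i j
    rw [← Matrix.sub_apply, ← Matrix.sub_mul]
    exact norm_mul_integral_apply_le hB fun k => h i k
  · intro h i j
    have : x i j - s i j = ((x * B - s * B) * B⁻¹) i j := by
      rw [← Matrix.sub_mul, Matrix.mul_assoc, Matrix.mul_nonsing_inv B hdet0.isUnit,
        Matrix.mul_one, Matrix.sub_apply]
    rw [this]
    exact norm_mul_integral_apply_le (hB.inv hdet) fun k => h i k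

end MatrixLemmas

section SemiInvariant

variable {K : Type*} [NontriviallyNormedField K] {n : ℕ} {N : Type*} [AddCommGroup N] [Module ℂ N]

theorem IsSemiInvariant.map_ind {ρ : Kˣ →* Module.End ℂ N}
    {η : SchwartzBZ (Matrix (Fin n) (Fin n) K) →ₗ[ℂ] N} (hη : IsSemiInvariant ρ η)
    {A B : Matrix (Fin n) (Fin n) K} (hA : A.det ≠ 0) (hB : B.det ≠ 0)
    {U U' : Set (Matrix (Fin n) (Fin n) K)} (hU : IsClopen U ∧ IsCompact U)
    (h : ∀ x, x ∈ U ↔ A * x * B ∈ U') :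
    η (SchwartzBZ.ind U') = ρ (Units.mk0 (A.det * B.det) (mul_ne_zero hA hB))
      (η (SchwartzBZ.ind U)) := by
  have key := hη (Matrix.GeneralLinearGroup.mkOfDetNeZero A hA)
    (Matrix.GeneralLinearGroup.mkOfDetNeZero B hB)⁻¹ (SchwartzBZ.ind U)
  rw [matAct, SchwartzBZ.pull_ind _ hU] at key
  have h1 : matHomeo (Matrix.GeneralLinearGroup.mkOfDetNeZero A hA)
      (Matrix.GeneralLinearGroup.mkOfDetNeZero B hB)⁻¹ ⁻¹' U = U' := by
    ext x
    rw [Set.mem_preimage, h, matHomeo_apply]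
    have : A * (((Matrix.GeneralLinearGroup.mkOfDetNeZero A hA)⁻¹ : GL (Fin n) K) * x *
        ((Matrix.GeneralLinearGroup.mkOfDetNeZero B hB)⁻¹ : GL (Fin n) K)) * B =
        ((Matrix.GeneralLinearGroup.mkOfDetNeZero A hA *
          (Matrix.GeneralLinearGroup.mkOfDetNeZero A hA)⁻¹ : GL (Fin n) K) :
            Matrix (Fin n) (Fin n) K) * x *
        (((Matrix.GeneralLinearGroup.mkOfDetNeZero B hB)⁻¹ *
          Matrix.GeneralLinearGroup.mkOfDetNeZero B hB : GL (Fin n) K) :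
            Matrix (Fin n) (Fin n) K) := by
      rw [Units.val_mul, Units.val_mul]
      simp only [Matrix.mul_assoc]
      rfl
    rw [this, mul_inv_cancel, inv_mul_cancel, Units.val_one, Matrix.one_mul, Matrix.mul_one]
  rw [h1] at key
  rw [key]
  congr 2
  ext
  rw [map_inv, inv_inv]
  rfl

/-- Near `x`, the distribution `η` takes values in `P`. -/
def IsLocallyIn (η : SchwartzBZ (Matrix (Fin n) (Fin n) K) →ₗ[ℂ] N) (P : Submodule ℂ N)
    (x : Matrix (Fin n) (Fin n) K) : Prop :=
  ∃ U ∈ nhds x, ∀ ψ : SchwartzBZ (Matrix (Fin n) (Fin n) K),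
    (∀ y, (ψ : Matrix (Fin n) (Fin n) K → ℂ) y ≠ 0 → y ∈ U) → η ψ ∈ P

theorem IsLocallyIn.of_mul {ρ : Kˣ →* Module.End ℂ N}
    {η : SchwartzBZ (Matrix (Fin n) (Fin n) K) →ₗ[ℂ] N} (hη : IsSemiInvariant ρ η)
    {P : Submodule ℂ N} (hP : ∀ a, ∀ v ∈ P, ρ a v ∈ P)
    {A B x : Matrix (Fin n) (Fin n) K} (hA : A.det ≠ 0) (hB : B.det ≠ 0)
    (h : IsLocallyIn η P (A * x * B)) : IsLocallyIn η P x := by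
  obtain ⟨U, hU, h⟩ := h
  let g₁ := (Matrix.GeneralLinearGroup.mkOfDetNeZero A hA)⁻¹
  let g₂ := Matrix.GeneralLinearGroup.mkOfDetNeZero B hB
  have he : ∀ y, matHomeo g₁ g₂ y = A * y * B := fun y => by
    rw [matHomeo_apply, inv_inv]
    rfl
  rw [← he] at hU
  refine ⟨matHomeo g₁ g₂ ⁻¹' U, (matHomeo g₁ g₂).continuous.continuousAt hU, fun ψ hψ => ?_⟩
  have hpull : ψ = matAct g₁ g₂ (SchwartzBZ.pull (matHomeo g₁ g₂).symm ψ) := by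
    refine Subtype.ext (funext fun y => ?_)
    rw [matAct, SchwartzBZ.pull_apply, SchwartzBZ.pull_apply, Homeomorph.symm_apply_apply]
  rw [hpull, hη]
  refine hP _ _ (h _ fun y hy => ?_)
  have := hψ _ hy
  rwa [Set.mem_preimage, Homeomorph.apply_symm_apply] at this

variable [IsUltrametricDist K] [LocallyCompactSpace K]

theorem map_mem_of_isLocallyIn {ϖ : K} (h0 : ϖ ≠ 0) (h1 : ‖ϖ‖ < 1)
    {η : SchwartzBZ (Matrix (Fin n) (Fin n) K) →ₗ[ℂ] N} {P : Submodule ℂ N}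
    {ψ : SchwartzBZ (Matrix (Fin n) (Fin n) K)}
    (h : ∀ x, (ψ : Matrix (Fin n) (Fin n) K → ℂ) x ≠ 0 → IsLocallyIn η P x) : η ψ ∈ P := by
  obtain ⟨M, hM⟩ := exists_uniform_colBox h0 h1 (SchwartzBZ.isCompact_support ψ)
    (p := fun U => ∀ ψ : SchwartzBZ (Matrix (Fin n) (Fin n) K),
      (∀ y, (ψ : Matrix (Fin n) (Fin n) K → ℂ) y ≠ 0 → y ∈ U) → η ψ ∈ P)
    (fun U U' hUU' hU ψ hψ => hU ψ fun y hy => hUU' (hψ y hy)) h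
  obtain ⟨M', hM'⟩ := SchwartzBZ.exists_level h0 h1 ψ
  have hpos : ∀ _ : Fin n, 0 < ‖ϖ‖ ^ max M M' := fun _ => pow_pos (norm_pos_iff.2 h0) _
  obtain ⟨T, hT0, -, hsum⟩ := SchwartzBZ.exists_finset_eq_sum_ind (colSetoid _ hpos)
    (isClopen_isCompact_colBox hpos) ψ (hM' _ (le_max_right _ _))
  rw [hsum, map_sum]
  refine P.sum_mem fun t ht => ?_
  rw [map_smul]
  exact P.smul_mem _ (hM _ (le_max_left _ _) t (hT0 t ht) _ fun y hy =>
    SchwartzBZ.mem_of_ind_ne_zero (isClopen_isCompact_colBox hpos t) hy)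

theorem isClopen_isCompact_stepBox {ε : ℝ} (hε : 0 < ε) (r : ℕ) :
    IsClopen (stepBox K n ε r) ∧ IsCompact (stepBox K n ε r) :=
  isClopen_isCompact_colBox (stepRadius_pos hε r) _

section Descent

variable {ρ : Kˣ →* Module.End ℂ N} {η : SchwartzBZ (Matrix (Fin n) (Fin n) K) →ₗ[ℂ] N}
  {P : Submodule ℂ N} {ϖ : K} {b : ℕ}

theorem map_ind_colBox_eq_or_mem (hη : IsSemiInvariant ρ η) (hP : ∀ a, ∀ v ∈ P, ρ a v ∈ P)
    (h0 : ϖ ≠ 0) (h1 : ‖ϖ‖ < 1) (hb : b ≠ 0)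
    (hρ : ∀ u : Kˣ, ‖(u : K) - 1‖ ≤ ‖ϖ‖ ^ b → ρ u = 1) {r : ℕ}
    (hgood : ∀ (z : Matrix (Fin n) (Fin n) K), IsColReduced r z → ∀ i j : Fin n, r ≤ i.1 →
      r ≤ j.1 → z i j ≠ 0 → IsLocallyIn η P z) {M : ℕ} (hM : b ≤ M)
    {t : Matrix (Fin n) (Fin n) K} (ht : t ∈ stepBox K n (‖ϖ‖ ^ b) r) :
    η (SchwartzBZ.ind (colBox (fun _ => ‖ϖ‖ ^ M) t)) =
      η (SchwartzBZ.ind (colBox (fun _ => ‖ϖ‖ ^ M) (rankMatrix K n r))) ∨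
    η (SchwartzBZ.ind (colBox (fun _ => ‖ϖ‖ ^ M) t)) ∈ P := by
  have hϖ : 0 < ‖ϖ‖ := norm_pos_iff.2 h0
  have hpos : ∀ _ : Fin n, 0 < ‖ϖ‖ ^ M := fun _ => pow_pos hϖ _
  by_cases hall : ∀ y ∈ colBox (fun _ => ‖ϖ‖ ^ M) t, IsLocallyIn η P y
  · exact Or.inr (map_mem_of_isLocallyIn h0 h1 fun x hx => hall x
      (SchwartzBZ.mem_of_ind_ne_zero (isClopen_isCompact_colBox hpos t) hx))
  · left
    push Not at hall
    obtain ⟨y, hy, hbad⟩ := hall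
    have hle : ∀ j, ‖ϖ‖ ^ M ≤ stepRadius n (‖ϖ‖ ^ b) r j := fun j => by
      unfold stepRadius
      split_ifs
      · exact pow_le_pow_of_le_one hϖ.le h1.le hM
      · exact pow_le_one₀ hϖ.le h1.le
    obtain ⟨A, z, hA, hdet, rfl, hz, hzi⟩ := exists_eq_mul_isColReduced (pow_nonneg hϖ.le b)
      (pow_lt_one₀ hϖ.le h1 hb) (mem_stepBox_of_mem_colBox hle hy ht)
    have hdet1 : ‖A.det‖ = 1 := norm_eq_one_of_norm_sub_lt (hdet.trans_lt (pow_lt_one₀ hϖ.le h1 hb))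
    have hdet0 : A.det ≠ 0 := norm_ne_zero_iff.1 (by rw [hdet1]; exact one_ne_zero)
    have hz0 : ∀ i j : Fin n, r ≤ i.1 → r ≤ j.1 → z i j = 0 := by
      intro i j hi hj
      by_contra hij
      refine hbad (IsLocallyIn.of_mul hη hP (A := A⁻¹) (B := 1) ?_ (by simp) ?_)
      · rw [Matrix.det_nonsing_inv, Ring.inverse_eq_inv']
        exact inv_ne_zero hdet0
      · rw [Matrix.mul_one, ← Matrix.mul_assoc, Matrix.nonsing_inv_mul A hdet0.isUnit,
          Matrix.one_mul]
        exact hgood z hz i j hi hj hij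
    obtain ⟨B, hB, hBdet, rfl⟩ := hz.exists_eq_rankMatrix_mul hz0
    rw [← colBox_eq_of_mem hy, ← Matrix.mul_assoc, hη.map_ind hdet0 (B := B) (by simp [hBdet])
      (isClopen_isCompact_colBox hpos (rankMatrix K n r))]
    · rw [hρ _ (by simpa [hBdet] using hdet)]
      rfl
    · intro x
      rw [mem_colBox_iff_mul_left hA hdet1, mem_colBox_iff_mul_right (hB hzi) (by simp [hBdet])]

theorem isLocallyIn_rankMatrix (hη : IsSemiInvariant ρ η) (hP : ∀ a, ∀ v ∈ P, ρ a v ∈ P)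
    (h0 : ϖ ≠ 0) (h1 : ‖ϖ‖ < 1) (hb : b ≠ 0)
    (hρ : ∀ u : Kˣ, ‖(u : K) - 1‖ ≤ ‖ϖ‖ ^ b → ρ u = 1) {r : ℕ}
    (hgood : ∀ (z : Matrix (Fin n) (Fin n) K), IsColReduced r z → ∀ i j : Fin n, r ≤ i.1 →
      r ≤ j.1 → z i j ≠ 0 → IsLocallyIn η P z)
    (hW : η (SchwartzBZ.ind (stepBox K n (‖ϖ‖ ^ b) r)) ∈ P) :
    IsLocallyIn η P (rankMatrix K n r) := by
  have hϖ : 0 < ‖ϖ‖ := norm_pos_iff.2 h0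
  have hWc := isClopen_isCompact_stepBox (K := K) (n := n) (pow_pos hϖ b) r
  refine ⟨stepBox K n (‖ϖ‖ ^ b) r, hWc.1.isOpen.mem_nhds (rankMatrix_mem_stepBox (pow_pos hϖ b) r),
    fun ψ hψ => ?_⟩
  obtain ⟨M, hM⟩ := SchwartzBZ.exists_level h0 h1 ψ
  have hpos : ∀ _ : Fin n, 0 < ‖ϖ‖ ^ max b M := fun _ => pow_pos hϖ _
  have hdich := fun t ht => map_ind_colBox_eq_or_mem hη hP h0 h1 hb hρ hgood (le_max_left b M)
    (t := t) ht
  have hle : ∀ j, ‖ϖ‖ ^ max b M ≤ stepRadius n (‖ϖ‖ ^ b) r j := fun j => by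
    unfold stepRadius
    split_ifs
    · exact pow_le_pow_of_le_one hϖ.le h1.le (le_max_left _ _)
    · exact pow_le_one₀ hϖ.le h1.le
  have hc := SchwartzBZ.mem_of_partition (colSetoid _ hpos) (isClopen_isCompact_colBox hpos) hWc
    (fun x y hy hx => mem_stepBox_of_mem_colBox hle hy hx) η P
    (rankMatrix_mem_stepBox (pow_pos hϖ b) r) hdich hW
  obtain ⟨T, hT0, -, hsum⟩ := SchwartzBZ.exists_finset_eq_sum_ind (colSetoid _ hpos)
    (isClopen_isCompact_colBox hpos) ψ (hM _ (le_max_right _ _))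
  rw [hsum, map_sum]
  refine P.sum_mem fun t ht => ?_
  rw [map_smul]
  refine P.smul_mem _ ?_
  rcases hdich t (hψ t (hT0 t ht)) with h | h
  · exact h.symm ▸ hc
  · exact h

/-- A semi-invariant distribution takes values in a stable subspace as soon as its values on the
step boxes do. -/
theorem map_mem_of_forall_stepBox (hη : IsSemiInvariant ρ η) (hP : ∀ a, ∀ v ∈ P, ρ a v ∈ P)
    (h0 : ϖ ≠ 0) (h1 : ‖ϖ‖ < 1) (hb : b ≠ 0)
    (hρ : ∀ u : Kˣ, ‖(u : K) - 1‖ ≤ ‖ϖ‖ ^ b → ρ u = 1)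
    (hW : ∀ r ≤ n, η (SchwartzBZ.ind (stepBox K n (‖ϖ‖ ^ b) r)) ∈ P)
    (φ : SchwartzBZ (Matrix (Fin n) (Fin n) K)) : η φ ∈ P := by
  have step : ∀ r ≤ n, (∀ (z : Matrix (Fin n) (Fin n) K), IsColReduced r z → ∀ i j : Fin n,
      r ≤ i.1 → r ≤ j.1 → z i j ≠ 0 → IsLocallyIn η P z) →
      ∀ z : Matrix (Fin n) (Fin n) K, IsColReduced r z → IsLocallyIn η P z := by
    intro r hr hgood z hz
    by_cases hz0 : ∀ i j : Fin n, r ≤ i.1 → r ≤ j.1 → z i j = 0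
    · obtain ⟨B, -, hBdet, rfl⟩ := hz.exists_eq_rankMatrix_mul hz0
      have hB : B.det ≠ 0 := by simp [hBdet]
      refine IsLocallyIn.of_mul hη hP (A := 1) (B := B⁻¹) (by simp) (by simp [hBdet]) ?_
      rw [Matrix.one_mul, Matrix.mul_assoc, Matrix.mul_nonsing_inv B hB.isUnit, Matrix.mul_one]
      exact isLocallyIn_rankMatrix hη hP h0 h1 hb hρ hgood (hW r hr)
    · push Not at hz0
      obtain ⟨i, j, hi, hj, hij⟩ := hz0
      exact hgood z hz i j hi hj hij
  have main : ∀ k r : ℕ, r + k = n → ∀ z : Matrix (Fin n) (Fin n) K, IsColReduced r z →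
      IsLocallyIn η P z := by
    intro k
    induction k with
    | zero => exact fun r hr => step r hr.le fun z _ i j hi => absurd i.2 (by omega)
    | succ k ih =>
      refine fun r hr => step r (by omega) fun z hz i j hi hj hij => ?_
      obtain ⟨A, B, hA, hB, h⟩ := hz.exists_pivot hi hj hij
      exact IsLocallyIn.of_mul hη hP hA hB (ih (r + 1) (by omega) _ h)
  exact map_mem_of_isLocallyIn h0 h1 fun x _ => main n 0 (by omega) x fun i j hj => by omega

end Descent

end SemiInvariant

section Cyclic

variable {K : Type*} [NontriviallyNormedField K] {n : ℕ} [IsUltrametricDist K]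

/-- A column box whose column `r` is small is obtained from a step box by column operations. -/
theorem mem_stepBox_iff_mul_mem_colBox {ϖ : K} (h0 : ϖ ≠ 0) (h1 : ‖ϖ‖ < 1) {r : Fin n}
    {t : Matrix (Fin n) (Fin n) K} (ht : t ∈ stepBox K n ‖ϖ‖ r)
    (hsmall : ∀ i, r ≤ i → ‖t i r‖ ≤ ‖ϖ‖) (x : Matrix (Fin n) (Fin n) K) :
    x ∈ stepBox K n ‖ϖ‖ r ↔
      1 * x * (1 : Matrix (Fin n) (Fin n) K).updateCol r
        (fun k => (if k < r then t k r else 0) + if k = r then ϖ else 0) ∈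
      colBox (stepRadius n ‖ϖ‖ (r + 1)) t := by
  rw [Matrix.one_mul]
  obtain ⟨ht1, ht2⟩ := mem_stepBox.1 ht
  set p := (1 : Matrix (Fin n) (Fin n) K).updateCol r
    (fun k => (if k < r then t k r else 0) + if k = r then ϖ else 0) with hp
  have hne : ∀ i j, j ≠ r → (x * p) i j = x i j := fun i j hj => by
    rw [Matrix.mul_apply, ← Matrix.mul_one x, Matrix.mul_apply, Matrix.mul_one]
    simp [hp, Matrix.updateCol_ne hj]
  have hr : ∀ i, (x * p) i r - t i r = x i r * ϖ +
      ((∑ k, (x i k - (1 : Matrix (Fin n) (Fin n) K) i k) * if k < r then t k r else 0) +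
        ((if i < r then t i r else 0) - t i r)) := fun i => by
    have hone : ∀ f : Fin n → K, ∑ k, (1 : Matrix (Fin n) (Fin n) K) i k * f k = f i := fun f => by
      simp [Matrix.one_apply]
    have hsingle : ∑ k, (x i k * if k = r then ϖ else 0) = x i r * ϖ := by simp
    simp only [Matrix.mul_apply, hone, hp, Matrix.updateCol_self, mul_add, Finset.sum_add_distrib, sub_mul,
      Finset.sum_sub_distrib, hsingle]
    ring
  have hrest : (∀ i j, j < r → ‖x i j - (1 : Matrix (Fin n) (Fin n) K) i j‖ ≤ ‖ϖ‖) →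
      ∀ i, ‖(∑ k, (x i k - (1 : Matrix (Fin n) (Fin n) K) i k) * if k < r then t k r else 0) +
        ((if i < r then t i r else 0) - t i r)‖ ≤ ‖ϖ‖ := by
    intro hx i
    refine norm_add_le_of_le_ultra ?_ ?_
    · refine IsUltrametricDist.norm_sum_le_of_forall_le_of_nonneg (norm_nonneg _) fun k _ => ?_
      split_ifs with hk
      · rw [norm_mul]
        exact (mul_le_of_le_one_right (norm_nonneg _) (ht2 k r le_rfl)).trans (hx i k hk)
      · simp
    · split_ifs with hi
      · simp
      · simpa using hsmall i (not_lt.1 hi)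
  have hcol : ∀ i, ‖x i r * ϖ‖ ≤ ‖ϖ‖ ↔ ‖x i r‖ ≤ 1 := fun i => by
    rw [norm_mul]
    exact mul_le_iff_le_one_left (norm_pos_iff.2 h0)
  have hti : IsIntegralMatrix t := isIntegralMatrix_of_mem_stepBox h1.le ht
  rw [mem_stepBox]
  constructor
  · rintro ⟨hx1, hx2⟩ i j
    unfold stepRadius
    rcases lt_trichotomy j r with hj | rfl | hj
    · rw [if_pos (by have : j.1 < r.1 := hj; omega), hne i j hj.ne]
      refine norm_sub_le_trans (hx1 i j hj) ?_
      rw [norm_sub_rev]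
      exact ht1 i j hj
    · rw [if_pos (Nat.lt_succ_self _), hr]
      exact norm_add_le_of_le_ultra ((hcol i).2 (hx2 i j le_rfl)) (hrest (fun i j hj => hx1 i j hj) i)
    · rw [if_neg (by have : r.1 < j.1 := hj; omega), hne i j hj.ne']
      exact norm_sub_le_of_le_ultra (hx2 i j (le_of_lt hj)) (hti i j)
  · intro h
    have hx1 : ∀ i j, j < r → ‖x i j - (1 : Matrix (Fin n) (Fin n) K) i j‖ ≤ ‖ϖ‖ := by
      intro i j hj
      have := h i j
      rw [hne i j hj.ne, stepRadius, if_pos (by have : j.1 < r.1 := hj; omega)] at this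
      exact norm_sub_le_trans this (ht1 i j hj)
    refine ⟨fun i j hj => hx1 i j hj, fun i j hj => ?_⟩
    rcases (show r ≤ j from hj).eq_or_lt with rfl | hj
    · have := h i r
      rw [hr, stepRadius, if_pos (Nat.lt_succ_self _)] at this
      rw [← hcol, ← add_sub_cancel_right (x i r * ϖ)]
      exact norm_sub_le_of_le_ultra this (hrest hx1 i)
    · have := h i j
      rw [hne i j hj.ne', stepRadius, if_neg (by have : r.1 < j.1 := hj; omega)] at this
      rw [← sub_add_cancel (x i j) (t i j)]
      exact norm_add_le_of_le_ultra this (hti i j)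

variable [LocallyCompactSpace K] {N : Type*} [AddCommGroup N] [Module ℂ N]
  {ρ : Kˣ →* Module.End ℂ N} {η : SchwartzBZ (Matrix (Fin n) (Fin n) K) →ₗ[ℂ] N}
  {P : Submodule ℂ N} {ϖ : K}

theorem map_ind_stepBox_succ_mem (hη : IsSemiInvariant ρ η) (hP : ∀ a, ∀ v ∈ P, ρ a v ∈ P)
    (h0 : ϖ ≠ 0) (h1 : ‖ϖ‖ < 1) (hm : ∀ x : K, ‖x‖ < 1 → ‖x‖ ≤ ‖ϖ‖)
    (hρ : ∀ u : Kˣ, ‖(u : K)‖ = 1 → ρ u = 1) (r : Fin n)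
    (hW : η (SchwartzBZ.ind (stepBox K n ‖ϖ‖ r)) ∈ P) :
    η (SchwartzBZ.ind (stepBox K n ‖ϖ‖ (r + 1))) ∈ P := by
  have hϖ : 0 < ‖ϖ‖ := norm_pos_iff.2 h0
  have hpos : ∀ j : Fin n, 0 < stepRadius n ‖ϖ‖ (r + 1) j := stepRadius_pos hϖ _
  have hle : ∀ j, stepRadius n ‖ϖ‖ (r + 1) j ≤ stepRadius n ‖ϖ‖ r j := fun j => by
    unfold stepRadius
    split_ifs
    · exact le_rfl
    · exact h1.le
    · omega
    · exact le_rfl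
  have hself : rankMatrix K n (r + 1) ∈ stepBox K n ‖ϖ‖ r := by
    refine mem_stepBox.2 ⟨fun i j hj => ?_, fun i j hj => ?_⟩
    · rw [rankMatrix_apply_of_lt i (by omega)]
      simp
    · rcases lt_or_ge j.1 (r + 1) with hj | hj
      · rw [rankMatrix_apply_of_lt i hj]
        exact isIntegralMatrix_one i j
      · rw [rankMatrix_apply_of_le i hj]
        simp
  refine SchwartzBZ.mem_of_partition (colSetoid _ hpos) (isClopen_isCompact_colBox hpos)
    (isClopen_isCompact_stepBox hϖ r) (fun x y hy hx => mem_stepBox_of_mem_colBox hle hy hx) η P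
    hself (fun t ht => ?_) hW
  change η (SchwartzBZ.ind (colBox _ t)) = η (SchwartzBZ.ind (colBox _ _)) ∨
    η (SchwartzBZ.ind (colBox _ t)) ∈ P
  obtain ⟨ht1, ht2⟩ := mem_stepBox.1 ht
  have hti : IsIntegralMatrix t := isIntegralMatrix_of_mem_stepBox h1.le ht
  by_cases hsmall : ∀ i, r ≤ i → ‖t i r‖ ≤ ‖ϖ‖
  · right
    have hdet : ((1 : Matrix (Fin n) (Fin n) K).updateCol r
        (fun k => (if k < r then t k r else 0) + if k = r then ϖ else 0)).det ≠ 0 := by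
      rw [← Matrix.cramer_apply, Matrix.cramer_one]
      simpa using h0
    rw [hη.map_ind (A := 1) (by simp) hdet (isClopen_isCompact_stepBox hϖ r)
      (mem_stepBox_iff_mul_mem_colBox h0 h1 ht hsmall)]
    exact hP _ _ hW
  · left
    push Not at hsmall
    obtain ⟨i, hi, hti'⟩ := hsmall
    have hone : ‖t i r‖ = 1 := le_antisymm (hti i r) (not_lt.1 fun h => hti'.not_ge (hm _ h))
    obtain ⟨G, hG1, hG2, hG3, hG4⟩ := exists_matrix_of_column r i hi fun a => t a r
    rw [hone] at hG3
    have hGi := hG4 fun a => hti a r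
    have hG0 : G.det ≠ 0 := norm_ne_zero_iff.1 (by rw [hG3]; exact one_ne_zero)
    have hmem : G * rankMatrix K n (r + 1) ∈ colBox (stepRadius n ‖ϖ‖ (r + 1)) t := by
      intro a j
      rw [rankMatrix, Matrix.mul_diagonal]
      unfold stepRadius
      split_ifs with hj
      · rw [mul_one]
        rcases (show j.1 ≤ r.1 by omega).lt_or_eq with hj | hj
        · rw [hG1 a j hj, norm_sub_rev]
          exact ht1 a j hj
        · rw [Fin.ext hj, hG2, sub_self, norm_zero]
          exact hϖ.le
      · rw [mul_zero, zero_sub, norm_neg]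
        exact hti a j
    rw [← colBox_eq_of_mem hmem, hη.map_ind hG0 (B := 1) (by simp)
      (isClopen_isCompact_colBox hpos (rankMatrix K n (r + 1))), hρ _ (by simpa using hG3)]
    · rfl
    · intro x
      rw [Matrix.mul_one]
      exact mem_colBox_iff_mul_left hGi hG3

theorem map_ind_stepBox_eq_smul (hη : IsSemiInvariant ρ η) {ε : ℝ} (hε : 0 < ε) (r : Fin n)
    {u : Kˣ} (hu : ‖(u : K)‖ = 1) :
    η (SchwartzBZ.ind (stepBox K n ε r)) = ρ u (η (SchwartzBZ.ind (stepBox K n ε r))) := by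
  have hdet : (Matrix.diagonal (Function.update (fun _ : Fin n => (1 : K)) r u)).det = u := by
    rw [Matrix.det_diagonal, Finset.prod_update_of_mem (Finset.mem_univ r)]
    simp
  have hdet0 : (Matrix.diagonal (Function.update (fun _ : Fin n => (1 : K)) r u)).det ≠ 0 := by
    rw [hdet]
    exact u.ne_zero
  have := hη.map_ind (A := 1) (by simp) hdet0 (isClopen_isCompact_stepBox hε r)
    (U' := stepBox K n ε r) fun x => ?_
  · refine this.trans (congrArg (fun a => ρ a _) (Units.ext ?_))
    rw [Units.val_mk0, hdet, Matrix.det_one, one_mul]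
  · rw [Matrix.one_mul, mem_stepBox, mem_stepBox]
    refine and_congr ?_ ?_
    · refine forall_congr' fun i => forall_congr' fun j => imp_congr_right fun hj => ?_
      rw [Matrix.mul_diagonal, Function.update_of_ne (fun h => by subst h; exact lt_irrefl _ hj),
        mul_one]
    · refine forall_congr' fun i => forall_congr' fun j => imp_congr_right fun hj => ?_
      rw [Matrix.mul_diagonal, norm_mul]
      by_cases h : j = r
      · subst h
        rw [Function.update_self, hu, mul_one]
      · rw [Function.update_of_ne h, norm_one, mul_one]

omit [IsUltrametricDist K] [LocallyCompactSpace K] in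
theorem exists_pow_forall_eq_one (h1 : ‖ϖ‖ < 1) {χ : Kˣ →* ℂˣ}
    (hχ : IsLocallyConstant fun a : Kˣ => (χ a : ℂ)) :
    ∃ b : ℕ, b ≠ 0 ∧ ∀ u : Kˣ, ‖(u : K) - 1‖ ≤ ‖ϖ‖ ^ b → χ u = 1 := by
  have h := (IsLocallyConstant.iff_eventually_eq _).1 hχ 1
  rw [Units.isEmbedding_val₀.nhds_eq_comap, Filter.eventually_comap] at h
  obtain ⟨ε, hε, h⟩ := Metric.eventually_nhds_iff.1 h
  obtain ⟨b, hb⟩ := exists_pow_lt_of_lt_one hε h1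
  refine ⟨b + 1, b.succ_ne_zero, fun u hu => ?_⟩
  have hlt : ‖(u : K) - 1‖ < ε :=
    (hu.trans (pow_le_pow_of_le_one (norm_nonneg _) h1.le b.le_succ)).trans_lt hb
  have := h (y := (u : K)) (by rwa [dist_eq_norm]) u rfl
  rw [map_one] at this
  exact Units.ext this

/-- There is a step box whose indicator generates the semi-invariant quotients of the Schwartz
space, for all actions that restrict to `χ` on the integral units. -/
theorem exists_generating_stepBox (n : ℕ) (h0 : ϖ ≠ 0) (h1 : ‖ϖ‖ < 1)
    (hm : ∀ x : K, ‖x‖ < 1 → ‖x‖ ≤ ‖ϖ‖) {χ : Kˣ →* ℂˣ}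
    (hχ : IsLocallyConstant fun a : Kˣ => (χ a : ℂ)) :
    ∃ (ε : ℝ) (r : ℕ), 0 < ε ∧ ε < 1 ∧
      (∀ x ∈ stepBox K n ε r, ∀ u : Kˣ, (u : K) = x.det → ‖(u : K)‖ = 1 → χ u = 1) ∧
      ∀ (N : Type) [AddCommGroup N] [Module ℂ N] (ρ : Kˣ →* Module.End ℂ N)
        (η : SchwartzBZ (Matrix (Fin n) (Fin n) K) →ₗ[ℂ] N) (P : Submodule ℂ N),
        (∀ u : Kˣ, ‖(u : K)‖ = 1 → ∀ v, ρ u v = (χ u : ℂ) • v) → IsSemiInvariant ρ η →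
        (∀ a, ∀ v ∈ P, ρ a v ∈ P) → η (SchwartzBZ.ind (stepBox K n ε r)) ∈ P → ∀ φ, η φ ∈ P := by
  have hϖ : 0 < ‖ϖ‖ := norm_pos_iff.2 h0
  by_cases hur : ∀ u : Kˣ, ‖(u : K)‖ = 1 → χ u = 1
  · refine ⟨‖ϖ‖, 0, hϖ, h1, fun x _ u _ hu => hur u hu, fun N _ _ ρ η P hρ hη hP hW => ?_⟩
    have hρ1 : ∀ u : Kˣ, ‖(u : K)‖ = 1 → ρ u = 1 := fun u hu => by
      ext v
      rw [hρ u hu, hur u hu]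
      simp
    have hall : ∀ r ≤ n, η (SchwartzBZ.ind (stepBox K n ‖ϖ‖ r)) ∈ P := by
      intro r
      induction r with
      | zero => exact fun _ => hW
      | succ r ih =>
        exact fun hr => map_ind_stepBox_succ_mem hη hP h0 h1 hm hρ1 ⟨r, hr⟩ (ih (by omega))
    refine map_mem_of_forall_stepBox hη hP h0 h1 one_ne_zero (fun u hu => hρ1 u ?_)
      (by simpa using hall)
    exact norm_eq_one_of_norm_sub_lt (hu.trans_lt (by simpa using h1))
  · push Not at hur
    obtain ⟨u, hu, hχu⟩ := hur
    obtain ⟨b, hb, hχb⟩ := exists_pow_forall_eq_one h1 hχ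
    have hε := pow_lt_one₀ hϖ.le h1 hb
    refine ⟨‖ϖ‖ ^ b, n, pow_pos hϖ b, hε, fun x hx v hv _ => hχb v ?_,
      fun N _ _ ρ η P hρ hη hP hW => ?_⟩
    · rw [hv, ← Matrix.det_one (n := Fin n) (R := K)]
      exact norm_det_sub_det_le (pow_nonneg hϖ.le b) (isIntegralMatrix_of_mem_stepBox hε.le hx)
        isIntegralMatrix_one fun i j => (mem_stepBox.1 hx).1 i j j.2
    · refine map_mem_of_forall_stepBox hη hP h0 h1 hb (fun v hv => ?_) (fun r hr => ?_)
      · ext w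
        rw [hρ v (norm_eq_one_of_norm_sub_lt (hv.trans_lt hε)), hχb v hv]
        simp
      · rcases hr.lt_or_eq with hr | rfl
        · have h := map_ind_stepBox_eq_smul hη (pow_pos hϖ b) ⟨r, hr⟩ hu
          rw [hρ u hu, eq_comm, ← sub_eq_zero] at h
          nth_rewrite 2 [← one_smul ℂ (η _)] at h
          rw [← sub_smul, smul_eq_zero] at h
          rw [h.resolve_left fun h => hχu (Units.ext (sub_eq_zero.1 h))]
          exact P.zero_mem
        · exact hW

end Cyclic

section Modulus

variable {K : Type*} [NontriviallyNormedField K] {n : ℕ} [IsUltrametricDist K]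
  [LocallyCompactSpace K] {I : SchwartzBZ (Matrix (Fin n) (Fin n) K) →ₗ[ℂ] ℂ}

theorem eq_zero_of_translation_invariant
    (hI : ∀ v φ, I (SchwartzBZ.pull (Homeomorph.addRight v) φ) = I φ)
    (h : I (SchwartzBZ.ind (colBox (fun _ => 1) 0)) = 0) : I = 0 := by
  obtain ⟨ϖ, h0, h1, -⟩ := exists_uniformizer (K := K)
  have hϖ : 0 < ‖ϖ‖ := norm_pos_iff.2 h0
  have hbox : ∀ M (t : Matrix (Fin n) (Fin n) K), I (SchwartzBZ.ind (colBox (fun _ => ‖ϖ‖ ^ M) t)) =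
      I (SchwartzBZ.ind (colBox (fun _ => ‖ϖ‖ ^ M) 0)) := fun M t => by
    rw [← hI (-t) (SchwartzBZ.ind (colBox (fun _ => ‖ϖ‖ ^ M) 0)),
      SchwartzBZ.pull_ind _ (isClopen_isCompact_colBox (fun _ => pow_pos hϖ M) 0)]
    congr 2
    ext x
    simp [colBox, sub_eq_add_neg]
  have hzero : ∀ M (t : Matrix (Fin n) (Fin n) K),
      I (SchwartzBZ.ind (colBox (fun _ => ‖ϖ‖ ^ M) t)) = 0 := fun M t => by
    have hpos : ∀ _ : Fin n, 0 < ‖ϖ‖ ^ M := fun _ => pow_pos hϖ M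
    rw [hbox, ← Submodule.mem_bot ℂ]
    refine SchwartzBZ.mem_of_partition (colSetoid _ hpos) (isClopen_isCompact_colBox hpos)
      (isClopen_isCompact_colBox (e := fun _ => 1) (fun _ => one_pos) 0) (fun x y hy hx i j => ?_)
      I ⊥ (x₀ := 0) (fun i j => by simp) (fun t _ => Or.inl (hbox M t)) ((Submodule.mem_bot ℂ).2 h)
    exact norm_sub_le_trans ((hy i j).trans (pow_le_one₀ hϖ.le h1.le)) (hx i j)
  ext φ
  obtain ⟨M, hM⟩ := SchwartzBZ.exists_level h0 h1 φ
  have hpos : ∀ _ : Fin n, 0 < ‖ϖ‖ ^ M := fun _ => pow_pos hϖ M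
  obtain ⟨T, -, -, hsum⟩ := SchwartzBZ.exists_finset_eq_sum_ind (colSetoid _ hpos)
    (isClopen_isCompact_colBox hpos) φ (hM M le_rfl)
  rw [hsum, map_sum]
  refine Finset.sum_eq_zero fun t _ => ?_
  rw [map_smul]
  exact (congrArg _ (hzero M t)).trans (smul_zero _)

theorem isClopen_isCompact_unitBox :
    IsClopen (colBox (fun _ => 1) (0 : Matrix (Fin n) (Fin n) K)) ∧
      IsCompact (colBox (fun _ => 1) (0 : Matrix (Fin n) (Fin n) K)) :=
  isClopen_isCompact_colBox (fun _ => one_pos) 0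

omit [IsUltrametricDist K] [LocallyCompactSpace K] in
theorem zero_mem_unitBox : (0 : Matrix (Fin n) (Fin n) K) ∈ colBox (fun _ => 1) 0 :=
  fun i j => by simp

variable (hI : ∀ v φ, I (SchwartzBZ.pull (Homeomorph.addRight v) φ) = I φ)
  (hne : ∀ U, IsClopen U → IsCompact U → U.Nonempty → I (SchwartzBZ.ind U) ≠ 0)
include hI hne

theorem exists_scaling (e : Matrix (Fin n) (Fin n) K ≃ₜ Matrix (Fin n) (Fin n) K)
    (he : ∀ x y, e (x + y) = e x + e y) :
    ∃ c : ℂˣ, ∀ φ, I (SchwartzBZ.pull e φ) = c * I φ := by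
  have hL := isClopen_isCompact_unitBox (K := K) (n := n)
  have hL0 := hne _ hL.1 hL.2 ⟨0, zero_mem_unitBox⟩
  have hL1 : I (SchwartzBZ.pull e (SchwartzBZ.ind (colBox (fun _ => 1) 0))) ≠ 0 := by
    rw [SchwartzBZ.pull_ind e hL]
    refine hne _ (hL.1.preimage e.continuous) (e.isCompact_preimage.2 hL.2) ⟨e.symm 0, ?_⟩
    rw [Set.mem_preimage, e.apply_symm_apply]
    exact zero_mem_unitBox
  refine ⟨Units.mk0 _ (div_ne_zero hL1 hL0), fun φ => ?_⟩
  have key := eq_zero_of_translation_invariant (I := I ∘ₗ SchwartzBZ.pull e -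
    (I (SchwartzBZ.pull e (SchwartzBZ.ind (colBox (fun _ => 1) 0))) /
      I (SchwartzBZ.ind (colBox (fun _ => 1) 0))) • I) (fun v ψ => ?_) ?_
  · have := LinearMap.congr_fun key φ
    simpa [sub_eq_zero] using this
  · have hpull : SchwartzBZ.pull e (SchwartzBZ.pull (Homeomorph.addRight v) ψ) =
        SchwartzBZ.pull (Homeomorph.addRight (e.symm v)) (SchwartzBZ.pull e ψ) := by
      refine Subtype.ext (funext fun x => ?_)
      simp [he]
    simp [hpull, hI]
  · simp [hL0]

theorem exists_left_modulus :
    ∃ δ : GL (Fin n) K →* ℂˣ, (∀ g φ, I (matAct g 1 φ) = δ g * I φ) ∧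
      ∀ k : GL (Fin n) K, IsIntegralMatrix (k : Matrix (Fin n) (Fin n) K) →
        ‖(k : Matrix (Fin n) (Fin n) K).det‖ = 1 → δ k = 1 := by
  have hL := isClopen_isCompact_unitBox (K := K) (n := n)
  have hL0 := hne _ hL.1 hL.2 ⟨0, zero_mem_unitBox⟩
  have hex : ∀ g : GL (Fin n) K, ∃ c : ℂˣ, ∀ φ, I (matAct g 1 φ) = c * I φ := fun g =>
    exists_scaling hI hne _ fun x y => by simp [matHomeo_apply, Matrix.mul_add]
  choose c hc using hex
  refine ⟨MonoidHom.mk' c fun g h => ?_, hc, fun k hk hdet => ?_⟩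
  · have hmul : matAct (g * h) 1 (SchwartzBZ.ind (colBox (fun _ => (1 : ℝ)) 0)) =
        matAct g 1 (matAct h 1 (SchwartzBZ.ind (colBox (fun _ => 1) 0))) := by
      refine Subtype.ext (funext fun x => ?_)
      simp [matAct, matHomeo_apply, Matrix.mul_assoc]
    have := congrArg I hmul
    rw [hc, hc, hc, ← mul_assoc] at this
    exact Units.ext (mul_right_cancel₀ hL0 this)
  · change c k = 1
    have h := hc k (SchwartzBZ.ind (colBox (fun _ => 1) 0))
    have hinv : matHomeo k 1 ⁻¹' colBox (fun _ => 1) 0 = colBox (fun _ => 1) 0 := by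
      ext x
      rw [Set.mem_preimage, matHomeo_apply, mem_colBox_iff_mul_left hk hdet, ← Matrix.mul_assoc,
        ← Matrix.mul_assoc, ← Units.val_mul, mul_inv_cancel]
      simp
    rw [matAct, SchwartzBZ.pull_ind _ hL, hinv] at h
    refine Units.ext (mul_right_cancel₀ hL0 ?_)
    rw [← h, Units.val_one, one_mul]

theorem exists_modulus [CharZero K] :
    ∃ δ : GL (Fin n) K →* ℂˣ, (∀ g₁ g₂ φ, I (matAct g₁ g₂ φ) = δ g₁ * (δ g₂)⁻¹ * I φ) ∧
      ∀ k : GL (Fin n) K, IsIntegralMatrix (k : Matrix (Fin n) (Fin n) K) →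
        ‖(k : Matrix (Fin n) (Fin n) K).det‖ = 1 → δ k = 1 := by
  obtain ⟨δ, hδ, hδ1⟩ := exists_left_modulus hI hne
  let τ : Matrix (Fin n) (Fin n) K ≃ₜ Matrix (Fin n) (Fin n) K :=
    { toFun := Matrix.transpose
      invFun := Matrix.transpose
      left_inv := Matrix.transpose_transpose
      right_inv := Matrix.transpose_transpose
      continuous_toFun := by fun_prop
      continuous_invFun := by fun_prop }
  obtain ⟨c, hc⟩ := exists_scaling hI hne τ fun x y => Matrix.transpose_add x y
  have hright : ∀ g h : GL (Fin n) K, (h : Matrix (Fin n) (Fin n) K) = (g : Matrix (Fin n) (Fin n) K)ᵀ →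
      ∀ φ, I (matAct 1 g φ) = (δ h)⁻¹ * I φ := by
    intro g h hgh φ
    have key : SchwartzBZ.pull τ (matAct 1 g φ) = matAct h⁻¹ 1 (SchwartzBZ.pull τ φ) := by
      refine Subtype.ext (funext fun x => ?_)
      have : (τ x) * (g : Matrix (Fin n) (Fin n) K) = τ ((h : Matrix (Fin n) (Fin n) K) * x) := by
        rw [hgh]
        change xᵀ * (g : Matrix (Fin n) (Fin n) K) = ((g : Matrix (Fin n) (Fin n) K)ᵀ * x)ᵀ
        rw [Matrix.transpose_mul, Matrix.transpose_transpose]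
      simp [matAct, matHomeo_apply, this]
    have := congrArg I key
    rw [hc, hδ, hc, map_inv, mul_left_comm] at this
    exact mul_left_cancel₀ c.ne_zero this
  have htrans : ∀ (t : Matrix.TransvectionStruct (Fin n) K) (g : GL (Fin n) K),
      (g : Matrix (Fin n) (Fin n) K) = t.toMatrix → δ g = 1 := by
    rintro ⟨i, j, hij, a⟩ g hg
    have hd : (Matrix.diagonal (Function.update (fun _ : Fin n => (1 : K)) i 2)).det ≠ 0 := by
      rw [Matrix.det_diagonal, Finset.prod_update_of_mem (Finset.mem_univ i)]
      simp
    have hcomm : Matrix.GeneralLinearGroup.mkOfDetNeZero _ hd * g =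
        g * g * Matrix.GeneralLinearGroup.mkOfDetNeZero _ hd := by
      refine Units.ext ?_
      rw [Units.val_mul, Units.val_mul, Units.val_mul, hg]
      change Matrix.diagonal _ * Matrix.transvection i j a =
        Matrix.transvection i j a * Matrix.transvection i j a * Matrix.diagonal _
      rw [Matrix.transvection_mul_transvection_same i j hij]
      ext k l
      rw [Matrix.diagonal_mul, Matrix.mul_diagonal]
      simp only [Matrix.transvection, Matrix.add_apply, Matrix.one_apply, Matrix.single_apply,
        Function.update_apply]
      grind
    have := congrArg δ hcomm
    rw [map_mul, map_mul, map_mul, mul_comm] at this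
    exact (mul_eq_left.1 (mul_right_cancel this).symm)
  have hsymm : ∀ A : Matrix (Fin n) (Fin n) K, A.det ≠ 0 → ∀ g h : GL (Fin n) K,
      (g : Matrix (Fin n) (Fin n) K) = A → (h : Matrix (Fin n) (Fin n) K) = Aᵀ → δ g = δ h := by
    intro A hA
    refine Matrix.diagonal_transvection_induction_of_det_ne_zero
      (fun A => ∀ g h : GL (Fin n) K, (g : Matrix (Fin n) (Fin n) K) = A →
        (h : Matrix (Fin n) (Fin n) K) = Aᵀ → δ g = δ h) A hA ?_ ?_ ?_
    · intro D _ g h hg hh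
      rw [Matrix.diagonal_transpose, ← hg] at hh
      rw [Units.ext hh]
    · rintro ⟨i, j, hij, a⟩ g h hg hh
      rw [htrans _ g hg, htrans ⟨j, i, hij.symm, a⟩ h]
      rw [hh]
      simp [Matrix.TransvectionStruct.toMatrix, Matrix.transvection]
    · intro A B hA hB ihA ihB g h hg hh
      have hA' : Aᵀ.det ≠ 0 := by rwa [Matrix.det_transpose]
      have hB' : Bᵀ.det ≠ 0 := by rwa [Matrix.det_transpose]
      have hg' : g = Matrix.GeneralLinearGroup.mkOfDetNeZero A hA *
          Matrix.GeneralLinearGroup.mkOfDetNeZero B hB := Units.ext hg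
      have hh' : h = Matrix.GeneralLinearGroup.mkOfDetNeZero Bᵀ hB' *
          Matrix.GeneralLinearGroup.mkOfDetNeZero Aᵀ hA' :=
        Units.ext (hh.trans (Matrix.transpose_mul A B))
      rw [hg', hh', map_mul, map_mul, mul_comm,
        ihA (Matrix.GeneralLinearGroup.mkOfDetNeZero A hA)
          (Matrix.GeneralLinearGroup.mkOfDetNeZero Aᵀ hA') rfl rfl,
        ihB (Matrix.GeneralLinearGroup.mkOfDetNeZero B hB)
          (Matrix.GeneralLinearGroup.mkOfDetNeZero Bᵀ hB') rfl rfl]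
  refine ⟨δ, fun g₁ g₂ φ => ?_, hδ1⟩
  have hmul : matAct g₁ g₂ φ = matAct g₁ 1 (matAct 1 g₂ φ) := by
    refine Subtype.ext (funext fun x => ?_)
    simp [matAct, matHomeo_apply]
  have hdet : (g₂ : Matrix (Fin n) (Fin n) K)ᵀ.det ≠ 0 := by
    rw [Matrix.det_transpose]
    exact g₂.det_ne_zero
  rw [hmul, hδ, hright g₂ (Matrix.GeneralLinearGroup.mkOfDetNeZero _ hdet) rfl,
    ← hsymm _ g₂.det_ne_zero g₂ (Matrix.GeneralLinearGroup.mkOfDetNeZero _ hdet) rfl rfl, mul_assoc]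

end Modulus

section Slices

variable {K : Type*} [NontriviallyNormedField K] {n : ℕ}

/-- The restriction of a function on `GL_n` to the matrices whose determinant has norm `t`,
extended by zero to all matrices. -/
noncomputable def sliceWeight (θ : GL (Fin n) K →* ℂˣ) (t : ℝ) (x : Matrix (Fin n) (Fin n) K) : ℂ := by
  classical
  exact if h : x.det ≠ 0 ∧ ‖x.det‖ = t then
    θ (Matrix.GeneralLinearGroup.mkOfDetNeZero x h.1) else 0

theorem sliceWeight_coe {θ : GL (Fin n) K →* ℂˣ} {t : ℝ} {g : GL (Fin n) K}
    (hg : ‖(g : Matrix (Fin n) (Fin n) K).det‖ = t) :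
    sliceWeight θ t (g : Matrix (Fin n) (Fin n) K) = θ g := by
  rw [sliceWeight, dif_pos ⟨g.det_ne_zero, hg⟩]
  exact congrArg (fun g => (θ g : ℂ)) (Units.ext rfl)

theorem sliceWeight_of_norm_det_ne {θ : GL (Fin n) K →* ℂˣ} {t : ℝ} {x : Matrix (Fin n) (Fin n) K}
    (hx : ‖x.det‖ ≠ t) : sliceWeight θ t x = 0 := by
  rw [sliceWeight, dif_neg fun h => hx h.2]

theorem sliceWeight_of_det_eq_zero {θ : GL (Fin n) K →* ℂˣ} {t : ℝ}
    {x : Matrix (Fin n) (Fin n) K} (hx : x.det = 0) : sliceWeight θ t x = 0 := by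
  rw [sliceWeight, dif_neg fun h => h.1 hx]

theorem sliceWeight_mul (θ : GL (Fin n) K →* ℂˣ) (t : ℝ) (g h : GL (Fin n) K)
    (x : Matrix (Fin n) (Fin n) K) :
    sliceWeight θ t ((g : Matrix (Fin n) (Fin n) K) * x * (h : Matrix (Fin n) (Fin n) K)) =
      θ g * θ h * sliceWeight θ (t / (‖(g : Matrix (Fin n) (Fin n) K).det‖ *
        ‖(h : Matrix (Fin n) (Fin n) K).det‖)) x := by
  have hg := norm_ne_zero_iff.2 g.det_ne_zero
  have hh := norm_ne_zero_iff.2 h.det_ne_zero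
  by_cases hx : x.det = 0
  · rw [sliceWeight_of_det_eq_zero hx, sliceWeight_of_det_eq_zero, mul_zero]
    rw [Matrix.det_mul, Matrix.det_mul, hx, mul_zero, zero_mul]
  · obtain ⟨y, rfl⟩ : ∃ y : GL (Fin n) K, (y : Matrix (Fin n) (Fin n) K) = x :=
      ⟨Matrix.GeneralLinearGroup.mkOfDetNeZero x hx, rfl⟩
    have hiff : ‖((g * y * h : GL (Fin n) K) : Matrix (Fin n) (Fin n) K).det‖ = t ↔
        ‖(y : Matrix (Fin n) (Fin n) K).det‖ = t / (‖(g : Matrix (Fin n) (Fin n) K).det‖ *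
          ‖(h : Matrix (Fin n) (Fin n) K).det‖) := by
      rw [Units.val_mul, Units.val_mul, Matrix.det_mul, Matrix.det_mul, norm_mul, norm_mul,
        eq_div_iff (mul_ne_zero hg hh)]
      ring_nf
    rw [← Units.val_mul, ← Units.val_mul]
    by_cases ht : ‖((g * y * h : GL (Fin n) K) : Matrix (Fin n) (Fin n) K).det‖ = t
    · rw [sliceWeight_coe ht, sliceWeight_coe (hiff.1 ht), map_mul, map_mul, Units.val_mul,
        Units.val_mul]
      ring
    · rw [sliceWeight_of_norm_det_ne ht, sliceWeight_of_norm_det_ne fun h => ht (hiff.2 h), mul_zero]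

theorem isLocallyConstant_sliceWeight [IsUltrametricDist K] [LocallyCompactSpace K]
    {θ : GL (Fin n) K →* ℂˣ} {ε : ℝ} (hε0 : 0 < ε) (hε : ε < 1)
    (hθ : ∀ k : GL (Fin n) K, (∀ i j, ‖(k : Matrix (Fin n) (Fin n) K) i j -
      (1 : Matrix (Fin n) (Fin n) K) i j‖ ≤ ε) → θ k = 1) (t : ℝ) :
    IsLocallyConstant (sliceWeight θ t) := by
  refine (IsLocallyConstant.iff_eventually_eq _).2 fun x => ?_
  by_cases hx : x.det = 0
  · rw [sliceWeight_of_det_eq_zero hx]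
    rcases eq_or_ne t 0 with rfl | ht
    · refine Filter.Eventually.of_forall fun y => ?_
      by_cases hy : y.det = 0
      · exact sliceWeight_of_det_eq_zero hy
      · exact sliceWeight_of_norm_det_ne (norm_ne_zero_iff.2 hy)
    · have hcont : Continuous fun y : Matrix (Fin n) (Fin n) K => ‖y.det‖ := by fun_prop
      have := hcont.continuousAt.eventually_ne (x := x) (y := t) (by simpa [hx] using ht.symm)
      filter_upwards [this] with y hy using sliceWeight_of_norm_det_ne hy
  · obtain ⟨g, rfl⟩ : ∃ g : GL (Fin n) K, (g : Matrix (Fin n) (Fin n) K) = x :=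
      ⟨Matrix.GeneralLinearGroup.mkOfDetNeZero x hx, rfl⟩
    have hbox := (isClopen_isCompact_colBox (n := n) (e := fun _ => ε) (fun _ => hε0)
      (1 : Matrix (Fin n) (Fin n) K)).1.isOpen
    have hnhds : matHomeo g 1 ⁻¹' colBox (fun _ => ε) 1 ∈ nhds (g : Matrix (Fin n) (Fin n) K) := by
      refine (hbox.preimage (matHomeo g 1).continuous).mem_nhds fun i j => ?_
      simp [matHomeo_apply, hε0.le]
    filter_upwards [hnhds] with y hy
    have hk : ∀ i j, ‖(matHomeo g 1 y) i j - (1 : Matrix (Fin n) (Fin n) K) i j‖ ≤ ε := hy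
    have hki : IsIntegralMatrix (matHomeo g 1 y) := fun i j => by
      rw [← sub_add_cancel (matHomeo g 1 y i j) ((1 : Matrix (Fin n) (Fin n) K) i j)]
      exact norm_add_le_of_le_ultra ((hk i j).trans hε.le) (isIntegralMatrix_one i j)
    have hdet : ‖(matHomeo g 1 y).det‖ = 1 := by
      refine norm_eq_one_of_norm_sub_lt (lt_of_le_of_lt ?_ hε)
      rw [← Matrix.det_one (n := Fin n) (R := K)]
      exact norm_det_sub_det_le hε0.le hki isIntegralMatrix_one hk
    obtain ⟨k, hk'⟩ : ∃ k : GL (Fin n) K, (k : Matrix (Fin n) (Fin n) K) = matHomeo g 1 y :=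
      ⟨Matrix.GeneralLinearGroup.mkOfDetNeZero _ (norm_ne_zero_iff.1 (by rw [hdet]; exact one_ne_zero)),
        rfl⟩
    have hy : y = 1 * (g : Matrix (Fin n) (Fin n) K) * (k : Matrix (Fin n) (Fin n) K) := by
      rw [hk', matHomeo_apply, Matrix.one_mul, ← Matrix.mul_assoc, ← Matrix.mul_assoc,
        ← Units.val_mul, mul_inv_cancel]
      simp
    have := sliceWeight_mul θ t 1 k (g : Matrix (Fin n) (Fin n) K)
    rw [Units.val_one] at this
    rw [hy, this, hθ k (by rw [hk']; exact hk), hk', hdet]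
    simp

end Slices

section Existence

/-- The multiplicative dilates of a function on the line. -/
noncomputable def dilate (q : ℝ) (f : ℝ → ℂ) (j : ℤ) : ℝ → ℂ := fun t => f (t / q ^ j)

theorem linearIndependent_dilate {q : ℝ} (hq0 : 0 < q) (hq1 : q < 1) {f : ℝ → ℂ}
    (hf : ∀ t, 1 < t → f t = 0) (hf1 : f 1 ≠ 0) : LinearIndependent ℂ (dilate q f) := by
  rw [linearIndependent_iff']
  intro s c hsum
  by_contra! hne
  obtain ⟨i₀, hi₀, hci₀⟩ := hne
  obtain ⟨i, hi, hmin⟩ := (s.filter fun i => c i ≠ 0).exists_min_image id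
    ⟨i₀, Finset.mem_filter.2 ⟨hi₀, hci₀⟩⟩
  obtain ⟨his, hci⟩ := Finset.mem_filter.1 hi
  have h := congrFun hsum (q ^ i)
  rw [Finset.sum_apply, Finset.sum_eq_single_of_mem i his] at h
  · rw [Pi.smul_apply, dilate, div_self (zpow_pos hq0 i).ne', Pi.zero_apply, smul_eq_zero] at h
    exact h.elim hci hf1
  · intro j hj hji
    rw [Pi.smul_apply]
    by_cases hcj : c j = 0
    · rw [hcj, zero_smul]
    · have hij : i < j := lt_of_le_of_ne (hmin j (Finset.mem_filter.2 ⟨hj, hcj⟩)) hji.symm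
      rw [dilate, hf, smul_zero]
      rw [one_lt_div (zpow_pos hq0 j)]
      exact zpow_lt_zpow_right_of_lt_one₀ hq0 hq1 hij

variable {K : Type*} [NontriviallyNormedField K] {n : ℕ}

/-- The twisted action of the multiplicative group on functions of the norm. -/
noncomputable def twistedTranslation (χ : Kˣ →* ℂˣ) : Kˣ →* Module.End ℂ (ℝ → ℂ) where
  toFun a :=
    { toFun := fun F t => χ a * F (t / ‖(a : K)‖)
      map_add' := fun F G => funext fun t => mul_add _ _ _
      map_smul' := fun c F => funext fun t => mul_left_comm _ _ _ }
  map_one' := by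
    ext F t
    simp
  map_mul' a b := by
    ext F t
    simp [mul_assoc, div_div]

theorem twistedTranslation_apply (χ : Kˣ →* ℂˣ) (a : Kˣ) (F : ℝ → ℂ) (t : ℝ) :
    twistedTranslation χ a F t = χ a * F (t / ‖(a : K)‖) := rfl

theorem twistedTranslation_dilate (χ : Kˣ →* ℂˣ) {q : ℝ} (hq0 : q ≠ 0) (f : ℝ → ℂ) {a : Kˣ} {m : ℤ}
    (ha : ‖(a : K)‖ = q ^ m) (j : ℤ) :
    twistedTranslation χ a (dilate q f j) = (χ a : ℂ) • dilate q f (m + j) := by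
  ext t
  rw [twistedTranslation_apply, dilate, Pi.smul_apply, dilate, ha, div_div, zpow_add₀ hq0,
    smul_eq_mul]

/-- A linear form on functions of the norm that is equivariant on the span of the dilates. -/
theorem exists_equivariant_form (χ : Kˣ →* ℂˣ) {q : ℝ} (hq0 : 0 < q) (hq1 : q < 1)
    (hq : ∀ a : Kˣ, ∃ m : ℤ, ‖(a : K)‖ = q ^ m) {f : ℝ → ℂ}
    (hf : ∀ t, 1 < t → f t = 0) (hf1 : f 1 ≠ 0) :
    ∃ (P : Submodule ℂ (ℝ → ℂ)) (l : (ℝ → ℂ) →ₗ[ℂ] ℂ), f ∈ P ∧ l f = 1 ∧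
      ∀ a, ∀ v ∈ P, twistedTranslation χ a v ∈ P ∧ l (twistedTranslation χ a v) = χ a * l v := by
  have hli := linearIndependent_dilate hq0 hq1 hf hf1
  obtain ⟨l, hl⟩ := LinearMap.exists_extend ((Module.Basis.span hli).constr ℂ fun _ => (1 : ℂ))
  have hlj : ∀ j, l (dilate q f j) = 1 := fun j => by
    have h := LinearMap.congr_fun hl (Module.Basis.span hli j)
    rwa [Module.Basis.constr_basis, LinearMap.comp_apply, Submodule.subtype_apply,
      Module.Basis.span_apply] at h
  have hzero : dilate q f 0 = f := by
    ext t
    simp [dilate]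
  refine ⟨Submodule.span ℂ (Set.range (dilate q f)), l, Submodule.subset_span ⟨0, hzero⟩,
    by rw [← hlj 0, hzero], fun a v hv => ?_⟩
  obtain ⟨m, hm⟩ := hq a
  induction hv using Submodule.span_induction with
  | mem v hv =>
    obtain ⟨j, rfl⟩ := hv
    rw [twistedTranslation_dilate χ hq0.ne' f hm, map_smul, hlj, hlj, smul_eq_mul]
    exact ⟨Submodule.smul_mem _ _ (Submodule.subset_span ⟨_, rfl⟩), rfl⟩
  | zero => simp
  | add v w _ _ hv hw =>
    rw [map_add, map_add, map_add, hv.2, hw.2, mul_add]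
    exact ⟨Submodule.add_mem _ hv.1 hw.1, rfl⟩
  | smul c v _ hv =>
    rw [map_smul, map_smul, map_smul, hv.2, smul_eq_mul, smul_eq_mul, mul_left_comm]
    exact ⟨Submodule.smul_mem _ _ hv.1, rfl⟩

/-- The integrals of a Schwartz function over the sets where the norm of the determinant is
fixed, against a multiplicative measure. -/
theorem exists_slice_integral [IsUltrametricDist K] [LocallyCompactSpace K] [CharZero K]
    {χ : Kˣ →* ℂˣ} (hχ : IsLocallyConstant fun a : Kˣ => (χ a : ℂ)) :
    ∃ Z : SchwartzBZ (Matrix (Fin n) (Fin n) K) →ₗ[ℂ] (ℝ → ℂ),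
      IsSemiInvariant (twistedTranslation χ) Z ∧
      ∀ W, IsClopen W ∧ IsCompact W → 1 ∈ W → (∀ x ∈ W, IsIntegralMatrix x) →
        (∀ x ∈ W, ∀ u : Kˣ, (u : K) = x.det → ‖(u : K)‖ = 1 → χ u = 1) →
        (∀ t, 1 < t → Z (SchwartzBZ.ind W) t = 0) ∧ Z (SchwartzBZ.ind W) 1 ≠ 0 := by
  have : LocallyCompactSpace (Matrix (Fin n) (Fin n) K) :=
    inferInstanceAs (LocallyCompactSpace (Fin n → Fin n → K))
  obtain ⟨I, hI, hne⟩ := SchwartzBZ.exists_translation_invariant (Matrix (Fin n) (Fin n) K)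
  obtain ⟨δ, hδ, hδ1⟩ := exists_modulus hI hne
  obtain ⟨ϖ, h0, h1, -⟩ := exists_uniformizer (K := K)
  obtain ⟨b, hb, hχb⟩ := exists_pow_forall_eq_one h1 hχ
  have hϖ : 0 < ‖ϖ‖ := norm_pos_iff.2 h0
  have hε := pow_lt_one₀ hϖ.le h1 hb
  let θ : GL (Fin n) K →* ℂˣ := (χ.comp Matrix.GeneralLinearGroup.det) * δ⁻¹
  have hθ : ∀ g, θ g = χ (Matrix.GeneralLinearGroup.det g) * (δ g)⁻¹ := fun g => rfl
  have hθ1 : ∀ k : GL (Fin n) K, (∀ i j, ‖(k : Matrix (Fin n) (Fin n) K) i j -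
      (1 : Matrix (Fin n) (Fin n) K) i j‖ ≤ ‖ϖ‖ ^ b) → θ k = 1 := by
    intro k hk
    have hki : IsIntegralMatrix (k : Matrix (Fin n) (Fin n) K) := fun i j => by
      rw [← sub_add_cancel ((k : Matrix (Fin n) (Fin n) K) i j)
        ((1 : Matrix (Fin n) (Fin n) K) i j)]
      exact norm_add_le_of_le_ultra ((hk i j).trans hε.le) (isIntegralMatrix_one i j)
    have hdet : ‖(k : Matrix (Fin n) (Fin n) K).det - 1‖ ≤ ‖ϖ‖ ^ b := by
      rw [← Matrix.det_one (n := Fin n) (R := K)]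
      exact norm_det_sub_det_le (pow_pos hϖ b).le hki isIntegralMatrix_one hk
    rw [hθ, hδ1 k hki (norm_eq_one_of_norm_sub_lt (hdet.trans_lt hε)), hχb _ hdet, inv_one, mul_one]
  have hw := isLocallyConstant_sliceWeight (pow_pos hϖ b) hε hθ1
  let Z : SchwartzBZ (Matrix (Fin n) (Fin n) K) →ₗ[ℂ] (ℝ → ℂ) :=
    LinearMap.pi fun t => I ∘ₗ SchwartzBZ.mulLeft (sliceWeight θ t) (hw t)
  have hZ : ∀ φ t, Z φ t = I (SchwartzBZ.mulLeft (sliceWeight θ t) (hw t) φ) := fun _ _ => rfl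
  refine ⟨Z, fun g₁ g₂ φ => funext fun t => ?_, fun W hW hW1 hWi hWχ => ⟨fun t ht => ?_, ?_⟩⟩
  · have hnorm : ‖((Matrix.GeneralLinearGroup.det g₁ *
        (Matrix.GeneralLinearGroup.det g₂)⁻¹ : Kˣ) : K)‖ =
        ‖(g₁ : Matrix (Fin n) (Fin n) K).det‖ *
          ‖((g₂⁻¹ : GL (Fin n) K) : Matrix (Fin n) (Fin n) K).det‖ := by
      rw [← map_inv, Units.val_mul, norm_mul]
      rfl
    rw [twistedTranslation_apply, hnorm, hZ, hZ]
    set s := t / (‖(g₁ : Matrix (Fin n) (Fin n) K).det‖ *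
      ‖((g₂⁻¹ : GL (Fin n) K) : Matrix (Fin n) (Fin n) K).det‖) with hs
    have hmul : SchwartzBZ.mulLeft (sliceWeight θ t) (hw t) (matAct g₁ g₂ φ) =
        matAct g₁ g₂
          (((θ g₁ : ℂ) * θ g₂⁻¹) • SchwartzBZ.mulLeft (sliceWeight θ s) (hw s) φ) := by
      refine Subtype.ext (funext fun x => ?_)
      have hx : (g₁ : Matrix (Fin n) (Fin n) K) * matHomeo g₁ g₂ x * (g₂⁻¹ : GL (Fin n) K) = x :=
        (matHomeo g₁ g₂).symm_apply_apply x
      have := sliceWeight_mul θ t g₁ g₂⁻¹ (matHomeo g₁ g₂ x)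
      rw [hx] at this
      rw [SchwartzBZ.mulLeft_apply, this]
      exact mul_assoc _ _ _
    rw [hmul, hδ, map_smul, smul_eq_mul, hθ, hθ, map_mul, map_inv, map_inv, map_inv, inv_inv]
    push_cast
    have e1 := (δ g₁).ne_zero
    have e2 := (δ g₂).ne_zero
    field_simp
  · rw [hZ]
    have : SchwartzBZ.mulLeft (sliceWeight θ t) (hw t) (SchwartzBZ.ind W) = 0 := by
      refine Subtype.ext (funext fun x => ?_)
      rw [SchwartzBZ.mulLeft_apply]
      by_cases hx : x ∈ W
      · rw [sliceWeight_of_norm_det_ne ((hWi x hx).norm_det_le.trans_lt ht).ne, zero_mul]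
        rfl
      · rw [SchwartzBZ.ind_of_notMem hW hx, mul_zero]
        rfl
    rw [this, map_zero]
  · rw [hZ]
    have hclopen : IsClopen {x : Matrix (Fin n) (Fin n) K | ‖x.det‖ = 1} := by
      have hcont : Continuous fun x : Matrix (Fin n) (Fin n) K => x.det := by fun_prop
      have : {x : Matrix (Fin n) (Fin n) K | ‖x.det‖ = 1} =
          (fun x => x.det) ⁻¹' Metric.sphere (0 : K) 1 := by
        ext x
        simp
      rw [this]
      exact ⟨Metric.isClosed_sphere.preimage hcont,
        (IsUltrametricDist.isOpen_sphere 0 one_ne_zero).preimage hcont⟩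
    have hW' : IsClopen (W ∩ {x | ‖x.det‖ = 1}) ∧ IsCompact (W ∩ {x | ‖x.det‖ = 1}) :=
      ⟨hW.1.inter hclopen, hW.2.inter_right hclopen.isClosed⟩
    have : SchwartzBZ.mulLeft (sliceWeight θ 1) (hw 1) (SchwartzBZ.ind W) =
        SchwartzBZ.ind (W ∩ {x | ‖x.det‖ = 1}) := by
      refine Subtype.ext (funext fun x => ?_)
      rw [SchwartzBZ.mulLeft_apply]
      by_cases hx : x ∈ W
      · by_cases hdet : ‖x.det‖ = 1
        · obtain ⟨g, rfl⟩ : ∃ g : GL (Fin n) K, (g : Matrix (Fin n) (Fin n) K) = x :=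
            ⟨Matrix.GeneralLinearGroup.mkOfDetNeZero x
              (norm_ne_zero_iff.1 (by rw [hdet]; exact one_ne_zero)), rfl⟩
          rw [SchwartzBZ.ind_of_mem hW hx, SchwartzBZ.ind_of_mem hW' ⟨hx, hdet⟩,
            sliceWeight_coe hdet, hθ, hδ1 g (hWi _ hx) hdet, hWχ _ hx _ rfl hdet]
          simp
        · rw [SchwartzBZ.ind_of_notMem hW' fun h => hdet h.2, sliceWeight_of_norm_det_ne hdet,
            zero_mul]
      · rw [SchwartzBZ.ind_of_notMem hW hx, SchwartzBZ.ind_of_notMem hW' fun h => hx h.1, mul_zero]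
    rw [this]
    exact hne _ hW'.1 hW'.2 ⟨1, hW1, by simp⟩

end Existence

section Main

variable {K : Type*} [NontriviallyNormedField K] {n : ℕ}

/-- Multiplication by the values of a character. -/
noncomputable def scalarAction (χ : Kˣ →* ℂˣ) : Kˣ →* Module.End ℂ ℂ :=
  (algebraMap ℂ (Module.End ℂ ℂ) : ℂ →* Module.End ℂ ℂ).comp ((Units.coeHom ℂ).comp χ)

theorem scalarAction_apply (χ : Kˣ →* ℂˣ) (a : Kˣ) (c : ℂ) : scalarAction χ a c = (χ a : ℂ) • c :=
  rfl

theorem isMatInvDistrib_iff {χ : Kˣ →* ℂˣ}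
    {η : SchwartzBZ (Matrix (Fin n) (Fin n) K) →ₗ[ℂ] ℂ} :
    IsMatInvDistrib χ η ↔ IsSemiInvariant (scalarAction χ) η := by
  have hc : ∀ a b : Kˣ, ∀ c : ℂ, scalarAction χ (a * b⁻¹) c = (χ a : ℂ) * ((χ b)⁻¹ : ℂˣ) * c :=
    fun a b c => by rw [scalarAction_apply, map_mul, map_inv, Units.val_mul, smul_eq_mul]
  constructor
  · intro h g₁ g₂ φ
    rw [hc]
    exact h g₁ g₂ φ (matAct g₁ g₂ φ) fun x => rfl
  · intro h g₁ g₂ φ ψ hψ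
    have : ψ = matAct g₁ g₂ φ := Subtype.ext (funext hψ)
    rw [this, h, hc]

end Main

/-- Let `k` be a non-archimedean local field of characteristic zero and
let `G = GL_n(k) × GL_n(k)` act on `M_n(k)` by `(g₁,g₂)·x = g₁ x g₂⁻¹`.  For every locally
constant character `χ` of `k^×`, the space of `(χ,χ⁻¹)`-invariant distributions on `M_n(k)`
is exactly one-dimensional. -/
theorem matrix_semiInvariant_distributions_one_dimensional
    (K : Type*) [NontriviallyNormedField K] [LocallyCompactSpace K]
    [TotallyDisconnectedSpace K] [CharZero K]
    (n : ℕ) (hn : 0 < n)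
    (χ : Kˣ →* ℂˣ) (hχ : IsLocallyConstant fun a : Kˣ => (χ a : ℂ)) :
    ∃ η₀ : SchwartzBZ (Matrix (Fin n) (Fin n) K) →ₗ[ℂ] ℂ,
      IsMatInvDistrib χ η₀ ∧ η₀ ≠ 0 ∧
      ∀ η : SchwartzBZ (Matrix (Fin n) (Fin n) K) →ₗ[ℂ] ℂ,
        IsMatInvDistrib χ η → ∃ c : ℂ, η = c • η₀ := by
  have : IsUltrametricDist K := isUltrametricDist_of_totallyDisconnectedSpace
  obtain ⟨ϖ, h0, h1, hm⟩ := exists_uniformizer (K := K)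
  obtain ⟨ε, r, hε0, hε1, hχW, hgen⟩ := exists_generating_stepBox n h0 h1 hm hχ
  obtain ⟨Z, hZ, hZW⟩ := exists_slice_integral (n := n) hχ
  have hone : (1 : Matrix (Fin n) (Fin n) K) ∈ stepBox K n ε r :=
    mem_stepBox.2 ⟨fun i j _ => by simpa using hε0.le, fun i j _ => isIntegralMatrix_one i j⟩
  obtain ⟨hf, hf1⟩ := hZW _ (isClopen_isCompact_stepBox hε0 r) hone
    (fun x hx => isIntegralMatrix_of_mem_stepBox hε1.le hx) hχW
  obtain ⟨P, l, hfP, hlf, hP⟩ := exists_equivariant_form χ (norm_pos_iff.2 h0) h1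
    (fun a => exists_norm_eq_zpow h0 h1 hm a.ne_zero) hf hf1
  have hmem : ∀ φ, Z φ ∈ P := hgen _ (twistedTranslation χ) Z P
    (fun u hu F => funext fun t => by
      rw [twistedTranslation_apply, hu, div_one, Pi.smul_apply, smul_eq_mul])
    hZ (fun a v hv => (hP a v hv).1) hfP
  have hη₀ : IsSemiInvariant (scalarAction χ) (l ∘ₗ Z) := fun g₁ g₂ φ => by
    rw [LinearMap.comp_apply, hZ, (hP _ _ (hmem φ)).2]
    rfl
  have hval : (l ∘ₗ Z) (SchwartzBZ.ind (stepBox K n ε r)) = 1 := hlf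
  refine ⟨l ∘ₗ Z, isMatInvDistrib_iff.2 hη₀, fun h => ?_, fun η hη => ?_⟩
  · rw [h] at hval
    exact zero_ne_one hval
  · refine ⟨η (SchwartzBZ.ind (stepBox K n ε r)), LinearMap.ext fun φ => ?_⟩
    have hη := isMatInvDistrib_iff.1 hη
    rw [← sub_eq_zero, ← LinearMap.sub_apply, ← Submodule.mem_bot ℂ]
    refine hgen ℂ (scalarAction χ) _ ⊥ (fun u _ v => rfl) (fun g₁ g₂ φ => ?_)
      (fun a v hv => ?_) ?_ φ
    · rw [LinearMap.sub_apply, LinearMap.sub_apply, LinearMap.smul_apply, LinearMap.smul_apply, hη,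
        hη₀, map_sub, map_smul]
    · rw [(Submodule.mem_bot ℂ).1 hv, map_zero]
      exact Submodule.zero_mem _
    · rw [Submodule.mem_bot, LinearMap.sub_apply, LinearMap.smul_apply, hval, smul_eq_mul, mul_one,
        sub_self]
end
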